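/- arXiv:2309.12248 — 5 statements merged into one kernel-verified Lean document; each statement's English description precedes it below -/
import Mathlib

section
/- Let G1 = (V1, E1) and G2 = (V2, E2) be rigidity circuits such that V1 ∩ V2 = {u, v} for two distinct vertices u, v, and E1 ∩ E2 = {uv} (i.e., uv is the unique common edge). Then the 2-sum G = (V1 ∪ V2, (E1 ∪ E2) \ {uv}) is a rigidity circuit. -/
open scoped Classical

noncomputable section

/-- The set of edges of `E` with both endpoints in `V'`. -/
def spans (E : Finset (Sym2 ℕ)) (V' : Finset ℕ) : Finset (Sym2 ℕ) :=
  E.filter (fun e => ∀ v ∈ e, v ∈ V')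

/-- `(V, E)` is a simple graph: edges are non-loops with both endpoints in `V`. -/
def IsGraph (V : Finset ℕ) (E : Finset (Sym2 ℕ)) : Prop :=
  ∀ e ∈ E, ¬ e.IsDiag ∧ ∀ v ∈ e, v ∈ V

/-- A rigidity circuit: a simple graph with `|E| = 2|V| - 2` such that every proper
subset `V' ⊊ V` with `|V'| ≥ 2` spans at most `2|V'| - 3` edges. -/
def IsRigidityCircuit (V : Finset ℕ) (E : Finset (Sym2 ℕ)) : Prop :=
  IsGraph V E ∧ E.card = 2 * V.card - 2 ∧
    ∀ V' ⊂ V, 2 ≤ V'.card → (spans E V').card ≤ 2 * V'.card - 3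

theorem spans_eq_empty_of_card_le_one {V X : Finset ℕ} {E : Finset (Sym2 ℕ)} (hG : IsGraph V E)
    (hX : X.card ≤ 1) : spans E X = ∅ := by
  refine Finset.filter_eq_empty_iff.2 fun e he h => (hG e he).1 ?_
  induction e with
  | _ a b =>
    exact Finset.card_le_one.1 hX a (h a (Sym2.mem_mk_left a b)) b (h b (Sym2.mem_mk_right a b))

theorem spans_self {V : Finset ℕ} {E : Finset (Sym2 ℕ)} (hG : IsGraph V E) : spans E V = E :=
  Finset.filter_true_of_mem fun e he => (hG e he).2

/-- A proper subset of the vertices of a rigidity circuit either has at most one element and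
spans no edge, or satisfies the sparsity count. -/
theorem IsRigidityCircuit.card_spans_of_ssubset {V X : Finset ℕ} {E : Finset (Sym2 ℕ)}
    (h : IsRigidityCircuit V E) (hX : X ⊂ V) :
    (X.card ≤ 1 ∧ (spans E X).card = 0) ∨ (spans E X).card + 3 ≤ 2 * X.card := by
  by_cases hc : X.card ≤ 1
  · exact Or.inl ⟨hc, by rw [spans_eq_empty_of_card_le_one h.1 hc, Finset.card_empty]⟩
  · have := h.2.2 X hX (by omega)
    omega

/-- The spanned edges of a union of two graphs, minus a given edge, are covered by the spanned
edges of the traces of the vertex set on the two parts. -/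
theorem card_spans_union_sdiff_le {V1 V2 : Finset ℕ} {E1 E2 : Finset (Sym2 ℕ)}
    (h1 : IsGraph V1 E1) (h2 : IsGraph V2 E2) (e : Sym2 ℕ) (X : Finset ℕ) :
    (spans ((E1 ∪ E2) \ {e}) X).card ≤
      ((spans E1 (X ∩ V1)).erase e).card + ((spans E2 (X ∩ V2)).erase e).card := by
  refine (Finset.card_le_card fun f hf => ?_).trans (Finset.card_union_le _ _)
  simp only [spans, Finset.mem_filter, Finset.mem_sdiff, Finset.mem_union, Finset.mem_singleton,
    Finset.mem_erase, Finset.mem_inter] at hf ⊢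
  obtain ⟨⟨hf | hf, hne⟩, hX⟩ := hf
  · exact Or.inl ⟨hne, hf, fun w hw => ⟨hX w hw, (h1 f hf).2 w hw⟩⟩
  · exact Or.inr ⟨hne, hf, fun w hw => ⟨hX w hw, (h2 f hf).2 w hw⟩⟩

/-- Deleting a spanned edge from a rigidity circuit leaves one edge less in each spanned set. -/
theorem IsRigidityCircuit.card_spans_erase {V X : Finset ℕ} {E : Finset (Sym2 ℕ)} {u v : ℕ}
    (h : IsRigidityCircuit V E) (he : s(u, v) ∈ E) (hu : u ∈ X) (hv : v ∈ X) (hX : X ⊆ V) :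
    ((spans E X).erase s(u, v)).card + 3 ≤ 2 * X.card ∧
      (X ≠ V → ((spans E X).erase s(u, v)).card + 4 ≤ 2 * X.card) := by
  have huv : u ≠ v := (h.1 _ he).1
  have hmem : s(u, v) ∈ spans E X := by simp [spans, he, hu, hv]
  have hc : 2 ≤ X.card := Finset.one_lt_card.2 ⟨u, hu, v, hv, huv⟩
  have hpos := Finset.card_pos.2 ⟨_, hmem⟩
  rw [Finset.card_erase_of_mem hmem]
  by_cases hXV : X = V
  · subst hXV
    rw [spans_self h.1, h.2.1]
    exact ⟨by omega, fun hne => (hne rfl).elim⟩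
  · have := h.2.2 X (hX.ssubset_of_ne hXV) hc
    exact ⟨by omega, fun _ => by omega⟩

/-- The 2-sum of two rigidity circuits sharing exactly the two vertices `u, v` and
exactly the edge `uv` is a rigidity circuit. -/
theorem twoSum_isRigidityCircuit (V1 V2 : Finset ℕ) (E1 E2 : Finset (Sym2 ℕ)) (u v : ℕ)
    (h1 : IsRigidityCircuit V1 E1) (h2 : IsRigidityCircuit V2 E2)
    (huv : u ≠ v) (hV : V1 ∩ V2 = {u, v}) (hE : E1 ∩ E2 = {s(u, v)}) :
    IsRigidityCircuit (V1 ∪ V2) ((E1 ∪ E2) \ {s(u, v)}) := by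
  have he : s(u, v) ∈ E1 ∩ E2 := by simp [hE]
  obtain ⟨he1, he2⟩ := Finset.mem_inter.1 he
  have hu : u ∈ V1 ∩ V2 := by simp [hV]
  have hv : v ∈ V1 ∩ V2 := by simp [hV]
  obtain ⟨hu1, hu2⟩ := Finset.mem_inter.1 hu
  obtain ⟨hv1, hv2⟩ := Finset.mem_inter.1 hv
  refine ⟨fun e he => ?_, ?_, fun X hX hXc => ?_⟩
  · obtain he | he := Finset.mem_union.1 (Finset.mem_sdiff.1 he).1
    · exact ⟨(h1.1 e he).1, fun w hw => Finset.mem_union_left _ ((h1.1 e he).2 w hw)⟩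
    · exact ⟨(h2.1 e he).1, fun w hw => Finset.mem_union_right _ ((h2.1 e he).2 w hw)⟩
  · have hVc := Finset.card_union_add_card_inter V1 V2
    have hEc := Finset.card_union_add_card_inter E1 E2
    have hc1 : 2 ≤ V1.card := Finset.one_lt_card.2 ⟨u, hu1, v, hv1, huv⟩
    have hc2 : 2 ≤ V2.card := Finset.one_lt_card.2 ⟨u, hu2, v, hv2, huv⟩
    rw [hV, Finset.card_pair huv] at hVc
    rw [hE, Finset.card_singleton, h1.2.1, h2.2.1] at hEc
    rw [Finset.card_sdiff_of_subset (by simp [he1]), Finset.card_singleton]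
    omega
  · have hle := card_spans_union_sdiff_le h1.1 h2.1 s(u, v) X
    have hXi := Finset.card_union_add_card_inter (X ∩ V1) (X ∩ V2)
    rw [← Finset.inter_union_distrib_left, Finset.inter_eq_left.2 hX.1,
      ← Finset.inter_inter_distrib_left, hV] at hXi
    by_cases hmem : u ∈ X ∧ v ∈ X
    · obtain ⟨huX, hvX⟩ := hmem
      have hinter : X ∩ {u, v} = {u, v} :=
        Finset.inter_eq_right.2 (by simp [Finset.insert_subset_iff, huX, hvX])
      rw [hinter, Finset.card_pair huv] at hXi
      obtain ⟨ha, ha'⟩ := h1.card_spans_erase he1 (Finset.mem_inter.2 ⟨huX, hu1⟩)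
        (Finset.mem_inter.2 ⟨hvX, hv1⟩) Finset.inter_subset_right
      obtain ⟨hb, hb'⟩ := h2.card_spans_erase he2 (Finset.mem_inter.2 ⟨huX, hu2⟩)
        (Finset.mem_inter.2 ⟨hvX, hv2⟩) Finset.inter_subset_right
      by_cases hX1 : X ∩ V1 = V1
      · have hX2 : X ∩ V2 ≠ V2 := fun hX2 =>
          hX.2 (Finset.union_subset (Finset.inter_eq_right.1 hX1) (Finset.inter_eq_right.1 hX2))
        have := hb' hX2
        omega
      · have := ha' hX1
        omega
    · have hproper {V : Finset ℕ} (hu : u ∈ V) (hv : v ∈ V) : X ∩ V ⊂ V :=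
        Finset.inter_subset_right.ssubset_of_ne fun h =>
          hmem ⟨Finset.inter_eq_right.1 h hu, Finset.inter_eq_right.1 h hv⟩
      have hinter : (X ∩ {u, v}).card < ({u, v} : Finset ℕ).card :=
        Finset.card_lt_card (hproper (by simp) (by simp))
      rw [Finset.card_pair huv] at hinter
      have ha := Finset.card_erase_le (s := spans E1 (X ∩ V1)) (a := s(u, v))
      have hb := Finset.card_erase_le (s := spans E2 (X ∩ V2)) (a := s(u, v))
      have hc1 := Finset.card_le_card (Finset.inter_subset_left (s₁ := X) (s₂ := V1))
      have hc2 := Finset.card_le_card (Finset.inter_subset_left (s₁ := X) (s₂ := V2))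
      have hs1 := h1.card_spans_of_ssubset (hproper hu1 hv1)
      have hs2 := h2.card_spans_of_ssubset (hproper hu2 hv2)
      omega

end
end

section
/- Let G = (V, E) be a rigidity circuit and let u, v be two distinct non-adjacent vertices of G forming a separating pair, i.e., V = V1 ∪ V2 with V1 ∩ V2 = {u, v}, both V1 \ {u,v} and V2 \ {u,v} nonempty, and no edge of G joins a vertex of V1 \ {u,v} to a vertex of V2 \ {u,v}. Let G1 = (V1, E(G[V1]) ∪ {uv}) and G2 = (V2, E(G[V2]) ∪ {uv}) be the two graphs obtained by a 2-split of G along {u,v}, where G[Vi] denotes the subgraph of G induced by Vi. Then both G1 and G2 are rigidity circuits. -/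
open scoped Classical

noncomputable section

lemma mem_spans {E : Finset (Sym2 ℕ)} {W : Finset ℕ} {a b : ℕ} :
    s(a, b) ∈ spans E W ↔ s(a, b) ∈ E ∧ a ∈ W ∧ b ∈ W := by
  simp [spans]

lemma spans_mono (E : Finset (Sym2 ℕ)) {W X : Finset ℕ} (h : W ⊆ X) : spans E W ⊆ spans E X :=
  Finset.monotone_filter_right E fun _ _ he v hv => h (he v hv)

/-- Vertex sets meeting exactly in a non-adjacent pair span disjoint sets of edges. -/
lemma disjoint_spans {W X : Finset ℕ} {E : Finset (Sym2 ℕ)} {u v : ℕ}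
    (hloop : ∀ e ∈ E, ¬ e.IsDiag) (hnonadj : s(u, v) ∉ E) (hinter : W ∩ X = {u, v}) :
    Disjoint (spans E W) (spans E X) := by
  rw [Finset.disjoint_left]
  intro e
  induction e with | _ a b
  intro h1 h2
  rw [mem_spans] at h1 h2
  have ha : a ∈ ({u, v} : Finset ℕ) := hinter ▸ Finset.mem_inter.2 ⟨h1.2.1, h2.2.1⟩
  have hb : b ∈ ({u, v} : Finset ℕ) := hinter ▸ Finset.mem_inter.2 ⟨h1.2.2, h2.2.2⟩
  have hab := hloop _ h1.1
  simp only [Finset.mem_insert, Finset.mem_singleton] at ha hb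
  rcases ha with rfl | rfl <;> rcases hb with rfl | rfl
  · exact hab rfl
  · exact hnonadj h1.1
  · exact hnonadj (Sym2.eq_swap ▸ h1.1)
  · exact hab rfl

/-- The edges of a graph separated by `{u, v}` are covered by the two sides. -/
lemma subset_spans_union {V1 V2 : Finset ℕ} {E : Finset (Sym2 ℕ)} {u v : ℕ}
    (hG : IsGraph (V1 ∪ V2) E) (hinter : V1 ∩ V2 = {u, v})
    (hsep : ∀ a ∈ V1 \ {u, v}, ∀ b ∈ V2 \ {u, v}, s(a, b) ∉ E) :
    E ⊆ spans E V1 ∪ spans E V2 := by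
  intro e
  induction e with | _ a b
  intro he
  have ha := (hG _ he).2 a (Sym2.mem_mk_left a b)
  have hb := (hG _ he).2 b (Sym2.mem_mk_right a b)
  have h1 := hsep a
  have h2 := hsep b
  rw [← hinter] at h1 h2
  have hab := h1 (b := b)
  have hba := h2 (b := a)
  rw [Sym2.eq_swap] at hba
  simp only [Finset.mem_union, mem_spans, Finset.mem_sdiff, Finset.mem_inter] at *
  tauto

/-- Each side of a 2-split of a rigidity circuit is a rigidity circuit. -/
lemma isRigidityCircuit_side {V1 V2 : Finset ℕ} {E : Finset (Sym2 ℕ)} {u v : ℕ}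
    (hG : IsRigidityCircuit (V1 ∪ V2) E)
    (huv : u ≠ v) (hnonadj : s(u, v) ∉ E) (hinter : V1 ∩ V2 = {u, v})
    (hne1 : (V1 \ {u, v}).Nonempty) (hne2 : (V2 \ {u, v}).Nonempty)
    (hsep : ∀ a ∈ V1 \ {u, v}, ∀ b ∈ V2 \ {u, v}, s(a, b) ∉ E) :
    IsRigidityCircuit V1 (spans E V1 ∪ {s(u, v)}) := by
  obtain ⟨hgraph, hcard, hsparse⟩ := hG
  have hpair : ({u, v} : Finset ℕ).card = 2 := Finset.card_pair huv
  have hloop : ∀ e ∈ E, ¬ e.IsDiag := fun e he => (hgraph e he).1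
  have hsub1 : ({u, v} : Finset ℕ) ⊆ V1 := hinter ▸ Finset.inter_subset_left
  have hsub2 : ({u, v} : Finset ℕ) ⊆ V2 := hinter ▸ Finset.inter_subset_right
  have hc1 := Finset.card_le_card hsub1
  have hc2 := Finset.card_le_card hsub2
  have hV := Finset.card_union_add_card_inter V1 V2
  rw [hinter] at hV
  have hV1 : V1 ⊂ V1 ∪ V2 := by
    obtain ⟨x, hx⟩ := hne2
    refine Finset.ssubset_iff_subset_ne.2 ⟨Finset.subset_union_left, fun h => ?_⟩
    rw [Finset.mem_sdiff, ← hinter, Finset.mem_inter] at hx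
    exact hx.2 ⟨h ▸ Finset.mem_union_right V1 hx.1, hx.1⟩
  have hV2 : V2 ⊂ V1 ∪ V2 := by
    obtain ⟨x, hx⟩ := hne1
    refine Finset.ssubset_iff_subset_ne.2 ⟨Finset.subset_union_right, fun h => ?_⟩
    rw [Finset.mem_sdiff, ← hinter, Finset.mem_inter] at hx
    exact hx.2 ⟨hx.1, h ▸ Finset.mem_union_left V2 hx.1⟩
  have hs1 := hsparse V1 hV1 (by omega)
  have hs2 := hsparse V2 hV2 (by omega)
  have hE := (Finset.card_le_card (subset_spans_union hgraph hinter hsep)).trans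
    (Finset.card_union_le _ _)
  refine ⟨fun e he => ?_, ?_, fun W hW hW2 => ?_⟩
  · rcases Finset.mem_union.1 he with he | he
    · obtain ⟨he, heV⟩ := Finset.mem_filter.1 he
      exact ⟨hloop e he, heV⟩
    · rw [Finset.mem_singleton.1 he]
      refine ⟨by simpa using huv, fun w hw => hsub1 ?_⟩
      simpa using hw
  · rw [Finset.card_union_of_disjoint, Finset.card_singleton]
    · omega
    · simp [mem_spans, hnonadj]
  · by_cases huvW : ({u, v} : Finset ℕ) ⊆ W
    · have hWV2 : W ∩ V2 = {u, v} :=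
        Finset.Subset.antisymm
          (hinter ▸ Finset.inter_subset_inter_right hW.subset)
          (Finset.subset_inter huvW hsub2)
      have hproper : W ∪ V2 ⊂ V1 ∪ V2 := by
        obtain ⟨x, hx, hxW⟩ := Finset.exists_of_ssubset hW
        refine Finset.ssubset_iff_subset_ne.2
          ⟨Finset.union_subset_union_left hW.subset, fun h => ?_⟩
        have hxV2 : x ∈ V2 :=
          (Finset.mem_union.1 (h ▸ Finset.mem_union_left V2 hx)).resolve_left hxW
        exact hxW (huvW (hinter ▸ Finset.mem_inter.2 ⟨hx, hxV2⟩))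
      have hWcard := Finset.card_union_add_card_inter W V2
      rw [hWV2] at hWcard
      have hbound := hsparse _ hproper (by omega)
      have hle := Finset.card_le_card (Finset.union_subset
        (spans_mono E (Finset.subset_union_left (s₁ := W) (s₂ := V2)))
        (spans_mono E (Finset.subset_union_right (s₁ := W) (s₂ := V2))))
      rw [Finset.card_union_of_disjoint (disjoint_spans hloop hnonadj hWV2)] at hle
      have hadd : spans (spans E V1 ∪ {s(u, v)}) W ⊆ spans E W ∪ {s(u, v)} := by
        intro e he
        simp only [spans, Finset.mem_filter, Finset.mem_union] at he ⊢
        tauto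
      have hadd_card := (Finset.card_le_card hadd).trans (Finset.card_union_le _ _)
      rw [Finset.card_singleton] at hadd_card
      omega
    · have hold : spans (spans E V1 ∪ {s(u, v)}) W ⊆ spans E W := by
        intro e he
        simp only [spans, Finset.mem_filter, Finset.mem_union, Finset.mem_singleton] at he ⊢
        rcases he with ⟨he | rfl, heW⟩
        · exact ⟨he.1, heW⟩
        · exact absurd (fun w hw => heW w (by simpa using hw)) huvW
      exact (Finset.card_le_card hold).trans (hsparse W (hW.trans hV1) hW2)

/-- A 2-split of a rigidity circuit along a non-adjacent separating pair `{u, v}`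
produces two rigidity circuits. -/
theorem twoSplit_isRigidityCircuit (V V1 V2 : Finset ℕ) (E : Finset (Sym2 ℕ)) (u v : ℕ)
    (hG : IsRigidityCircuit V E)
    (huv : u ≠ v) (hnonadj : s(u, v) ∉ E)
    (hunion : V = V1 ∪ V2) (hinter : V1 ∩ V2 = {u, v})
    (hne1 : (V1 \ {u, v}).Nonempty) (hne2 : (V2 \ {u, v}).Nonempty)
    (hsep : ∀ a ∈ V1 \ {u, v}, ∀ b ∈ V2 \ {u, v}, s(a, b) ∉ E) :
    IsRigidityCircuit V1 (spans E V1 ∪ {s(u, v)}) ∧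
      IsRigidityCircuit V2 (spans E V2 ∪ {s(u, v)}) := by
  subst hunion
  refine ⟨isRigidityCircuit_side hG huv hnonadj hinter hne1 hne2 hsep,
    isRigidityCircuit_side (Finset.union_comm V1 V2 ▸ hG) huv hnonadj
      (Finset.inter_comm V1 V2 ▸ hinter) hne2 hne1 fun a ha b hb => ?_⟩
  rw [Sym2.eq_swap]
  exact hsep b hb a ha

end
end

section
/- Let G = (V, E) be a 3-connected rigidity circuit with n = |V| ≥ 5 vertices. Then there exist rigidity circuits G1 = (V1, E1) and G2 = (V2, E2) and an edge e ∈ E1 ∩ E2 such that G = CRes(G1, G2, e), G1 is 3-connected with exactly n − 1 vertices, and G2 has at most n − 1 vertices. -/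
open scoped Classical

noncomputable section

/-- The graph `(V, E)` is connected: `V` is nonempty and any two vertices of `V`
are joined by a walk along edges of `E`. -/
def ConnectedGraph (V : Finset ℕ) (E : Finset (Sym2 ℕ)) : Prop :=
  V.Nonempty ∧ ∀ a ∈ V, ∀ b ∈ V, Relation.ReflTransGen (fun x y => s(x, y) ∈ E) a b

/-- The graph `(V, E)` is 3-connected: it has at least 4 vertices and deleting any
at most 2 vertices (with all incident edges) leaves a connected graph. -/
def ThreeConnected (V : Finset ℕ) (E : Finset (Sym2 ℕ)) : Prop :=
  4 ≤ V.card ∧ ∀ S ⊆ V, S.card ≤ 2 → ConnectedGraph (V \ S) (spans E (V \ S))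

namespace CircuitCRD

/-- The number of edges of `E` induced by `X`. -/
def ind (E : Finset (Sym2 ℕ)) (X : Finset ℕ) : ℕ := (spans E X).card

/-- The number of neighbours of `u` in `X`. -/
def deg (E : Finset (Sym2 ℕ)) (u : ℕ) (X : Finset ℕ) : ℕ :=
  (X.filter fun x => s(u, x) ∈ E).card

/-- The edges induced by `X ∪ Y` that are induced by neither `X` nor `Y`. -/
def cross (E : Finset (Sym2 ℕ)) (X Y : Finset ℕ) : Finset (Sym2 ℕ) :=
  spans E (X ∪ Y) \ (spans E X ∪ spans E Y)

/-- `X` has at least two vertices and induces exactly `2|X| - 3` edges. -/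
def Tight (E : Finset (Sym2 ℕ)) (X : Finset ℕ) : Prop :=
  2 ≤ X.card ∧ ind E X + 3 = 2 * X.card

/-- No proper subset of `C` containing `p` and `q` is tight. -/
def Free (E : Finset (Sym2 ℕ)) (C : Finset ℕ) (p q : ℕ) : Prop :=
  ∀ X ⊂ C, p ∈ X → q ∈ X → ind E X + 4 ≤ 2 * X.card

/-- The subgraph induced by `C` together with the edge `pq`. -/
def withE (E : Finset (Sym2 ℕ)) (C : Finset ℕ) (p q : ℕ) : Finset (Sym2 ℕ) :=
  insert s(p, q) (spans E C)

/-- The neighbours of `u` are exactly the distinct vertices `x`, `y`, `z`. -/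
structure IsNode (V : Finset ℕ) (E : Finset (Sym2 ℕ)) (u x y z : ℕ) : Prop where
  mem : u ∈ V
  xy : x ≠ y
  xz : x ≠ z
  yz : y ≠ z
  adj : ∀ t, s(u, t) ∈ E ↔ t = x ∨ t = y ∨ t = z

/-- Some tight set contains `x` and `y` but neither `z` nor `u`. -/
def Blocked (V : Finset ℕ) (E : Finset (Sym2 ℕ)) (u x y z : ℕ) : Prop :=
  ∃ X ⊆ V, Tight E X ∧ x ∈ X ∧ y ∈ X ∧ z ∉ X ∧ u ∉ X

variable {V : Finset ℕ} {E : Finset (Sym2 ℕ)} {X Y W C : Finset ℕ}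

theorem mem_spans {x y : ℕ} : s(x, y) ∈ spans E X ↔ s(x, y) ∈ E ∧ x ∈ X ∧ y ∈ X := by
  simp [spans]

theorem spans_mono (h : X ⊆ Y) : spans E X ⊆ spans E Y := by
  intro e he
  simp only [spans, Finset.mem_filter] at he ⊢
  exact ⟨he.1, fun v hv => h (he.2 v hv)⟩

theorem spans_inter : spans E X ∩ spans E Y = spans E (X ∩ Y) := by
  ext e
  induction e with
  | _ x y => simp only [Finset.mem_inter, mem_spans]; tauto

theorem ind_add_ind : ind E X + ind E Y + (cross E X Y).card = ind E (X ∪ Y) + ind E (X ∩ Y) := by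
  have h1 : (spans E X ∪ spans E Y) ⊆ spans E (X ∪ Y) :=
    Finset.union_subset (spans_mono Finset.subset_union_left) (spans_mono Finset.subset_union_right)
  have h2 := Finset.card_sdiff_add_card_eq_card h1
  have h3 := Finset.card_union_add_card_inter (spans E X) (spans E Y)
  rw [spans_inter] at h3
  simp only [ind, cross]
  omega

theorem mem_cross {x y : ℕ} (h : s(x, y) ∈ E) (hx : x ∈ X) (hx' : x ∉ Y) (hy : y ∈ Y)
    (hy' : y ∉ X) : s(x, y) ∈ cross E X Y := by
  simp only [cross, Finset.mem_sdiff, Finset.mem_union, mem_spans]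
  tauto

theorem deg_insert {u t : ℕ} (hu : u ∉ X) :
    deg E t (insert u X) = deg E t X + if s(t, u) ∈ E then 1 else 0 := by
  unfold deg
  rw [Finset.filter_insert]
  split_ifs with h
  · rw [Finset.card_insert_of_notMem (by simp [hu])]
  · rfl

theorem deg_mono {u : ℕ} (h : X ⊆ Y) : deg E u X ≤ deg E u Y :=
  Finset.card_le_card (Finset.filter_subset_filter _ h)

theorem ind_insert {u : ℕ} (hl : ∀ x, s(x, x) ∉ E) (hu : u ∉ X) :
    ind E (insert u X) = ind E X + deg E u X := by
  have h : spans E (insert u X) =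
      spans E X ∪ (X.filter fun x => s(u, x) ∈ E).image fun x => s(u, x) := by
    ext e
    induction e with
    | _ x y =>
      simp only [Finset.mem_union, mem_spans, Finset.mem_image, Finset.mem_filter,
        Finset.mem_insert]
      constructor
      · rintro ⟨h, hx | hx, hy | hy⟩
        · subst hx; subst hy; exact absurd h (hl _)
        · subst hx; exact Or.inr ⟨y, ⟨hy, h⟩, rfl⟩
        · subst hy; exact Or.inr ⟨x, ⟨hx, Sym2.eq_swap ▸ h⟩, Sym2.eq_swap⟩
        · exact Or.inl ⟨h, hx, hy⟩
      · rintro (⟨h, hx, hy⟩ | ⟨t, ⟨ht, h⟩, he⟩)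
        · exact ⟨h, Or.inr hx, Or.inr hy⟩
        · rw [← he]
          refine ⟨h, ?_⟩
          rcases Sym2.eq_iff.1 he with ⟨rfl, rfl⟩ | ⟨rfl, rfl⟩ <;> simp [ht]
  unfold ind deg
  rw [h, Finset.card_union_of_disjoint, Finset.card_image_of_injective]
  · intro a b hab
    rcases Sym2.eq_iff.1 hab with ⟨_, h⟩ | ⟨h1, h2⟩
    exacts [h, h2.trans h1]
  · rw [Finset.disjoint_left]
    intro e he he'
    obtain ⟨t, -, rfl⟩ := Finset.mem_image.1 he'
    exact hu (mem_spans.1 he).2.1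

theorem ind_singleton (hl : ∀ x, s(x, x) ∉ E) (u : ℕ) : ind E {u} = 0 := by
  unfold ind
  rw [Finset.card_eq_zero, Finset.eq_empty_iff_forall_notMem]
  intro e
  induction e with
  | _ x y =>
    rw [mem_spans]
    rintro ⟨h, hx, hy⟩
    rw [Finset.mem_singleton] at hx hy
    subst hx; subst hy
    exact hl _ h

theorem ind_empty : ind E ∅ = 0 := by
  unfold ind
  rw [Finset.card_eq_zero, Finset.eq_empty_iff_forall_notMem]
  intro e
  induction e with
  | _ x y => simp [mem_spans]

theorem ind_erase {u : ℕ} (hl : ∀ x, s(x, x) ∉ E) (hu : u ∈ X) :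
    ind E X = ind E (X.erase u) + deg E u X := by
  have h := ind_insert hl (Finset.notMem_erase u X)
  have h2 := deg_insert (E := E) (t := u) (Finset.notMem_erase u X)
  rw [Finset.insert_erase hu] at h h2
  rw [if_neg (hl u)] at h2
  omega

theorem ind_pair {x y : ℕ} (hl : ∀ x, s(x, x) ∉ E) (hxy : x ≠ y) :
    ind E {x, y} = if s(x, y) ∈ E then 1 else 0 := by
  rw [ind_insert hl (by simpa using hxy), ind_singleton hl]
  unfold deg
  rw [Finset.filter_singleton]
  split_ifs <;> simp

theorem sum_deg (hl : ∀ x, s(x, x) ∉ E) (h : Disjoint Y W) :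
    ∑ u ∈ Y, deg E u (Y ∪ W) + ind E W = ind E Y + ind E (Y ∪ W) := by
  induction Y using Finset.induction_on with
  | empty => simp [ind_empty]
  | insert u Y hu ih =>
    rw [Finset.disjoint_insert_left] at h
    have hZ : u ∉ Y ∪ W := by simp [hu, h.1]
    have ih := ih h.2
    rw [Finset.insert_union, ind_insert hl hZ, ind_insert hl hu, Finset.sum_insert hu,
      deg_insert hZ, if_neg (hl u), Finset.sum_congr rfl fun t _ => deg_insert hZ,
      Finset.sum_add_distrib]
    have : ∑ t ∈ Y, (if s(t, u) ∈ E then 1 else 0) = deg E u Y := by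
      rw [deg, Finset.card_filter]
      exact Finset.sum_congr rfl fun t _ => by rw [Sym2.eq_swap]
    omega

theorem exists_adj_of_deg_pos {u : ℕ} (h : 0 < deg E u X) : ∃ x ∈ X, s(u, x) ∈ E := by
  obtain ⟨x, hx⟩ := Finset.card_pos.1 h
  exact ⟨x, (Finset.mem_filter.1 hx).1, (Finset.mem_filter.1 hx).2⟩

theorem exists_adj_of_two_le_deg {u : ℕ} (t : ℕ) (h : 2 ≤ deg E u X) :
    ∃ x ∈ X, x ≠ t ∧ s(u, x) ∈ E := by
  obtain ⟨x, hx, hxt⟩ := Finset.exists_mem_ne h t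
  exact ⟨x, (Finset.mem_filter.1 hx).1, hxt, (Finset.mem_filter.1 hx).2⟩

theorem loopless (hG : IsRigidityCircuit V E) (x : ℕ) : s(x, x) ∉ E := fun h =>
  (hG.1 _ h).1 rfl

theorem mem_left (hG : IsRigidityCircuit V E) {x y : ℕ} (h : s(x, y) ∈ E) : x ∈ V :=
  (hG.1 _ h).2 x (Sym2.mem_mk_left x y)

theorem mem_right (hG : IsRigidityCircuit V E) {x y : ℕ} (h : s(x, y) ∈ E) : y ∈ V :=
  (hG.1 _ h).2 y (Sym2.mem_mk_right x y)

theorem adj_ne (hG : IsRigidityCircuit V E) {x y : ℕ} (h : s(x, y) ∈ E) : x ≠ y := by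
  rintro rfl
  exact loopless hG x h

theorem spans_self (hG : IsRigidityCircuit V E) : spans E V = E :=
  Finset.filter_true_of_mem fun e he => (hG.1 e he).2

theorem ind_le (hG : IsRigidityCircuit V E) (hX : X ⊂ V) (h2 : 2 ≤ X.card) :
    ind E X + 3 ≤ 2 * X.card := by
  have := hG.2.2 X hX h2
  unfold ind
  omega

theorem ind_self (hG : IsRigidityCircuit V E) (h : 1 ≤ V.card) : ind E V + 2 = 2 * V.card := by
  unfold ind
  rw [spans_self hG, hG.2.1]
  omega

theorem ind_le_two_mul (hG : IsRigidityCircuit V E) (hX : X ⊆ V) (h : 1 ≤ X.card) :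
    ind E X + 2 ≤ 2 * X.card := by
  rcases hX.eq_or_ssubset with rfl | hX
  · exact (ind_self hG h).le
  · rcases h.eq_or_lt with h | h
    · obtain ⟨u, rfl⟩ := Finset.card_eq_one.1 h.symm
      rw [ind_singleton (loopless hG)]
      simp
    · have := ind_le hG hX h
      omega

theorem Tight.ssubset (hG : IsRigidityCircuit V E) (hT : Tight E X) (hX : X ⊆ V) : X ⊂ V := by
  rcases hX.eq_or_ssubset with rfl | hX
  · have := ind_self hG (by have := hT.1; omega)
    have := hT.2
    omega
  · exact hX

theorem three_le_deg (hG : IsRigidityCircuit V E) (hn : 3 ≤ V.card) {u : ℕ} (hu : u ∈ V) :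
    3 ≤ deg E u V := by
  have h1 := ind_erase (loopless hG) hu
  have h2 := Finset.card_erase_of_mem hu
  have h3 := ind_le hG (Finset.erase_ssubset hu) (by omega)
  have h4 := ind_self hG (by omega)
  omega

theorem Tight.two_le_deg (hG : IsRigidityCircuit V E) (hX : X ⊆ V) (hT : Tight E X)
    (h3 : 3 ≤ X.card) {u : ℕ} (hu : u ∈ X) : 2 ≤ deg E u X := by
  have h1 := ind_erase (loopless hG) hu
  have h2 := Finset.card_erase_of_mem hu
  have h3 := ind_le hG ((Finset.erase_subset u X).trans_ssubset (hT.ssubset hG hX)) (by omega)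
  have := hT.2
  omega

theorem Tight.deg_pos (hG : IsRigidityCircuit V E) (hX : X ⊆ V) (hT : Tight E X)
    {u : ℕ} (hu : u ∈ X) : 0 < deg E u X := by
  have h1 := ind_erase (loopless hG) hu
  have h2 := Finset.card_erase_of_mem hu
  have h4 := hT.1
  have h3 := ind_le_two_mul hG ((Finset.erase_subset u X).trans hX) (by omega)
  have := hT.2
  omega

theorem Tight.inter_union (hG : IsRigidityCircuit V E) (hX : X ⊆ V) (hY : Y ⊆ V)
    (hTX : Tight E X) (hTY : Tight E Y) (hne : X ∪ Y ≠ V) (h2 : 2 ≤ (X ∩ Y).card) :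
    Tight E (X ∩ Y) ∧ Tight E (X ∪ Y) ∧ cross E X Y = ∅ := by
  have h1 := Finset.card_union_add_card_inter X Y
  have h3 := ind_add_ind (E := E) (X := X) (Y := Y)
  have h4 := ind_le hG ((Finset.union_subset hX hY).ssubset_of_ne hne)
    (hTX.1.trans (Finset.card_le_card Finset.subset_union_left))
  have h5 := ind_le hG (Finset.inter_subset_left.trans_ssubset (hTX.ssubset hG hX)) h2
  have h6 := hTX.2
  have h7 := hTY.2
  have h8 := hTX.1.trans (Finset.card_le_card (Finset.subset_union_left (s₁ := X) (s₂ := Y)))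
  refine ⟨⟨h2, by omega⟩, ⟨h8, by omega⟩, Finset.card_eq_zero.1 (by omega)⟩

theorem Tight.ind_inter (hG : IsRigidityCircuit V E) (hX : X ⊆ V)
    (hTX : Tight E X) (hTY : Tight E Y) (hU : X ∪ Y = V) (h2 : 2 ≤ (X ∩ Y).card) :
    ind E (X ∩ Y) + 4 = 2 * (X ∩ Y).card + (cross E X Y).card ∧ (cross E X Y).card ≤ 1 := by
  have h1 := Finset.card_union_add_card_inter X Y
  have h3 := ind_add_ind (E := E) (X := X) (Y := Y)
  have h5 := ind_le hG (Finset.inter_subset_left.trans_ssubset (hTX.ssubset hG hX)) h2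
  have h6 := hTX.2
  have h7 := hTY.2
  rw [hU] at h1 h3
  have h4 := ind_self hG (by have := hTX.1; have := Finset.card_le_card hX; omega)
  omega

/-- A tight set has no cut vertex. -/
theorem Tight.exists_adj (hG : IsRigidityCircuit V E) (hX : X ⊆ V) (hT : Tight E X)
    {A : Finset ℕ} (hA : A ⊆ X) (hA0 : A.Nonempty) (hB : 2 ≤ (X \ A).card) (t : ℕ) :
    ∃ b ∈ X, b ∉ A ∧ b ≠ t ∧ ∃ a ∈ A, s(b, a) ∈ E := by
  have key : ∀ t ∈ X \ A, ∃ b ∈ X, b ∉ A ∧ b ≠ t ∧ ∃ a ∈ A, s(b, a) ∈ E := by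
    intro t ht
    by_contra! hcon
    rw [Finset.mem_sdiff] at ht
    have hin : (X \ A) ∩ insert t A = {t} := by
      ext x
      simp only [Finset.mem_inter, Finset.mem_sdiff, Finset.mem_insert, Finset.mem_singleton]
      constructor
      · tauto
      · rintro rfl; tauto
    have hun : (X \ A) ∪ insert t A = X := by
      ext x
      simp only [Finset.mem_union, Finset.mem_sdiff, Finset.mem_insert]
      constructor
      · rintro (h | rfl | h)
        exacts [h.1, ht.1, hA h]
      · tauto
    have hcr : cross E (X \ A) (insert t A) = ∅ := by
      rw [Finset.eq_empty_iff_forall_notMem]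
      intro e
      induction e with
      | _ x y =>
        simp only [cross, hun, Finset.mem_sdiff, Finset.mem_union, mem_spans, Finset.mem_insert]
        rintro ⟨⟨he, hx, hy⟩, hno⟩
        by_cases hxA : x ∈ A <;> by_cases hyA : y ∈ A
        · tauto
        · by_cases hyt : y = t
          · tauto
          · exact hcon y hy hyA hyt x hxA (Sym2.eq_swap ▸ he)
        · by_cases hxt : x = t
          · tauto
          · exact hcon x hx hxA hxt y hyA he
        · tauto
    have h1 := ind_add_ind (E := E) (X := X \ A) (Y := insert t A)
    rw [hin, hun, hcr, ind_singleton (loopless hG)] at h1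
    have hXV := hT.ssubset hG hX
    have h2 := ind_le hG (Finset.sdiff_subset.trans_ssubset hXV) hB
    have hc : (insert t A).card = A.card + 1 := Finset.card_insert_of_notMem ht.2
    have h3 := ind_le hG (X := insert t A)
      ((Finset.insert_subset ht.1 hA).trans_ssubset hXV) (by have := hA0.card_pos; omega)
    have h4 := Finset.card_sdiff_add_card_eq_card hA
    have h5 := hT.2
    simp only [Finset.card_empty] at h1
    omega
  by_cases ht : t ∈ X \ A
  · exact key t ht
  · obtain ⟨t', ht'⟩ := Finset.card_pos.1 (show 0 < (X \ A).card by omega)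
    obtain ⟨b, hb, hbA, -, h⟩ := key t' ht'
    refine ⟨b, hb, hbA, ?_, h⟩
    rintro rfl
    exact ht (Finset.mem_sdiff.2 ⟨hb, hbA⟩)

theorem ind_lt_card_of_nodes (hG : IsRigidityCircuit V E) {N : Finset ℕ} (hN : N ⊆ V)
    (hd : ∀ u ∈ N, deg E u V = 3) (hW : 2 ≤ (V \ N).card) (hN0 : N.Nonempty) :
    ind E N < N.card := by
  have h1 := sum_deg (loopless hG) (Finset.disjoint_sdiff (s := N) (t := V))
  rw [Finset.union_sdiff_of_subset hN, Finset.sum_const_nat hd] at h1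
  have h2 := Finset.card_sdiff_add_card_eq_card hN
  have h3 := ind_le hG (X := V \ N) (Finset.sdiff_ssubset hN hN0) hW
  have h4 := ind_self hG (by omega)
  omega

/-- The nodes induce a forest, so some node other than `c` has at most one neighbour which is a
node. -/
theorem exists_leaf (hG : IsRigidityCircuit V E) {N : Finset ℕ} (hN : N ⊆ V)
    (hd : ∀ u ∈ N, deg E u V = 3) (hW : 2 ≤ (V \ N).card) (hN2 : 2 ≤ N.card) (c : ℕ) :
    ∃ u ∈ N, u ≠ c ∧ deg E u N ≤ 1 := by
  by_contra! hcon
  have hi := ind_lt_card_of_nodes hG hN hd hW (Finset.card_pos.1 (by omega))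
  have hc1 : N.card ≤ (N.erase c).card + 1 := by
    have := Finset.pred_card_le_card_erase (s := N) (a := c)
    omega
  have hsub : N.erase c ⊆ V := (Finset.erase_subset c N).trans hN
  have hi' := ind_lt_card_of_nodes hG hsub (fun u hu => hd u (Finset.mem_of_mem_erase hu))
    (hW.trans (Finset.card_le_card (Finset.sdiff_subset_sdiff le_rfl (Finset.erase_subset c N))))
    (Finset.card_pos.1 (by omega))
  have h1 := sum_deg (loopless hG)
    (Finset.disjoint_sdiff (s := N.erase c) (t := N))
  rw [Finset.union_sdiff_of_subset (Finset.erase_subset c N)] at h1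
  have h2 : (N.erase c).card * 2 ≤ ∑ u ∈ N.erase c, deg E u N :=
    Finset.card_nsmul_le_sum (N.erase c) (fun u => deg E u N) 2 fun u hu =>
      hcon u (Finset.mem_of_mem_erase hu) (Finset.ne_of_mem_erase hu)
  by_cases hc : c ∈ N
  · have := Finset.card_erase_of_mem hc
    omega
  · rw [Finset.erase_eq_of_notMem hc] at *
    omega

theorem four_mul_card_le (hG : IsRigidityCircuit V E) (hn : 3 ≤ V.card) (hY : Y ⊆ V) :
    4 * Y.card ≤ ∑ u ∈ Y, deg E u V + (Y.filter fun u => deg E u V = 3).card := by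
  rw [Finset.card_filter, ← Finset.sum_add_distrib, mul_comm]
  refine Finset.card_nsmul_le_sum Y _ 4 fun u hu => ?_
  have := three_le_deg hG hn (hY hu)
  split_ifs <;> omega

theorem four_le_card_nodes (hG : IsRigidityCircuit V E) (hn : 3 ≤ V.card) :
    4 ≤ (V.filter fun u => deg E u V = 3).card := by
  have h1 := four_mul_card_le hG hn (subset_refl V)
  have h2 := sum_deg (loopless hG) (Finset.disjoint_empty_right V)
  have h3 := ind_self hG (by omega)
  rw [ind_empty, Finset.union_empty] at h2
  omega

theorem Tight.two_le_card_nodes (hG : IsRigidityCircuit V E) (hX : X ⊆ V) (hT : Tight E X)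
    (h2 : 2 ≤ (V \ X).card) : 2 ≤ ((V \ X).filter fun u => deg E u V = 3).card := by
  have h5 := Finset.card_sdiff_add_card_eq_card hX
  have h6 := hT.1
  have h7 := hT.2
  have h1 := four_mul_card_le hG (by omega) (Finset.sdiff_subset (s := V) (t := X))
  have h3 := sum_deg (loopless hG) (Finset.sdiff_disjoint (s := X) (t := V))
  rw [Finset.sdiff_union_of_subset hX] at h3
  have h4 := ind_self hG (by omega)
  have h8 := ind_le hG (X := V \ X)
    (Finset.sdiff_ssubset hX (Finset.card_pos.1 (by omega))) h2
  omega

theorem exists_isNode (hG : IsRigidityCircuit V E) {u : ℕ} (hu : u ∈ V) (hd : deg E u V = 3) :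
    ∃ x y z, IsNode V E u x y z := by
  obtain ⟨x, y, z, hxy, hxz, hyz, h⟩ := Finset.card_eq_three.1 hd
  refine ⟨x, y, z, hu, hxy, hxz, hyz, fun t => ?_⟩
  have := Finset.ext_iff.1 h t
  simp only [Finset.mem_filter, Finset.mem_insert, Finset.mem_singleton] at this
  rw [← this]
  exact ⟨fun h => ⟨mem_right hG h, h⟩, fun h => h.2⟩

namespace IsNode

variable {u x y z : ℕ}

theorem swap (h : IsNode V E u x y z) : IsNode V E u y x z :=
  ⟨h.mem, h.xy.symm, h.yz, h.xz, fun t => by rw [h.adj]; tauto⟩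

theorem rotate (h : IsNode V E u x y z) : IsNode V E u y z x :=
  ⟨h.mem, h.yz, h.xy.symm, h.xz.symm, fun t => by rw [h.adj]; tauto⟩

theorem adj_fst (h : IsNode V E u x y z) : s(u, x) ∈ E := (h.adj x).2 (Or.inl rfl)

theorem adj_snd (h : IsNode V E u x y z) : s(u, y) ∈ E := (h.adj y).2 (Or.inr (Or.inl rfl))

theorem adj_trd (h : IsNode V E u x y z) : s(u, z) ∈ E := (h.adj z).2 (Or.inr (Or.inr rfl))

theorem deg_eq (h : IsNode V E u x y z) (hx : x ∈ X) (hy : y ∈ X) (hz : z ∈ X) :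
    deg E u X = 3 := by
  rw [deg, Finset.card_eq_three]
  refine ⟨x, y, z, h.xy, h.xz, h.yz, ?_⟩
  ext t
  simp only [Finset.mem_filter, Finset.mem_insert, Finset.mem_singleton, h.adj]
  constructor
  · exact fun h => h.2
  · rintro (rfl | rfl | rfl) <;> tauto

theorem deg_eq_two (h : IsNode V E u x y z) (hx : x ∈ X) (hy : y ∈ X) (hz : z ∉ X) :
    deg E u X = 2 := by
  rw [deg, Finset.card_eq_two]
  refine ⟨x, y, h.xy, ?_⟩
  ext t
  simp only [Finset.mem_filter, Finset.mem_insert, Finset.mem_singleton, h.adj]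
  constructor
  · rintro ⟨ht, rfl | rfl | rfl⟩ <;> tauto
  · rintro (rfl | rfl) <;> tauto

theorem deg_eq_three (hG : IsRigidityCircuit V E) (h : IsNode V E u x y z) : deg E u V = 3 :=
  h.deg_eq (mem_right hG h.adj_fst) (mem_right hG h.adj_snd) (mem_right hG h.adj_trd)

end IsNode

theorem tight_erase (hG : IsRigidityCircuit V E) (hn : 3 ≤ V.card) {u : ℕ} (hu : u ∈ V)
    (hd : deg E u V = 3) : Tight E (V.erase u) := by
  have h1 := ind_erase (loopless hG) hu
  have h2 := Finset.card_erase_of_mem hu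
  have h4 := ind_self hG (by omega)
  exact ⟨by omega, by omega⟩

theorem Tight.insert (hG : IsRigidityCircuit V E) (hX : X ⊆ V) (hT : Tight E X) {u : ℕ}
    (hu : u ∈ V) (huX : u ∉ X) (hd : 2 ≤ deg E u X) (h2 : 2 ≤ (V \ X).card) :
    Tight E (insert u X) := by
  have h1 := ind_insert (loopless hG) huX
  have h3 := Finset.card_insert_of_notMem huX
  have h5 := Finset.card_sdiff_add_card_eq_card hX
  have h6 := hT.1
  have h7 := hT.2
  have hs : Insert.insert u X ⊂ V := by
    refine (Finset.insert_subset hu hX).ssubset_of_ne fun h => ?_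
    rw [h] at h3
    omega
  have h8 := ind_le hG hs (by omega)
  exact ⟨by omega, by omega⟩

theorem mem_of_closed (h3 : ThreeConnected V E) {S P : Finset ℕ} (hS : S ⊆ V)
    (hS2 : S.card ≤ 2) (hP : ∃ x ∈ P, x ∈ V ∧ x ∉ S)
    (hcl : ∀ x ∈ P, x ∈ V → x ∉ S → ∀ y ∈ V, y ∉ S → s(x, y) ∈ E → y ∈ P) {y : ℕ} (hy : y ∈ V)
    (hyS : y ∉ S) : y ∈ P := by
  obtain ⟨x, hx, hxV, hxS⟩ := hP
  have h := (h3.2 S hS hS2).2 x (Finset.mem_sdiff.2 ⟨hxV, hxS⟩) y (Finset.mem_sdiff.2 ⟨hy, hyS⟩)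
  clear hy hyS
  induction h with
  | refl => exact hx
  | tail _ hbc ih =>
    rw [mem_spans, Finset.mem_sdiff, Finset.mem_sdiff] at hbc
    exact hcl _ ih hbc.2.1.1 hbc.2.1.2 _ hbc.2.2.1 hbc.2.2.2 hbc.1

theorem Free.notMem {p q : ℕ} (hf : Free E C p q) (hp : p ∈ C) (hq : q ∈ C) (hpq : p ≠ q)
    (h3 : 3 ≤ C.card) : s(p, q) ∉ E := by
  intro h
  have hc := Finset.card_pair hpq
  have hs : ({p, q} : Finset ℕ) ⊂ C := by
    refine (Finset.insert_subset hp (by simpa using hq)).ssubset_of_ne fun h => ?_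
    rw [h] at hc
    omega
  have h1 := hf _ hs (by simp) (by simp)
  have h2 : 0 < ind E {p, q} := Finset.card_pos.2 ⟨s(p, q), mem_spans.2 ⟨h, by simp, by simp⟩⟩
  omega

theorem ind_withE {p q : ℕ} (hpq : s(p, q) ∉ E) (hX : X ⊆ C) :
    ind (withE E C p q) X = ind E X + if p ∈ X ∧ q ∈ X then 1 else 0 := by
  have h1 : spans (spans E C) X = spans E X := by
    ext e
    induction e with
    | _ x y =>
      simp only [mem_spans]
      exact ⟨fun h => ⟨h.1.1, h.2⟩, fun h => ⟨⟨h.1, hX h.2.1, hX h.2.2⟩, h.2⟩⟩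
  have h2 : s(p, q) ∉ spans E X := fun h => hpq (mem_spans.1 h).1
  unfold ind
  split_ifs with h
  · have : spans (withE E C p q) X = Insert.insert s(p, q) (spans E X) := by
      conv_lhs => rw [spans, withE, Finset.filter_insert, if_pos (by simpa using h)]
      rw [← h1]
      rfl
    rw [this, Finset.card_insert_of_notMem h2]
  · have : spans (withE E C p q) X = spans E X := by
      conv_lhs => rw [spans, withE, Finset.filter_insert, if_neg (by simpa using h)]
      rw [← h1]
      rfl
    rw [this, add_zero]

theorem mem_withE {p q x y : ℕ} : s(x, y) ∈ withE E C p q ↔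
    (x = p ∧ y = q ∨ x = q ∧ y = p) ∨ (s(x, y) ∈ E ∧ x ∈ C ∧ y ∈ C) := by
  rw [withE, Finset.mem_insert, mem_spans, Sym2.eq_iff]

theorem Free.symm {p q : ℕ} (hf : Free E C p q) : Free E C q p :=
  fun X hX hq hp => hf X hX hp hq

theorem Tight.withE_circuit (hG : IsRigidityCircuit V E) (hC : C ⊆ V) (hT : Tight E C) {p q : ℕ}
    (hp : p ∈ C) (hq : q ∈ C) (hpq : p ≠ q) (hf : Free E C p q) (h3 : 3 ≤ C.card) :
    IsRigidityCircuit C (withE E C p q) := by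
  have hE := hf.notMem hp hq hpq h3
  refine ⟨?_, ?_, fun X hX h2 => ?_⟩
  · intro e
    induction e with
    | _ x y =>
      intro he
      rw [Sym2.mk_isDiag_iff]
      rw [mem_withE] at he
      rcases he with (⟨rfl, rfl⟩ | ⟨rfl, rfl⟩) | ⟨he, hx, hy⟩
      · exact ⟨hpq, by simp [hp, hq]⟩
      · exact ⟨hpq.symm, by simp [hp, hq]⟩
      · exact ⟨adj_ne hG he, by simp [hx, hy]⟩
  · rw [withE, Finset.card_insert_of_notMem fun h => hE (mem_spans.1 h).1]
    have := hT.2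
    unfold ind at this
    omega
  · have h1 := ind_withE hE hX.subset
    have h4 := ind_le hG (hX.trans_subset hC) h2
    unfold ind at h1
    split_ifs at h1 with h
    · have := hf X hX h.1 h.2
      unfold ind at this
      omega
    · unfold ind at h4
      omega

/-- A tight set avoiding the node `u` and containing its neighbours is everything else. -/
theorem IsNode.eq_erase (hG : IsRigidityCircuit V E) {u x y z : ℕ} (h : IsNode V E u x y z)
    (hX : X ⊆ V) (hT : Tight E X) (hu : u ∉ X) (hx : x ∈ X) (hy : y ∈ X) (hz : z ∈ X) :
    X = V.erase u := by
  by_contra hne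
  have h1 := ind_insert (loopless hG) hu
  rw [h.deg_eq hx hy hz] at h1
  have h2 := Finset.card_insert_of_notMem hu
  have h3 : Insert.insert u X ⊂ V := by
    refine (Finset.insert_subset h.mem hX).ssubset_of_ne fun h => hne ?_
    rw [← h, Finset.erase_insert hu]
  have h4 := ind_le hG h3 (by have := hT.1; omega)
  have h5 := hT.2
  omega

theorem IsNode.free (hG : IsRigidityCircuit V E) {u x y z : ℕ} (h : IsNode V E u x y z)
    (hb : ¬ Blocked V E u x y z) : Free E (V.erase u) x y := by
  intro X hX hx hy
  have h2 : 2 ≤ X.card := by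
    rw [← Finset.card_pair h.xy]
    exact Finset.card_le_card (Finset.insert_subset hx (by simpa using hy))
  have hXV := hX.subset.trans (Finset.erase_subset u V)
  have hu : u ∉ X := fun h => Finset.notMem_erase u V (hX.subset h)
  have h1 := ind_le hG (hX.trans_subset (Finset.erase_subset u V)) h2
  by_contra hcon
  have hT : Tight E X := ⟨h2, by omega⟩
  refine hb ⟨X, hXV, hT, hx, hy, fun hz => ?_, hu⟩
  exact hX.ne (h.eq_erase hG hXV hT hu hx hy hz)

/-- Two overlapping tight sets avoiding the node `u` that together contain its neighbours. -/
theorem IsNode.edges_of_two (hG : IsRigidityCircuit V E) {u x y z : ℕ} (h : IsNode V E u x y z)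
    (hX : X ⊆ V) (hTX : Tight E X) (huX : u ∉ X) (hY : Y ⊆ V) (hTY : Tight E Y) (huY : u ∉ Y)
    (hx : x ∈ X ∪ Y) (hy : y ∈ X ∪ Y) (hz : z ∈ X ∪ Y) (h2 : 2 ≤ (X ∩ Y).card) :
    X ∪ Y = V.erase u ∧
      ∀ a b, s(a, b) ∈ E → a ≠ u → b ≠ u → (a ∈ X ∧ b ∈ X) ∨ (a ∈ Y ∧ b ∈ Y) := by
  have huXY : u ∉ X ∪ Y := by simp [huX, huY]
  obtain ⟨-, hT, hcr⟩ := hTX.inter_union hG hX hY hTY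
    (fun he => huXY (he ▸ h.mem)) h2
  have he := h.eq_erase hG (Finset.union_subset hX hY) hT huXY hx hy hz
  refine ⟨he, fun a b hab ha hb => ?_⟩
  have := Finset.eq_empty_iff_forall_notMem.1 hcr s(a, b)
  rw [cross, he, Finset.mem_sdiff, Finset.mem_union, mem_spans, mem_spans, mem_spans,
    Finset.mem_erase, Finset.mem_erase] at this
  have ha' := mem_left hG hab
  have hb' := mem_right hG hab
  tauto

theorem inter_eq_singleton {x : ℕ} (h : ¬ 2 ≤ (X ∩ Y).card) (hx : x ∈ X) (hy : x ∈ Y) :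
    X ∩ Y = {x} := by
  symm
  refine Finset.eq_of_subset_of_card_le (by simp [hx, hy]) ?_
  rw [Finset.card_singleton]
  omega

theorem disjoint_spans (hG : IsRigidityCircuit V E) {x : ℕ} (h : X ∩ Y = {x}) :
    Disjoint (spans E X) (spans E Y) := by
  rw [Finset.disjoint_iff_inter_eq_empty, spans_inter, h]
  exact Finset.card_eq_zero.1 (ind_singleton (loopless hG) x)

/-- If every pair of neighbours of the node `u` is blocked, then the three blocking sets induce
every edge that avoids `u`. -/
theorem IsNode.edges_of_three (hG : IsRigidityCircuit V E) {u x y z : ℕ} (h : IsNode V E u x y z)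
    {Z : Finset ℕ} (hX : X ⊆ V) (hTX : Tight E X) (huX : u ∉ X) (hY : Y ⊆ V) (hTY : Tight E Y)
    (huY : u ∉ Y) (hZ : Z ⊆ V) (hTZ : Tight E Z) (huZ : u ∉ Z) (hxX : x ∈ X) (hyX : y ∈ X)
    (hyY : y ∈ Y) (hzY : z ∈ Y) (hxZ : x ∈ Z) (hzZ : z ∈ Z) :
    ∀ a b, s(a, b) ∈ E → a ≠ u → b ≠ u →
      (a ∈ X ∧ b ∈ X) ∨ (a ∈ Y ∧ b ∈ Y) ∨ (a ∈ Z ∧ b ∈ Z) := by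
  by_cases c1 : 2 ≤ (X ∩ Y).card
  · intro a b hab ha hb
    rcases (h.edges_of_two hG hX hTX huX hY hTY huY (by simp [hxX]) (by simp [hyX]) (by simp [hzY])
      c1).2 a b hab ha hb with h | h <;> tauto
  by_cases c2 : 2 ≤ (X ∩ Z).card
  · intro a b hab ha hb
    rcases (h.edges_of_two hG hX hTX huX hZ hTZ huZ (by simp [hxX]) (by simp [hyX]) (by simp [hzZ])
      c2).2 a b hab ha hb with h | h <;> tauto
  by_cases c3 : 2 ≤ (Y ∩ Z).card
  · intro a b hab ha hb
    rcases (h.edges_of_two hG hY hTY huY hZ hTZ huZ (by simp [hxZ]) (by simp [hyY]) (by simp [hzZ])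
      c3).2 a b hab ha hb with h | h <;> tauto
  have e1 := inter_eq_singleton c1 hyX hyY
  have e2 := inter_eq_singleton c2 hxX hxZ
  have e3 := inter_eq_singleton c3 hzY hzZ
  have e4 : (X ∪ Y) ∩ Z = {x, z} := by
    rw [Finset.union_inter_distrib_right, e2, e3]
    rfl
  have d1 := disjoint_spans (E := E) hG e1
  have d2 := disjoint_spans (E := E) hG e2
  have d3 := disjoint_spans (E := E) hG e3
  have k1 := Finset.card_union_add_card_inter X Y
  have k2 := Finset.card_union_add_card_inter (X ∪ Y) Z
  rw [e1, Finset.card_singleton] at k1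
  rw [e4, Finset.card_pair h.xz] at k2
  have k3 := Finset.card_union_of_disjoint d1
  have k4 := Finset.card_union_of_disjoint (Finset.disjoint_union_left.2 ⟨d2, d3⟩)
  have hU : (X ∪ Y) ∪ Z ⊆ V := Finset.union_subset (Finset.union_subset hX hY) hZ
  have huU : u ∉ (X ∪ Y) ∪ Z := by simp [huX, huY, huZ]
  have hsub : (spans E X ∪ spans E Y) ∪ spans E Z ⊆ spans E ((X ∪ Y) ∪ Z) :=
    Finset.union_subset (Finset.union_subset
      (spans_mono (Finset.subset_union_left.trans Finset.subset_union_left))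
      (spans_mono (Finset.subset_union_right.trans Finset.subset_union_left)))
      (spans_mono Finset.subset_union_right)
  have k5 := Finset.card_le_card hsub
  have k6 := hTX.2
  have k7 := hTY.2
  have k8 := hTZ.2
  have k9 := hTX.1
  have k10 := Finset.card_le_card (Finset.subset_union_left.trans
    (Finset.subset_union_left (s₁ := X ∪ Y) (s₂ := Z)))
  have hss : (X ∪ Y) ∪ Z ⊂ V := hU.ssubset_of_ne fun he => huU (he ▸ h.mem)
  have k11 := ind_le hG hss (by omega)
  unfold ind at k6 k7 k8 k11
  have hT : Tight E ((X ∪ Y) ∪ Z) := ⟨by omega, by unfold ind; omega⟩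
  have he := h.eq_erase hG hU hT huU (by simp [hxX]) (by simp [hyX]) (by simp [hzZ])
  have hse := Finset.eq_of_subset_of_card_le hsub (by omega)
  intro a b hab ha hb
  have hm : s(a, b) ∈ spans E ((X ∪ Y) ∪ Z) := by
    rw [he, mem_spans, Finset.mem_erase, Finset.mem_erase]
    exact ⟨hab, ⟨ha, mem_left hG hab⟩, hb, mem_right hG hab⟩
  rw [← hse, Finset.mem_union, Finset.mem_union, mem_spans, mem_spans, mem_spans] at hm
  tauto

theorem IsNode.of_adj (hG : IsRigidityCircuit V E) {u x y z : ℕ} (hd : deg E u V = 3)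
    (hx : s(u, x) ∈ E) (hy : s(u, y) ∈ E) (hz : s(u, z) ∈ E) (hxy : x ≠ y) (hxz : x ≠ z)
    (hyz : y ≠ z) : IsNode V E u x y z := by
  refine ⟨mem_left hG hx, hxy, hxz, hyz, fun t => ⟨fun ht => ?_, ?_⟩⟩
  · have h1 : ({x, y, z} : Finset ℕ) ⊆ V.filter fun x => s(u, x) ∈ E := by
      intro t
      simp only [Finset.mem_insert, Finset.mem_singleton, Finset.mem_filter]
      rintro (rfl | rfl | rfl)
      exacts [⟨mem_right hG hx, hx⟩, ⟨mem_right hG hy, hy⟩, ⟨mem_right hG hz, hz⟩]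
    have h2 := Finset.eq_of_subset_of_card_le h1
      (by rw [Finset.card_eq_three.2 ⟨x, y, z, hxy, hxz, hyz, rfl⟩]; exact hd.le)
    have : t ∈ ({x, y, z} : Finset ℕ) := by
      rw [h2, Finset.mem_filter]
      exact ⟨mem_right hG ht, ht⟩
    simpa using this
  · rintro (rfl | rfl | rfl) <;> assumption

theorem deg_union_add_deg_inter (u : ℕ) :
    deg E u (X ∪ Y) + deg E u (X ∩ Y) = deg E u X + deg E u Y := by
  unfold deg
  rw [Finset.filter_union, Finset.filter_inter_distrib, Finset.card_union_add_card_inter]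

theorem deg_singleton_self (hG : IsRigidityCircuit V E) (u : ℕ) : deg E u {u} = 0 := by
  simp [deg, Finset.filter_singleton, loopless hG]

theorem Tight.adj_of_card_le_two (hG : IsRigidityCircuit V E) (hT : Tight E X) {x y : ℕ}
    (hx : x ∈ X) (hy : y ∈ X) (hxy : x ≠ y) (h2 : X.card ≤ 2) : s(x, y) ∈ E := by
  have h1 : ({x, y} : Finset ℕ) = X :=
    Finset.eq_of_subset_of_card_le (Finset.insert_subset hx (by simpa using hy))
      (by rwa [Finset.card_pair hxy])
  subst h1
  have h3 := hT.2
  rw [ind_pair (loopless hG) hxy, Finset.card_pair hxy] at h3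
  split_ifs at h3 with h
  · exact h
  · omega

/-- Two blocking sets of the node `u` that share a neighbour of `u` which is itself a node. -/
theorem IsNode.two_le_card_inter (hG : IsRigidityCircuit V E) (h3 : ThreeConnected V E)
    (hn : 5 ≤ V.card) {u x y z : ℕ} (h : IsNode V E u x y z) (hd : deg E x V = 3)
    (hX : X ⊆ V) (hTX : Tight E X) (huX : u ∉ X) (hY : Y ⊆ V) (hTY : Tight E Y)
    (huY : u ∉ Y) (hxX : x ∈ X) (hyX : y ∈ X) (hxY : x ∈ Y) (hzY : z ∈ Y) :
    2 ≤ (X ∩ Y).card := by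
  by_contra hcon
  have e := inter_eq_singleton hcon hxX hxY
  have h1 := deg_union_add_deg_inter (E := E) (X := X) (Y := Y) x
  rw [e, deg_singleton_self hG] at h1
  have h2 := deg_insert (E := E) (t := x) (show u ∉ X ∪ Y by simp [huX, huY])
  have hxu : s(x, u) ∈ E := Sym2.eq_swap ▸ h.adj_fst
  rw [if_pos hxu] at h2
  have h4 := deg_mono (E := E) (u := x)
    (Finset.insert_subset h.mem (Finset.union_subset hX hY))
  have h5 := hTX.deg_pos hG hX hxX
  have h6 := hTY.deg_pos hG hY hxY
  have h7 : X.card ≤ 2 := by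
    by_contra hc
    have := hTX.two_le_deg hG hX (by omega) hxX
    omega
  have h8 : Y.card ≤ 2 := by
    by_contra hc
    have := hTY.two_le_deg hG hY (by omega) hxY
    omega
  have hxy := hTX.adj_of_card_le_two hG hxX hyX h.xy h7
  have hxz := hTY.adj_of_card_le_two hG hxY hzY h.xz h8
  have hx := IsNode.of_adj hG hd hxu hxy hxz (adj_ne hG h.adj_snd)
    (adj_ne hG h.adj_trd) h.yz
  obtain ⟨t, ht, ht'⟩ : ∃ t ∈ V, t ∉ ({u, x, y, z} : Finset ℕ) := by
    by_contra! hcon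
    have := Finset.card_le_card hcon
    have := Finset.card_le_four (a := u) (b := x) (c := y) (d := z)
    omega
  simp only [Finset.mem_insert, Finset.mem_singleton, not_or] at ht'
  have := mem_of_closed h3 (S := {y, z}) (P := {u, x})
    (Finset.insert_subset (mem_right hG hxy) (by simpa using mem_right hG hxz))
    Finset.card_le_two
    ⟨u, by simp, h.mem, by simp [adj_ne hG h.adj_snd, adj_ne hG h.adj_trd]⟩ (by
      simp only [Finset.mem_insert, Finset.mem_singleton, not_or]
      rintro a (rfl | rfl) - - b - hb hab
      · rw [h.adj] at hab
        tauto
      · rw [hx.adj] at hab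
        tauto) ht (by simp [ht'])
  simp only [Finset.mem_insert, Finset.mem_singleton] at this
  tauto

theorem separation_side (hG : IsRigidityCircuit V E) {P Q S : Finset ℕ} (hV : P ∪ Q ∪ S = V)
    (hPS : Disjoint P S) (hQS : Disjoint Q S) (hPQ : Disjoint P Q) (hP : P.Nonempty)
    (hQ : Q.Nonempty) (hS : S.card ≤ 2) (hE : ∀ x ∈ P, ∀ y ∈ Q, s(x, y) ∉ E) :
    S.card = 2 ∧ ind E S = 0 ∧ Tight E (P ∪ S) ∧
      ∀ X ⊂ P ∪ S, S ⊆ X → ind E X + 4 ≤ 2 * X.card := by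
  have hP0 := hP.card_pos
  have hQ0 := hQ.card_pos
  have c1 := Finset.card_union_of_disjoint hPS
  have c2 := Finset.card_union_of_disjoint hQS
  have c3 := Finset.card_union_of_disjoint (Finset.disjoint_union_left.2 ⟨hPS, hQS⟩)
  have c4 := Finset.card_union_of_disjoint hPQ
  rw [hV] at c3
  have hUV : (P ∪ S) ∪ (Q ∪ S) = V := by
    rw [← hV]; ext x; simp only [Finset.mem_union]; tauto
  have hB1 : P ∪ S ⊆ V := hUV ▸ Finset.subset_union_left
  have hB2 : Q ∪ S ⊆ V := hUV ▸ Finset.subset_union_right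
  have hcr : ∀ X, S ⊆ X → X ⊆ P ∪ S → X ∩ (Q ∪ S) = S ∧ cross E X (Q ∪ S) = ∅ := by
    intro X hSX hX
    constructor
    · ext x
      simp only [Finset.mem_inter, Finset.mem_union]
      constructor
      · rintro ⟨hx, hxQ | hxS⟩
        · rcases Finset.mem_union.1 (hX hx) with h | h
          · exact absurd hxQ (Finset.disjoint_left.1 hPQ h)
          · exact h
        · exact hxS
      · exact fun h => ⟨hSX h, Or.inr h⟩
    · rw [Finset.eq_empty_iff_forall_notMem]
      intro e
      induction e with
      | _ x y =>
        simp only [cross, Finset.mem_sdiff, Finset.mem_union, mem_spans]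
        rintro ⟨⟨he, hx, hy⟩, hno⟩
        have h1 : ∀ t ∈ X, t ∈ P ∨ t ∈ S := fun t ht => Finset.mem_union.1 (hX ht)
        have h2 : ∀ t ∈ S, t ∈ X := fun t ht => hSX ht
        have h3 := hE x
        have h4 := hE y
        have he' : s(y, x) ∈ E := Sym2.eq_swap ▸ he
        grind
  obtain ⟨i1, e1⟩ := hcr (P ∪ S) Finset.subset_union_right subset_rfl
  have h1 := ind_add_ind (E := E) (X := P ∪ S) (Y := Q ∪ S)
  rw [i1, e1, hUV, Finset.card_empty] at h1
  have h2 := ind_self hG (by omega)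
  have h3 := ind_le_two_mul hG hB1 (by omega)
  have h4 := ind_le_two_mul hG hB2 (by omega)
  have s1 : P ∪ S ⊂ V := hB1.ssubset_of_ne fun h => by rw [h] at c1; omega
  have s2 : Q ∪ S ⊂ V := hB2.ssubset_of_ne fun h => by rw [h] at c2; omega
  have h5 := ind_le hG s1
  have h6 := ind_le hG s2
  have hS2 : S.card = 2 := by
    by_contra hne
    by_cases hS0 : S.card = 0
    · omega
    · have := h5 (by omega)
      have := h6 (by omega)
      omega
  have h7 := h5 (by omega)
  have h8 := h6 (by omega)
  refine ⟨hS2, by omega, ⟨by omega, by omega⟩, fun X hX hSX => ?_⟩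
  obtain ⟨i2, e2⟩ := hcr X hSX hX.subset
  have h9 := ind_add_ind (E := E) (X := X) (Y := Q ∪ S)
  have h10 := Finset.card_union_add_card_inter X (Q ∪ S)
  rw [i2, hS2] at h10
  rw [i2, e2, Finset.card_empty] at h9
  have hXV : X ∪ (Q ∪ S) ⊆ V := Finset.union_subset (hX.subset.trans hB1) hB2
  have hss : X ∪ (Q ∪ S) ⊂ V := hXV.ssubset_of_ne fun he => by
    have := Finset.card_lt_card hX
    rw [he] at h10
    omega
  have := Finset.card_le_card hSX
  have := ind_le hG hss (by omega)
  omega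

/-- A 2-separation of a circuit has a side that contains the given edge at most in the
separating pair. -/
theorem exists_separation (hG : IsRigidityCircuit V E) (h4 : 4 ≤ V.card)
    (h3 : ¬ ThreeConnected V E) {p q : ℕ} (hpq : s(p, q) ∈ E) :
    ∃ B ⊂ V, ∃ r ∈ B, ∃ t ∈ B, r ≠ t ∧ 3 ≤ B.card ∧ Tight E B ∧ Free E B r t ∧
      (∀ x ∈ B, x ≠ r → x ≠ t → ∀ y, y ∉ B → s(x, y) ∉ E) ∧
      (p ∈ B → p = r ∨ p = t) ∧ (q ∈ B → q = r ∨ q = t) ∧ ¬ (p ∈ B ∧ q ∈ B) := by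
  have key : ∀ P Q S : Finset ℕ, P ∪ Q ∪ S = V → Disjoint P S → Disjoint Q S → Disjoint P Q →
      P.Nonempty → Q.Nonempty → S.card ≤ 2 → (∀ x ∈ P, ∀ y ∈ Q, s(x, y) ∉ E) → p ∉ P → q ∉ P →
      ∃ B ⊂ V, ∃ r ∈ B, ∃ t ∈ B, r ≠ t ∧ 3 ≤ B.card ∧ Tight E B ∧ Free E B r t ∧
        (∀ x ∈ B, x ≠ r → x ≠ t → ∀ y, y ∉ B → s(x, y) ∉ E) ∧
        (p ∈ B → p = r ∨ p = t) ∧ (q ∈ B → q = r ∨ q = t) ∧ ¬ (p ∈ B ∧ q ∈ B) := by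
    intro P Q S hV hPS hQS hPQ hP hQ hS hE hp hq
    obtain ⟨hS2, hS0, hT, hf⟩ := separation_side hG hV hPS hQS hPQ hP hQ hS hE
    obtain ⟨r, t, hrt, rfl⟩ := Finset.card_eq_two.1 hS2
    have hpS : p ∈ P ∪ {r, t} → p = r ∨ p = t := fun h => by
      rcases Finset.mem_union.1 h with h | h
      · exact absurd h hp
      · simpa using h
    have hqS : q ∈ P ∪ {r, t} → q = r ∨ q = t := fun h => by
      rcases Finset.mem_union.1 h with h | h
      · exact absurd h hq
      · simpa using h
    refine ⟨P ∪ {r, t}, ?_, r, by simp, t, by simp, hrt, ?_, hT,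
      fun X hX hr ht => hf X hX ?_, ?_, hpS, hqS, ?_⟩
    · refine hT.ssubset hG ?_
      rw [← hV]
      exact Finset.union_subset_union_left Finset.subset_union_left
    · have := hP.card_pos
      rw [Finset.card_union_of_disjoint hPS]
      omega
    · exact Finset.insert_subset hr (by simpa using ht)
    · intro x hx hxr hxt y hy hxy
      have hyV := mem_right hG hxy
      rw [← hV] at hyV
      simp only [Finset.mem_union, Finset.mem_insert, Finset.mem_singleton] at hx hy hyV
      exact hE x (by tauto) y (by tauto) hxy
    · rintro ⟨h1, h2⟩
      have : 0 < ind E {r, t} := Finset.card_pos.2 ⟨s(p, q), mem_spans.2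
        ⟨hpq, by simpa using hpS h1, by simpa using hqS h2⟩⟩
      omega
  obtain ⟨S, hS, hS2, hcon⟩ : ∃ S ⊆ V, S.card ≤ 2 ∧
      ¬ ConnectedGraph (V \ S) (spans E (V \ S)) := by
    by_contra! h
    exact h3 ⟨h4, h⟩
  have hne : (V \ S).Nonempty := by
    rw [← Finset.card_pos]
    have := Finset.card_sdiff_add_card_eq_card hS
    omega
  obtain ⟨a, ha, b, hb, hab⟩ : ∃ a ∈ V \ S, ∃ b ∈ V \ S,
      ¬ Relation.ReflTransGen (fun x y => s(x, y) ∈ spans E (V \ S)) a b := by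
    by_contra! h
    exact hcon ⟨hne, h⟩
  set P := (V \ S).filter (Relation.ReflTransGen (fun x y => s(x, y) ∈ spans E (V \ S)) a) with hP
  set Q := (V \ S) \ P with hQ
  have hPQ : Disjoint P Q := Finset.disjoint_sdiff
  have hPV : P ⊆ V \ S := Finset.filter_subset _ _
  have hPS : Disjoint P S := Finset.sdiff_disjoint.mono_left hPV
  have hQS : Disjoint Q S := Finset.sdiff_disjoint.mono_left Finset.sdiff_subset
  have hV : P ∪ Q ∪ S = V := by
    rw [hQ, Finset.union_sdiff_of_subset hPV, Finset.sdiff_union_of_subset hS]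
  have haP : a ∈ P := Finset.mem_filter.2 ⟨ha, .refl⟩
  have hbQ : b ∈ Q := Finset.mem_sdiff.2 ⟨hb, fun h => hab (Finset.mem_filter.1 h).2⟩
  have hE : ∀ x ∈ P, ∀ y ∈ Q, s(x, y) ∉ E := by
    intro x hx y hy hxy
    rw [hQ, Finset.mem_sdiff] at hy
    refine hy.2 (Finset.mem_filter.2 ⟨hy.1, (Finset.mem_filter.1 hx).2.tail ?_⟩)
    exact mem_spans.2 ⟨hxy, hPV hx, hy.1⟩
  have hE' : ∀ x ∈ Q, ∀ y ∈ P, s(x, y) ∉ E := fun x hx y hy h => hE y hy x hx (Sym2.eq_swap ▸ h)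
  by_cases h : p ∈ P ∨ q ∈ P
  · have hdis := Finset.disjoint_left.1 hPQ
    refine key Q P S (by rw [Finset.union_comm Q P, hV]) hQS hPS hPQ.symm ⟨b, hbQ⟩ ⟨a, haP⟩ hS2 hE'
      ?_ ?_
    · intro hpQ
      rcases h with h | h
      · exact hdis h hpQ
      · exact hE' p hpQ q h hpq
    · intro hqQ
      rcases h with h | h
      · exact hE p h q hqQ hpq
      · exact hdis h hqQ
  · rw [not_or] at h
    exact key P Q S hV hPS hQS hPQ ⟨a, haP⟩ ⟨b, hbQ⟩ hS2 hE h.1 h.2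

/-- A tight set `X` of the graph restricts to a tight set of the circuit on `C`. -/
theorem Tight.inter_withE (hG : IsRigidityCircuit V E) (hC : C ⊆ V) (hT : Tight E C) {p q : ℕ}
    (hp : p ∈ C) (hq : q ∈ C) (hpq : p ≠ q) (hf : Free E C p q) (h3 : 3 ≤ C.card)
    (hpo : ∃ t, t ∉ C ∧ s(p, t) ∈ E) (hqo : ∃ t, t ∉ C ∧ s(q, t) ∈ E)
    (hX : X ⊆ V) (hTX : Tight E X) (hCX : ¬ C ⊆ X) (h2 : 2 ≤ (X ∩ C).card) :
    Tight (withE E C p q) (X ∩ C) := by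
  have hE := hf.notMem hp hq hpq h3
  have hi := ind_withE hE (Finset.inter_subset_right (s₁ := X) (s₂ := C))
  have hss : X ∩ C ⊂ C := Finset.inter_subset_right.ssubset_of_ne fun h =>
    hCX (Finset.inter_eq_right.1 h)
  by_cases hU : X ∪ C = V
  · obtain ⟨h4, h5⟩ := hTX.ind_inter hG hX hT hU h2
    split_ifs at hi with hin
    · have h6 := ind_le (hT.withE_circuit hG hC hp hq hpq hf h3) hss h2
      have h7 := hf _ hss hin.1 hin.2
      exact ⟨h2, by omega⟩
    · have h6 : 0 < (cross E X C).card := by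
        rw [Finset.card_pos]
        rw [not_and_or] at hin
        have hout : ∀ r ∈ C, r ∉ X ∩ C → (∃ t, t ∉ C ∧ s(r, t) ∈ E) → (cross E X C).Nonempty := by
          rintro r hr hrX ⟨t, ht, hrt⟩
          have htX : t ∈ X := by
            have := mem_right hG hrt
            rw [← hU, Finset.mem_union] at this
            tauto
          exact ⟨s(t, r), mem_cross (Sym2.eq_swap ▸ hrt) htX ht hr
            fun h => hrX (Finset.mem_inter.2 ⟨h, hr⟩)⟩
        rcases hin with h | h
        · exact hout p hp h hpo
        · exact hout q hq h hqo
      exact ⟨h2, by omega⟩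
  · have h4 := (hTX.inter_union hG hX hC hT hU h2).1
    rw [if_neg] at hi
    · exact ⟨h2, by rw [hi]; exact h4.2⟩
    · intro hin
      have := hf _ hss hin.1 hin.2
      have := h4.2
      omega

/-- A tight set `C` that the other vertices can only reach through `p`, `q` and the single edge
`cv`, such that `C` together with the edge `pq` is a circuit. -/
structure Piece (V : Finset ℕ) (E : Finset (Sym2 ℕ)) (C : Finset ℕ) (p q c v : ℕ) : Prop where
  sub : C ⊆ V
  tight : Tight E C
  hp : p ∈ C
  hq : q ∈ C
  hc : c ∈ C
  pq : p ≠ q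
  cp : c ≠ p
  cq : c ≠ q
  hv : v ∉ C
  cv : s(c, v) ∈ E
  out : ∀ x ∈ C, x ≠ p → x ≠ q → ∀ y, y ∉ C → s(x, y) ∈ E → x = c ∧ y = v
  free : Free E C p q
  two : 2 ≤ (V \ C).card

namespace Piece

variable {p q c v : ℕ}

theorem symm (h : Piece V E C p q c v) : Piece V E C q p c v :=
  ⟨h.sub, h.tight, h.hq, h.hp, h.hc, h.pq.symm, h.cq, h.cp, h.hv, h.cv,
    fun x hx h1 h2 => h.out x hx h2 h1, h.free.symm, h.two⟩

theorem three_le_deg (hG : IsRigidityCircuit V E) (h : Piece V E C p q c v) : 3 ≤ deg E c C := by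
  have h1 := ind_erase (loopless hG) h.hc
  have h2 := Finset.card_erase_of_mem h.hc
  have h3 := h.free _ (Finset.erase_ssubset h.hc) (Finset.mem_erase.2 ⟨h.cp.symm, h.hp⟩)
    (Finset.mem_erase.2 ⟨h.cq.symm, h.hq⟩)
  have := h.tight.1
  have := h.tight.2
  omega

theorem four_le_card (hG : IsRigidityCircuit V E) (h : Piece V E C p q c v) : 4 ≤ C.card := by
  have h1 := h.three_le_deg hG
  have h2 : deg E c C ≤ (C.erase c).card := Finset.card_le_card fun x hx => by
    rw [Finset.mem_filter] at hx
    exact Finset.mem_erase.2 ⟨(adj_ne hG hx.2).symm, hx.1⟩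
  rw [Finset.card_erase_of_mem h.hc] at h2
  omega

theorem exists_out (hG : IsRigidityCircuit V E) (h3 : ThreeConnected V E)
    (h : Piece V E C p q c v) : ∃ t, t ∉ C ∧ s(p, t) ∈ E := by
  by_contra! hcon
  refine h.hv (mem_of_closed h3 (S := {q, c}) (P := C) ?_ Finset.card_le_two
    ⟨p, h.hp, h.sub h.hp, ?_⟩ ?_ (mem_right hG h.cv) ?_)
  · exact Finset.insert_subset (h.sub h.hq) (by simpa using h.sub h.hc)
  · simp [h.pq, h.cp.symm]
  · intro x hx _ hxS y _ _ hxy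
    simp only [Finset.mem_insert, Finset.mem_singleton, not_or] at hxS
    by_contra hy
    by_cases hxp : x = p
    · exact hcon y hy (hxp ▸ hxy)
    · exact hxS.2 (h.out x hx hxp hxS.1 y hy hxy).1
  · have hv := h.hv
    simp only [Finset.mem_insert, Finset.mem_singleton, not_or]
    exact ⟨fun e => hv (e ▸ h.hq), fun e => hv (e ▸ h.hc)⟩

theorem circuit (hG : IsRigidityCircuit V E) (h : Piece V E C p q c v) :
    IsRigidityCircuit C (withE E C p q) :=
  h.tight.withE_circuit hG h.sub h.hp h.hq h.pq h.free (by have := h.four_le_card hG; omega)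

/-- A tight set avoiding the outer vertex is nested with the piece. -/
theorem subset_or_subset (hG : IsRigidityCircuit V E) (h : Piece V E C p q c v) (hX : X ⊆ V)
    (hT : Tight E X) (hv : v ∉ X) (h2 : 2 ≤ (X ∩ C).card) : X ⊆ C ∨ C ⊆ X := by
  by_contra! hcon
  have hU : X ∪ C ≠ V := fun he => by
    have := mem_right hG h.cv
    rw [← he, Finset.mem_union] at this
    exact this.elim hv h.hv
  have hin := (hT.inter_union hG hX h.sub h.tight hU h2).1
  have hB : 2 ≤ (X \ (X \ C)).card := by rwa [Finset.sdiff_sdiff_self_left]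
  have hA0 : (X \ C).Nonempty := Finset.sdiff_nonempty.2 hcon.1
  have hcut := hT.exists_adj hG hX Finset.sdiff_subset hA0 hB
  have hmem : ∀ t, ∃ b ∈ X ∩ C, b ≠ t ∧ (b = p ∨ b = q) := by
    intro t
    obtain ⟨b, hb, hbA, hbt, a, ha, hab⟩ := hcut t
    rw [Finset.mem_sdiff] at hbA ha
    have hbC : b ∈ C := by tauto
    refine ⟨b, Finset.mem_inter.2 ⟨hb, hbC⟩, hbt, ?_⟩
    by_contra! hne
    obtain ⟨-, rfl⟩ := h.out b hbC hne.1 hne.2 a ha.2 hab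
    exact hv ha.1
  have hpX : p ∈ X ∩ C := by
    obtain ⟨b, hb, hbt, rfl | rfl⟩ := hmem q
    exacts [hb, absurd rfl hbt]
  have hqX : q ∈ X ∩ C := by
    obtain ⟨b, hb, hbt, rfl | rfl⟩ := hmem p
    exacts [absurd rfl hbt, hb]
  have := h.free _ (Finset.inter_subset_right.ssubset_of_ne fun he =>
    hcon.2 (Finset.inter_eq_right.1 he)) hpX hqX
  have := hin.2
  omega

end Piece

/-- An unblocked node whose reduction is not 3-connected gives a piece. -/
theorem IsNode.exists_piece (hG : IsRigidityCircuit V E) (h3 : ThreeConnected V E)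
    (hn : 5 ≤ V.card) {v a b c : ℕ} (h : IsNode V E v a b c) (hb : ¬ Blocked V E v a b c)
    (hH : ¬ ThreeConnected (V.erase v) (withE E (V.erase v) a b)) :
    ∃ C p q, Piece V E C p q c v := by
  have hsub := Finset.erase_subset v V
  have hcard := Finset.card_erase_of_mem h.mem
  have hT := tight_erase hG (by omega) h.mem (h.deg_eq_three hG)
  have hf := h.free hG hb
  have hane := adj_ne hG h.adj_fst
  have hbne := adj_ne hG h.adj_snd
  have ha : a ∈ V.erase v := Finset.mem_erase.2 ⟨hane.symm, mem_right hG h.adj_fst⟩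
  have hb' : b ∈ V.erase v := Finset.mem_erase.2 ⟨hbne.symm, mem_right hG h.adj_snd⟩
  have hHc := hT.withE_circuit hG hsub ha hb' h.xy hf (by omega)
  have hab := hf.notMem ha hb' h.xy (by omega)
  obtain ⟨B, hB, r, hr, t, ht, hrt, hB3, hBT, hBf, hout, hpB, hqB, hpq⟩ :=
    exists_separation hHc (by omega) hH (p := a) (q := b) (mem_withE.2 (by tauto))
  have hi : ∀ X ⊆ B, ind (withE E (V.erase v) a b) X = ind E X := fun X hX => by
    rw [ind_withE hab (hX.trans hB.subset), if_neg fun h => hpq ⟨hX h.1, hX h.2⟩, add_zero]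
  have hvB : v ∉ B := fun h => Finset.notMem_erase v V (hB.subset h)
  have hBV := hB.subset.trans hsub
  have hout' : ∀ x ∈ B, x ≠ r → x ≠ t → ∀ y, y ∉ B → s(x, y) ∈ E → x = c ∧ y = v := by
    intro x hx hxr hxt y hy hxy
    have hyv : y = v := by
      by_contra hyv
      refine hout x hx hxr hxt y hy (mem_withE.2 (Or.inr ⟨hxy, hB.subset hx, ?_⟩))
      exact Finset.mem_erase.2 ⟨hyv, mem_right hG hxy⟩
    subst hyv
    refine ⟨?_, rfl⟩
    rcases (h.adj x).1 (Sym2.eq_swap ▸ hxy) with rfl | rfl | rfl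
    · exact ((hpB hx).elim hxr hxt).elim
    · exact ((hqB hx).elim hxr hxt).elim
    · rfl
  have hc : c ∈ B ∧ c ≠ r ∧ c ≠ t := by
    by_contra hc
    obtain ⟨x, hx, hx'⟩ : ∃ x ∈ B, x ∉ ({r, t} : Finset ℕ) := by
      by_contra! hcon
      have := Finset.card_le_card hcon
      have := Finset.card_le_two (a := r) (b := t)
      omega
    refine hvB (mem_of_closed h3 (S := {r, t}) (P := B)
      (Finset.insert_subset (hBV hr) (by simpa using hBV ht)) Finset.card_le_two
      ⟨x, hx, hBV hx, hx'⟩ ?_ h.mem ?_)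
    · intro x hx _ hxS y _ _ hxy
      simp only [Finset.mem_insert, Finset.mem_singleton, not_or] at hxS
      by_contra hy
      obtain ⟨rfl, -⟩ := hout' x hx hxS.1 hxS.2 y hy hxy
      exact hc ⟨hx, hxS⟩
    · simp only [Finset.mem_insert, Finset.mem_singleton, not_or]
      exact ⟨fun e => hvB (e ▸ hr), fun e => hvB (e ▸ ht)⟩
  refine ⟨B, r, t, hBV, ⟨hBT.1, by rw [← hi B subset_rfl]; exact hBT.2⟩, hr, ht, hc.1, hrt, hc.2.1,
    hc.2.2, hvB, Sym2.eq_swap ▸ h.adj_trd, hout', fun X hX hrX htX => ?_, ?_⟩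
  · rw [← hi X hX.subset]
    exact hBf X hX hrX htX
  · have h1 := Finset.card_sdiff_add_card_eq_card hBV
    have h2 := Finset.card_lt_card hB
    omega

theorem notMem_of_card_inter_le_one (hG : IsRigidityCircuit V E) (h : ¬ 2 ≤ (X ∩ W).card) {a b : ℕ}
    (hab : s(a, b) ∈ E) (ha : a ∈ W) (hb : b ∈ W) : ¬ (a ∈ X ∧ b ∈ X) := by
  rintro ⟨haX, hbX⟩
  refine h ?_
  rw [← Finset.card_pair (adj_ne hG hab)]
  exact Finset.card_le_card (Finset.insert_subset (Finset.mem_inter.2 ⟨haX, ha⟩)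
    (by simp [hbX, hb]))

theorem Tight.exists_edge (hG : IsRigidityCircuit V E) (hX : X ⊆ V) (hT : Tight E X) {x : ℕ}
    (hx : x ∈ X) : ∃ y ∈ X, s(x, y) ∈ E :=
  exists_adj_of_deg_pos (hT.deg_pos hG hX hx)

/-- Let `W` be a tight set that overlaps every tight set avoiding some common non-node trivially.
Then the node `w` cannot have all its pairs blocked. -/
theorem IsNode.not_all_blocked (hG : IsRigidityCircuit V E) (h3 : ThreeConnected V E)
    (hn : 5 ≤ V.card) (hW : W ⊆ V) (hTW : Tight E W)
    (hmax : ∀ X ⊆ V, Tight E X → ¬ X ⊆ W → (∃ t ∈ V, t ∉ X ∧ t ∉ W ∧ deg E t V ≠ 3) →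
      ¬ 2 ≤ (X ∩ W).card)
    {w x y z : ℕ} (h : IsNode V E w x y z) (hw : w ∉ W) (hxy : Blocked V E w x y z)
    (hyz : Blocked V E w y z x) (hxz : Blocked V E w x z y) (hy : y ∉ W) (hz : z ∉ W)
    (hdz : deg E z V ≠ 3) (hleaf : x ∉ W → deg E x V = 3 → deg E y V = 3 → False) : False := by
  obtain ⟨A, hA, hTA, hxA, hyA, hzA, hwA⟩ := hxy
  obtain ⟨B, hB, hTB, hyB, hzB, hxB, hwB⟩ := hyz
  obtain ⟨D, hD, hTD, hxD, hzD, hyD, hwD⟩ := hxz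
  have hxV := mem_right hG h.adj_fst
  have hyV := mem_right hG h.adj_snd
  have hzV := mem_right hG h.adj_trd
  have mA := hmax A hA hTA (fun h => hy (h hyA)) ⟨z, hzV, hzA, hz, hdz⟩
  have mB : x ∉ W → deg E x V ≠ 3 → ¬ 2 ≤ (B ∩ W).card := fun hx hd =>
    hmax B hB hTB (fun h => hy (h hyB)) ⟨x, hxV, hxB, hx, hd⟩
  have mD : deg E y V ≠ 3 → ¬ 2 ≤ (D ∩ W).card := fun hd =>
    hmax D hD hTD (fun h => hz (h hzD)) ⟨y, hyV, hyD, hy, hd⟩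
  have key : ∃ a b, s(a, b) ∈ E ∧ a ∈ W ∧ b ∈ W ∧ (x ∈ W → a = x) := by
    by_cases hx : x ∈ W
    · obtain ⟨b, hb, hab⟩ := hTW.exists_edge hG hW hx
      exact ⟨x, b, hab, hx, hb, fun _ => rfl⟩
    · obtain ⟨a, ha⟩ := Finset.card_pos.1 (show 0 < W.card by have := hTW.1; omega)
      obtain ⟨b, hb, hab⟩ := hTW.exists_edge hG hW ha
      exact ⟨a, b, hab, ha, hb, fun h => absurd h hx⟩
  obtain ⟨a, b, hab, ha, hb, hax⟩ := key
  have haw : a ≠ w := by rintro rfl; exact hw ha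
  have hbw : b ≠ w := by rintro rfl; exact hw hb
  have nA := notMem_of_card_inter_le_one hG mA hab ha hb
  have nB : ¬ (deg E x V = 3 ∧ x ∉ W) → ¬ (a ∈ B ∧ b ∈ B) := fun hd => by
    by_cases hx : x ∈ W
    · rintro ⟨haB, -⟩
      exact hxB (hax hx ▸ haB)
    · exact notMem_of_card_inter_le_one hG (mB hx fun h => hd ⟨h, hx⟩) hab ha hb
  have nD : deg E y V ≠ 3 → ¬ (a ∈ D ∧ b ∈ D) := fun hd =>
    notMem_of_card_inter_le_one hG (mD hd) hab ha hb
  by_cases hdy : deg E y V = 3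
  · have hi := h.swap.two_le_card_inter hG h3 hn hdy hA hTA hwA hB hTB hwB hyA hxA hyB hzB
    rcases (h.edges_of_two hG hA hTA hwA hB hTB hwB (by simp [hxA]) (by simp [hyA]) (by simp [hzB])
      hi).2 a b hab haw hbw with h | h
    · exact nA h
    · exact nB (fun hd => hleaf hd.2 hd.1 hdy) h
  by_cases hdx : deg E x V = 3 ∧ x ∉ W
  · have hi := h.two_le_card_inter hG h3 hn hdx.1 hA hTA hwA hD hTD hwD hxA hyA hxD hzD
    rcases (h.edges_of_two hG hA hTA hwA hD hTD hwD (by simp [hxA]) (by simp [hyA]) (by simp [hzD])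
      hi).2 a b hab haw hbw with h | h
    · exact nA h
    · exact nD hdy h
  · rcases h.edges_of_three hG hA hTA hwA hB hTB hwB hD hTD hwD hxA hyA hyB hzB hxD hzD a b hab haw
      hbw with h | h | h
    exacts [nA h, nB hdx h, nD hdy h]

theorem notMem_of_deg_le_one {w s t : ℕ} (h : deg E w W ≤ 1) (hst : s ≠ t) (hs : s(w, s) ∈ E)
    (ht : s(w, t) ∈ E) (hsW : s ∈ W) : t ∉ W := by
  intro htW
  have : ({s, t} : Finset ℕ) ⊆ W.filter fun x => s(w, x) ∈ E :=
    Finset.insert_subset (by simp [hsW, hs]) (by simp [htW, ht])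
  have := Finset.card_le_card this
  rw [Finset.card_pair hst] at this
  unfold deg at h
  omega

theorem Blocked.symm {u x y z : ℕ} (h : Blocked V E u x y z) : Blocked V E u y x z := by
  obtain ⟨X, hX, hT, hx, hy, h⟩ := h
  exact ⟨X, hX, hT, hy, hx, h⟩

/-- Outside a tight set that misses a non-node there is an unblocked node. The tight set can be
enlarged to one that is maximal subject to missing a non-node and such that the unblocked node has
at most one neighbour in it and at most one neighbour outside it that is a node. -/
theorem exists_unblocked_outside (hG : IsRigidityCircuit V E) (h3 : ThreeConnected V E)
    (hn : 5 ≤ V.card) (hC : C ⊆ V) (hTC : Tight E C) (hnn : ∃ t ∈ V, t ∉ C ∧ deg E t V ≠ 3)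
    (v : ℕ) :
    ∃ W w x y z, C ⊆ W ∧ W ⊆ V ∧ Tight E W ∧
      (∀ X ⊆ V, W ⊆ X → Tight E X → (∃ t ∈ V, t ∉ X ∧ deg E t V ≠ 3) → X = W) ∧
      w ∉ W ∧ w ≠ v ∧ IsNode V E w x y z ∧ ¬ Blocked V E w x y z ∧ deg E w W ≤ 1 ∧
      (∀ s t, s ≠ t → s(w, s) ∈ E → s(w, t) ∈ E → s ∉ W → t ∉ W → deg E s V = 3 →
        deg E t V ≠ 3) := by
  obtain ⟨W, hWF, hWmax⟩ := (V.powerset.filter fun X => C ⊆ X ∧ Tight E X ∧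
    ∃ t ∈ V, t ∉ X ∧ deg E t V ≠ 3).exists_max_image Finset.card
    ⟨C, by simp [hC, hTC, hnn]⟩
  simp only [Finset.mem_filter, Finset.mem_powerset] at hWF hWmax
  obtain ⟨hW, hCW, hTW, z₀, hz₀, hz₀W, hz₀d⟩ := hWF
  have hmax : ∀ X ⊆ V, W ⊆ X → Tight E X → (∃ t ∈ V, t ∉ X ∧ deg E t V ≠ 3) → X = W :=
    fun X hX hWX hT ht =>
      (Finset.eq_of_subset_of_card_le hWX (hWmax X ⟨hX, hCW.trans hWX, hT, ht⟩)).symm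
  have hsd := Finset.card_sdiff_add_card_eq_card hW
  have hY2 : 2 ≤ (V \ W).card := by
    by_contra hcon
    have h1 : V \ W = {z₀} := by
      symm
      refine Finset.eq_of_subset_of_card_le (by simp [hz₀, hz₀W]) ?_
      rw [Finset.card_singleton]
      omega
    have h2 : V.erase z₀ = W := by
      rw [← Finset.sdiff_singleton_eq_erase, ← h1, Finset.sdiff_sdiff_eq_self hW]
    have h3 := ind_erase (loopless hG) hz₀
    have h4 := ind_self hG (by omega)
    have h5 := hTW.2
    rw [h1, Finset.card_singleton] at hsd
    rw [h2] at h3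
    omega
  set N := (V \ W).filter fun u => deg E u V = 3 with hN
  have hN2 : 2 ≤ N.card := hTW.two_le_card_nodes hG hW hY2
  have hNV : N ⊆ V \ W := Finset.filter_subset _ _
  have hNd : ∀ u ∈ N, deg E u V = 3 := fun u hu => (Finset.mem_filter.1 hu).2
  have hVN : 2 ≤ (V \ N).card := hTW.1.trans (Finset.card_le_card fun x hx =>
    Finset.mem_sdiff.2 ⟨hW hx, fun h => (Finset.mem_sdiff.1 (hNV h)).2 hx⟩)
  obtain ⟨w, hwN, hwv, hwleaf⟩ := exists_leaf hG (hNV.trans Finset.sdiff_subset) hNd hVN hN2 v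
  have hwW := (Finset.mem_sdiff.1 (hNV hwN)).2
  have hwV := (Finset.mem_sdiff.1 (hNV hwN)).1
  have hwd := hNd w hwN
  have hwW1 : deg E w W ≤ 1 := by
    by_contra hcon
    have hT := hTW.insert hG hW hwV hwW (by omega) hY2
    have := hmax _ (Finset.insert_subset hwV hW) (Finset.subset_insert w W) hT
      ⟨z₀, hz₀, by
        rw [Finset.mem_insert, not_or]
        exact ⟨fun h => hz₀d (h ▸ hwd), hz₀W⟩, hz₀d⟩
    exact hwW (this ▸ Finset.mem_insert_self w W)
  have hleaf : ∀ s t, s ≠ t → s(w, s) ∈ E → s(w, t) ∈ E → s ∉ W → t ∉ W → deg E s V = 3 →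
      deg E t V ≠ 3 := by
    intro s t hst hs ht hsW htW hsd htd
    refine notMem_of_deg_le_one hwleaf hst hs ht ?_ ?_
    · exact Finset.mem_filter.2 ⟨Finset.mem_sdiff.2 ⟨mem_right hG hs, hsW⟩, hsd⟩
    · exact Finset.mem_filter.2 ⟨Finset.mem_sdiff.2 ⟨mem_right hG ht, htW⟩, htd⟩
  have hmeet : ∀ X ⊆ V, Tight E X → ¬ X ⊆ W → (∃ t ∈ V, t ∉ X ∧ t ∉ W ∧ deg E t V ≠ 3) →
      ¬ 2 ≤ (X ∩ W).card := by
    rintro X hX hT hXW ⟨t, ht, htX, htW, htd⟩ h2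
    have htU : t ∉ X ∪ W := by simp [htX, htW]
    have := hmax (X ∪ W) (Finset.union_subset hX hW) Finset.subset_union_right
      (hT.inter_union hG hX hW hTW (fun h => htU (h ▸ ht)) h2).2.1 ⟨t, ht, htU, htd⟩
    exact hXW (this ▸ Finset.subset_union_left)
  by_contra! hcon
  have hbl : ∀ x y z, IsNode V E w x y z → Blocked V E w x y z := by
    intro x y z h
    by_contra hb
    obtain ⟨s, t, h1, h2, h3, h4, h5, h6, h7⟩ :=
      hcon W w x y z hCW hW hTW hmax hwW hwv h hb hwW1
    exact hleaf s t h1 h2 h3 h4 h5 h6 h7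
  have hno : ∀ x y z, IsNode V E w x y z → y ∉ W → z ∉ W → deg E z V ≠ 3 → False := by
    intro x y z h hy hz hdz
    refine h.not_all_blocked hG h3 hn hW hTW hmeet hwW (hbl _ _ _ h) (hbl _ _ _ h.rotate)
      (hbl _ _ _ h.rotate.rotate).symm hy hz hdz fun hx hdx hdy => ?_
    exact hleaf x y h.xy h.adj_fst h.adj_snd hx hy hdx hdy
  have hno' : ∀ x y z, IsNode V E w x y z → y ∉ W → z ∉ W → False := by
    intro x y z h hy hz
    by_cases hdz : deg E z V = 3
    · exact hno x z y h.swap.rotate hz hy fun hdy =>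
        hleaf y z h.yz h.adj_snd h.adj_trd hy hz hdy hdz
    · exact hno x y z h hy hz hdz
  obtain ⟨x, y, z, h⟩ := exists_isNode hG hwV hwd
  by_cases hx : x ∈ W
  · exact hno' x y z h (notMem_of_deg_le_one hwW1 h.xy h.adj_fst h.adj_snd hx)
      (notMem_of_deg_le_one hwW1 h.xz h.adj_fst h.adj_trd hx)
  · by_cases hy : y ∈ W
    · exact hno' y x z h.swap hx (notMem_of_deg_le_one hwW1 h.yz h.adj_snd h.adj_trd hy)
    · exact hno' z x y h.rotate.rotate hx hy

theorem exists_unblocked (hG : IsRigidityCircuit V E) (h3 : ThreeConnected V E)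
    (hn : 5 ≤ V.card) {p q : ℕ} (hpq : s(p, q) ∈ E) (c : ℕ) :
    ∃ u x y z, IsNode V E u x y z ∧ ¬ Blocked V E u x y z ∧ u ≠ p ∧ u ≠ q ∧ u ≠ c := by
  have hne := adj_ne hG hpq
  have hsub : ({p, q} : Finset ℕ) ⊆ V :=
    Finset.insert_subset (mem_left hG hpq) (by simpa using mem_right hG hpq)
  have hcard := Finset.card_pair hne
  by_cases hnn : ∃ t ∈ V, t ∉ ({p, q} : Finset ℕ) ∧ deg E t V ≠ 3
  · have hT : Tight E {p, q} := by
      refine ⟨by omega, ?_⟩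
      rw [ind_pair (loopless hG) hne, if_pos hpq, hcard]
    obtain ⟨W, w, x, y, z, hCW, -, -, -, hw, hwc, h, hb, -, -⟩ :=
      exists_unblocked_outside hG h3 hn hsub hT hnn c
    exact ⟨w, x, y, z, h, hb, fun e => hw (hCW (by simp [e])), fun e => hw (hCW (by simp [e])), hwc⟩
  · push Not at hnn
    have hVN : V \ (V \ {p, q}) = {p, q} := Finset.sdiff_sdiff_eq_self hsub
    have hsd := Finset.card_sdiff_add_card_eq_card hsub
    obtain ⟨u, huN, huc, hleaf⟩ := exists_leaf hG (N := V \ {p, q}) Finset.sdiff_subset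
      (fun u hu => hnn u (Finset.mem_sdiff.1 hu).1 (Finset.mem_sdiff.1 hu).2)
      (by rw [hVN]; omega) (by omega) c
    have hu := Finset.mem_sdiff.1 huN
    have h1 := deg_union_add_deg_inter (E := E) (X := V \ {p, q}) (Y := {p, q}) u
    rw [Finset.sdiff_union_of_subset hsub, Finset.sdiff_inter_self, hnn u hu.1 hu.2] at h1
    have h2 : deg E u {p, q} ≤ 2 := hcard ▸ Finset.card_filter_le _ _
    have h4 : deg E u ∅ = 0 := rfl
    obtain ⟨x, hx, hux⟩ := exists_adj_of_deg_pos (show 0 < deg E u (V \ {p, q}) by omega)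
    obtain ⟨p', hp', hp'q, hup⟩ := exists_adj_of_two_le_deg q (show 2 ≤ deg E u {p, q} by omega)
    obtain ⟨q', hq', hq'p, huq⟩ := exists_adj_of_two_le_deg p (show 2 ≤ deg E u {p, q} by omega)
    simp only [Finset.mem_insert, Finset.mem_singleton] at hp' hq'
    obtain rfl : p' = p := by tauto
    obtain rfl : q' = q := by tauto
    have hx' := Finset.mem_sdiff.1 hx
    have hu2 := hu.2
    have hx2 := hx'.2
    simp only [Finset.mem_insert, Finset.mem_singleton, not_or] at hu2 hx2
    have h := IsNode.of_adj hG (hnn u hu.1 hu.2) hux hup huq hx2.1 hx2.2 hne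
    by_cases b1 : Blocked V E u x p' q'
    · by_cases b2 : Blocked V E u x q' p'
      · obtain ⟨A, hA, hTA, hxA, hpA, hqA, huA⟩ := b1
        obtain ⟨B, hB, hTB, hxB, hqB, hpB, huB⟩ := b2
        have hi := h.two_le_card_inter hG h3 hn (hnn x hx'.1 hx'.2) hA hTA huA hB hTB huB hxA hpA
          hxB hqB
        rcases (h.edges_of_two hG hA hTA huA hB hTB huB (by simp [hxA]) (by simp [hpA])
          (by simp [hqB]) hi).2 p' q' hpq (Ne.symm hu2.1) (Ne.symm hu2.2) with h | h
        · exact absurd h.2 hqA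
        · exact absurd h.1 hpB
      · exact ⟨u, x, q', p', h.rotate.rotate.swap, b2, hu2.1, hu2.2, huc⟩
    · exact ⟨u, x, p', q', h, b1, hu2.1, hu2.2, huc⟩

namespace Piece

variable {p q c v : ℕ}

theorem threeConnected (hG : IsRigidityCircuit V E) (h3 : ThreeConnected V E)
    (h : Piece V E C p q c v)
    (hmin : ∀ D r s d w, Piece V E D r s d w → C.card ≤ D.card) :
    ThreeConnected C (withE E C p q) := by
  by_contra hH
  have h4 := h.four_le_card hG
  have hpq := h.free.notMem h.hp h.hq h.pq (by omega)
  obtain ⟨B, hB, r, hr, t, ht, hrt, hB3, hBT, hBf, hout, hpB, hqB, hpqB⟩ :=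
    exists_separation (h.circuit hG) h4 hH (p := p) (q := q) (mem_withE.2 (by tauto))
  have hi : ∀ X ⊆ B, ind (withE E C p q) X = ind E X := fun X hX => by
    rw [ind_withE hpq (hX.trans hB.subset), if_neg fun h => hpqB ⟨hX h.1, hX h.2⟩, add_zero]
  have hvB : v ∉ B := fun hv => h.hv (hB.subset hv)
  have hBV := hB.subset.trans h.sub
  have hout' : ∀ x ∈ B, x ≠ r → x ≠ t → ∀ y, y ∉ B → s(x, y) ∈ E → x = c ∧ y = v := by
    intro x hx hxr hxt y hy hxy
    refine h.out x (hB.subset hx) ?_ ?_ y ?_ hxy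
    · rintro rfl
      exact (hpB hx).elim hxr hxt
    · rintro rfl
      exact (hqB hx).elim hxr hxt
    · exact fun hyC => hout x hx hxr hxt y hy (mem_withE.2 (Or.inr ⟨hxy, hB.subset hx, hyC⟩))
  have hc : c ∈ B ∧ c ≠ r ∧ c ≠ t := by
    by_contra hc
    obtain ⟨x, hx, hx'⟩ : ∃ x ∈ B, x ∉ ({r, t} : Finset ℕ) := by
      by_contra! hcon
      have := Finset.card_le_card hcon
      have := Finset.card_le_two (a := r) (b := t)
      omega
    refine hvB (mem_of_closed h3 (S := {r, t}) (P := B)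
      (Finset.insert_subset (hBV hr) (by simpa using hBV ht)) Finset.card_le_two
      ⟨x, hx, hBV hx, hx'⟩ ?_ (mem_right hG h.cv) ?_)
    · intro x hx _ hxS y _ _ hxy
      simp only [Finset.mem_insert, Finset.mem_singleton, not_or] at hxS
      by_contra hy
      obtain ⟨rfl, -⟩ := hout' x hx hxS.1 hxS.2 y hy hxy
      exact hc ⟨hx, hxS⟩
    · simp only [Finset.mem_insert, Finset.mem_singleton, not_or]
      exact ⟨fun e => hvB (e ▸ hr), fun e => hvB (e ▸ ht)⟩
  have hpiece : Piece V E B r t c v := by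
    refine ⟨hBV, ⟨hBT.1, by rw [← hi B subset_rfl]; exact hBT.2⟩, hr, ht, hc.1, hrt, hc.2.1,
      hc.2.2, hvB, h.cv, hout', fun X hX hrX htX => ?_, ?_⟩
    · rw [← hi X hX.subset]
      exact hBf X hX hrX htX
    · exact h.two.trans (Finset.card_le_card (Finset.sdiff_subset_sdiff le_rfl hB.subset))
  have := hmin _ _ _ _ _ hpiece
  have := Finset.card_lt_card hB
  omega

theorem mem_of_adj (h : Piece V E C p q c v) {u y : ℕ} (hu : u ∈ C) (hp : u ≠ p) (hq : u ≠ q)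
    (hc : u ≠ c) (hy : s(u, y) ∈ E) : y ∈ C := by
  by_contra hyC
  exact hc (h.out u hu hp hq y hyC hy).1

theorem exists_unblocked_of_five_le (hG : IsRigidityCircuit V E) (h3 : ThreeConnected V E)
    (h : Piece V E C p q c v) (hH : ThreeConnected C (withE E C p q)) (h5 : 5 ≤ C.card) :
    ∃ u x y z, u ∈ C ∧ u ≠ p ∧ u ≠ q ∧ u ≠ c ∧ IsNode V E u x y z ∧ ¬ Blocked V E u x y z := by
  obtain ⟨u, x, y, z, hN, hb, hup, huq, huc⟩ :=
    exists_unblocked (h.circuit hG) hH h5 (p := p) (q := q) (mem_withE.2 (by tauto)) c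
  refine ⟨u, x, y, z, hN.mem, hup, huq, huc,
    ⟨h.sub hN.mem, hN.xy, hN.xz, hN.yz, fun t => ?_⟩, ?_⟩
  · rw [← hN.adj, mem_withE]
    have := fun ht => h.mem_of_adj (y := t) hN.mem hup huq huc ht
    have := hN.mem
    tauto
  · rintro ⟨X, hX, hT, hx, hy, hz, hu⟩
    have hxC := mem_right (h.circuit hG) hN.adj_fst
    have hyC := mem_right (h.circuit hG) hN.adj_snd
    have h2 : 2 ≤ (X ∩ C).card := by
      rw [← Finset.card_pair hN.xy]
      exact Finset.card_le_card (Finset.insert_subset (by simp [hx, hxC]) (by simp [hy, hyC]))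
    refine hb ⟨X ∩ C, Finset.inter_subset_right, h.tight.inter_withE hG h.sub h.hp h.hq h.pq
      h.free (by omega) (h.exists_out hG h3) (h.symm.exists_out hG h3) hX hT
      (fun hC => hu (hC hN.mem)) h2,
      by simp [hx, hxC], by simp [hy, hyC], by simp [hz], by simp [hu]⟩

theorem exists_unblocked_of_card_eq_four (hG : IsRigidityCircuit V E)
    (h : Piece V E C p q c v) (h4 : C.card = 4) :
    ∃ u x y z, u ∈ C ∧ u ≠ p ∧ u ≠ q ∧ u ≠ c ∧ IsNode V E u x y z ∧ ¬ Blocked V E u x y z := by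
  have hpqc : ({p, q, c} : Finset ℕ).card = 3 :=
    Finset.card_eq_three.2 ⟨p, q, c, h.pq, h.cp.symm, h.cq.symm, rfl⟩
  have hsub : ({p, q, c} : Finset ℕ) ⊆ C :=
    Finset.insert_subset h.hp (Finset.insert_subset h.hq (by simpa using h.hc))
  obtain ⟨u, hu⟩ := Finset.card_eq_one.1 (show (C \ {p, q, c}).card = 1 by
    have := Finset.card_sdiff_add_card_eq_card hsub
    omega)
  have huC : ∀ t, t ∈ C → t = u ∨ t = p ∨ t = q ∨ t = c := by
    intro t ht
    have := Finset.ext_iff.1 hu t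
    simp only [Finset.mem_sdiff, Finset.mem_insert, Finset.mem_singleton] at this
    tauto
  have hu' : u ∈ C \ {p, q, c} := by simp [hu]
  simp only [Finset.mem_sdiff, Finset.mem_insert, Finset.mem_singleton, not_or] at hu'
  obtain ⟨huC', hup, huq, huc⟩ := hu'
  have hle : (V.filter fun x => s(u, x) ∈ E) ⊆ {p, q, c} := by
    intro t ht
    rw [Finset.mem_filter] at ht
    have := huC t (h.mem_of_adj huC' hup huq huc ht.2)
    have := (adj_ne hG ht.2).symm
    simp only [Finset.mem_insert, Finset.mem_singleton]
    tauto
  have hd := CircuitCRD.three_le_deg hG (u := u)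
    (by have := Finset.card_le_card h.sub; omega) (h.sub huC')
  have heq := Finset.eq_of_subset_of_card_le hle (by rw [hpqc]; exact hd)
  have hadj : ∀ t, s(u, t) ∈ E ↔ t = p ∨ t = q ∨ t = c := by
    intro t
    have := Finset.ext_iff.1 heq t
    simp only [Finset.mem_filter, Finset.mem_insert, Finset.mem_singleton] at this
    rw [← this]
    exact ⟨fun ht => ⟨mem_right hG ht, ht⟩, fun ht => ht.2⟩
  refine ⟨u, p, q, c, huC', hup, huq, huc,
    ⟨h.sub huC', h.pq, h.cp.symm, h.cq.symm, hadj⟩, ?_⟩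
  rintro ⟨X, hX, hT, hp, hq, hc, huX⟩
  have hf := h.free (X ∩ C) (Finset.inter_subset_right.ssubset_of_ne fun he =>
    huX (Finset.inter_eq_right.1 he huC')) (by simp [hp, h.hp]) (by simp [hq, h.hq])
  have h2 : 2 ≤ (X ∩ C).card := by
    rw [← Finset.card_pair h.pq]
    exact Finset.card_le_card
      (Finset.insert_subset (by simp [hp, h.hp]) (by simp [hq, h.hq]))
  by_cases hU : X ∪ C = V
  · have h5 := (hT.ind_inter hG hX h.tight hU h2).1
    have hvX : v ∈ X := by
      have := mem_right hG h.cv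
      rw [← hU, Finset.mem_union] at this
      exact this.resolve_right h.hv
    have : 0 < (cross E X C).card := Finset.card_pos.2
      ⟨s(v, c), mem_cross (Sym2.eq_swap ▸ h.cv) hvX h.hv h.hc hc⟩
    omega
  · have := (hT.inter_union hG hX h.sub h.tight hU h2).1.2
    omega

/-- A minimal piece and a piece, each containing the outer vertex of the other, do not overlap in
a proper subset in this way. -/
theorem not_overlapping (hG : IsRigidityCircuit V E) (h3 : ThreeConnected V E)
    (h : Piece V E C p q c v)
    (hmin : ∀ D r s d w, Piece V E D r s d w → C.card ≤ D.card)
    {D : Finset ℕ} {r s d u : ℕ} (hD : Piece V E D r s d u) (huC : u ∈ C) (hvD : v ∈ D)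
    (hU : C ∪ D ≠ V) (hI : Tight E (C ∩ D)) (hc : c ∈ D) (hd : d ∈ C)
    (hp : p ∈ D) (hq : q ∉ D) (hs : s ∈ C) (hr : r ∉ C) : False := by
  have hUV := Finset.union_subset h.sub hD.sub
  obtain ⟨t₀, ht₀, ht₀U⟩ := Finset.exists_of_ssubset (hUV.ssubset_of_ne hU)
  have hexit : ∀ x ∈ C ∪ D, ∀ y, y ∉ C ∪ D → s(x, y) ∈ E → x = q ∨ x = r ∨ (x = p ∧ p = s) := by
    intro x hx y hy hxy
    rw [Finset.mem_union, not_or] at hy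
    by_contra! hne
    have hCx : x ∈ C → x = p := fun hxC => by
      by_contra hxp
      obtain ⟨-, rfl⟩ := h.out x hxC hxp hne.1 y hy.1 hxy
      exact hy.2 hvD
    have hDx : x ∈ D → x = s := fun hxD => by
      by_contra hxs
      obtain ⟨-, rfl⟩ := hD.out x hxD hne.2.1 hxs y hy.2 hxy
      exact hy.1 huC
    have hx' : x = p := by
      rcases Finset.mem_union.1 hx with hx | hx
      · exact hCx hx
      · exact hCx (hDx hx ▸ hs)
    exact hne.2.2 hx' (hx' ▸ hDx (hx' ▸ hp))
  have hrc : r ≠ c := by rintro rfl; exact hr h.hc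
  by_cases hps : p = s
  · subst hps
    by_cases hcd : c = d
    · subst hcd
      obtain ⟨x, hx, hxp, hxc⟩ : ∃ x ∈ C ∩ D, x ≠ p ∧ x ≠ c := by
        by_contra! hcon
        have : (C.filter fun x => s(c, x) ∈ E) ⊆ {p, u} := by
          intro x hx
          rw [Finset.mem_filter] at hx
          have hxc := (adj_ne hG hx.2).symm
          by_cases hxD : x ∈ D
          · have := hcon x (Finset.mem_inter.2 ⟨hx.1, hxD⟩)
            rw [Finset.mem_insert]
            tauto
          · have := (hD.out c hc hD.cp hD.cq x hxD hx.2).2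
            simp [this]
        have h1 := Finset.card_le_card this
        have h2 := Finset.card_le_two (a := p) (b := u)
        have h4 := h.three_le_deg hG
        unfold deg at h4
        omega
      have hq' := mem_of_closed h3 (S := {p, c}) (P := C ∩ D)
        (Finset.insert_subset (h.sub h.hp) (by simpa using h.sub h.hc)) Finset.card_le_two
        ⟨x, hx, h.sub (Finset.mem_inter.1 hx).1, by simp [hxp, hxc]⟩ (by
          intro x hx _ hxS y _ _ hxy
          simp only [Finset.mem_insert, Finset.mem_singleton, not_or] at hxS
          rw [Finset.mem_inter] at hx ⊢
          exact ⟨h.mem_of_adj hx.1 hxS.1 (fun e => hq (e ▸ hx.2)) hxS.2 hxy,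
            hD.mem_of_adj hx.2 (fun e => hr (e ▸ hx.1)) hxS.1 hxS.2 hxy⟩)
        (h.sub h.hq) (by simp [h.pq.symm, h.cq.symm])
      exact hq (Finset.mem_inter.1 hq').2
    · have hss : C ∩ D ⊂ C := Finset.inter_subset_left.ssubset_of_ne fun he =>
        hq (Finset.inter_eq_left.1 he h.hq)
      have hpiece : Piece V E (C ∩ D) p d c v := by
        refine ⟨hss.subset.trans h.sub, hI, by simp [hp, h.hp], by simp [hd, hD.hc],
          by simp [hc, h.hc], hD.cq.symm, h.cp, hcd, by simp [h.hv], h.cv, ?_, ?_, ?_⟩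
        · intro x hx hxp hxd y hy hxy
          rw [Finset.mem_inter] at hx hy
          refine h.out x hx.1 hxp (fun e => hq (e ▸ hx.2)) y (fun hyC => hy ⟨hyC, ?_⟩) hxy
          exact hD.mem_of_adj hx.2 (fun e => hr (e ▸ hx.1)) hxp hxd hxy
        · intro X hX hpX hdX
          have hXC := hX.subset.trans Finset.inter_subset_left
          have hun : (C ∩ D) ∪ (X ∪ C \ D) = C := by
            ext x
            have : x ∈ X → x ∈ C ∩ D := fun hx => hX.subset hx
            simp only [Finset.mem_union, Finset.mem_inter, Finset.mem_sdiff] at this ⊢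
            tauto
          have hin : (C ∩ D) ∩ (X ∪ C \ D) = X := by
            ext x
            have : x ∈ X → x ∈ C ∩ D := fun hx => hX.subset hx
            simp only [Finset.mem_union, Finset.mem_inter, Finset.mem_sdiff] at this ⊢
            tauto
          have hcr' : cross E (C ∩ D) (X ∪ C \ D) = ∅ := by
            rw [Finset.eq_empty_iff_forall_notMem]
            have key : ∀ x ∈ C ∩ D, ∀ y, y ∉ D → s(x, y) ∈ E → x ∈ X := by
              intro x hx y hy hxy
              rw [Finset.mem_inter] at hx
              by_contra hxX
              refine hy (hD.mem_of_adj hx.2 (fun e => hr (e ▸ hx.1)) ?_ ?_ hxy)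
              · rintro rfl; exact hxX hpX
              · rintro rfl; exact hxX hdX
            intro e
            induction e with
            | _ x y =>
              intro hxy
              simp only [cross, hun, Finset.mem_sdiff, Finset.mem_union, mem_spans] at hxy
              obtain ⟨⟨he, hx, hy⟩, hno⟩ := hxy
              by_cases hxD : x ∈ D <;> by_cases hyD : y ∈ D
              · exact hno (Or.inl ⟨he, Finset.mem_inter.2 ⟨hx, hxD⟩,
                  Finset.mem_inter.2 ⟨hy, hyD⟩⟩)
              · exact hno (Or.inr ⟨he, Or.inl (key x (Finset.mem_inter.2 ⟨hx, hxD⟩) y hyD he),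
                  Or.inr ⟨hy, hyD⟩⟩)
              · exact hno (Or.inr ⟨he, Or.inr ⟨hx, hxD⟩, Or.inl
                  (key y (Finset.mem_inter.2 ⟨hy, hyD⟩) x hxD (Sym2.eq_swap ▸ he))⟩)
              · exact hno (Or.inr ⟨he, Or.inr ⟨hx, hxD⟩, Or.inr ⟨hy, hyD⟩⟩)
          have h1 := ind_add_ind (E := E) (X := C ∩ D) (Y := X ∪ C \ D)
          have h2 := Finset.card_union_add_card_inter (C ∩ D) (X ∪ C \ D)
          rw [hun, hin, hcr', Finset.card_empty] at h1
          rw [hun, hin] at h2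
          have h5 := Finset.card_lt_card hX
          have h6 := h.free (X ∪ C \ D) (by
            refine (Finset.union_subset hXC Finset.sdiff_subset).ssubset_of_ne fun he => ?_
            rw [he] at h2
            omega) (by simp [hpX]) (by simp [hq, h.hq])
          have := h.tight.2
          have := hI.2
          omega
        · exact h.two.trans (Finset.card_le_card (Finset.sdiff_subset_sdiff le_rfl hss.subset))
      have := hmin _ _ _ _ _ hpiece
      have := Finset.card_lt_card hss
      omega
  · refine ht₀U (mem_of_closed h3 (S := {q, r}) (P := C ∪ D)
      (Finset.insert_subset (h.sub h.hq) (by simpa using hD.sub hD.hp)) Finset.card_le_two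
      ⟨c, by simp [hc], h.sub h.hc, by simp [h.cq, hrc.symm]⟩ ?_ ht₀ ?_)
    · intro x hx _ hxS y _ _ hxy
      simp only [Finset.mem_insert, Finset.mem_singleton, not_or] at hxS
      by_contra hy
      have := hexit x hx y hy hxy
      tauto
    · simp only [Finset.mem_insert, Finset.mem_singleton, not_or]
      rw [Finset.mem_union, not_or] at ht₀U
      exact ⟨fun e => ht₀U.1 (e ▸ h.hq), fun e => ht₀U.2 (e ▸ hD.hp)⟩

/-- A piece whose outer vertex lies in a minimal piece overlaps it and covers the rest. -/
theorem union_eq (hG : IsRigidityCircuit V E) (h3 : ThreeConnected V E)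
    (h : Piece V E C p q c v)
    (hmin : ∀ D r s d w, Piece V E D r s d w → C.card ≤ D.card)
    {D : Finset ℕ} {r s d u : ℕ} (hD : Piece V E D r s d u) (huC : u ∈ C) (hd : d ∈ C) :
    C ∪ D = V ∧ 2 ≤ (C ∩ D).card := by
  have h4 := h.four_le_card hG
  have hI : 2 ≤ (C ∩ D).card := by
    by_contra hcon
    have he := inter_eq_singleton hcon hd hD.hc
    obtain ⟨x, hx, hxu, hdx⟩ := exists_adj_of_two_le_deg u
      (h.tight.two_le_deg hG h.sub (by omega) hd)
    have hxD : x ∈ D := by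
      by_contra hxD
      exact hxu (hD.out d hD.hc hD.cp hD.cq x hxD hdx).2
    have : x ∈ C ∩ D := Finset.mem_inter.2 ⟨hx, hxD⟩
    rw [he, Finset.mem_singleton] at this
    exact adj_ne hG hdx this.symm
  refine ⟨?_, hI⟩
  by_contra hU
  have hvD : v ∈ D := by
    by_contra hvD
    rcases h.subset_or_subset hG hD.sub hD.tight hvD (by rwa [Finset.inter_comm]) with hs | hs
    · have h1 : D ⊂ C := hs.ssubset_of_ne fun e => hD.hv (e ▸ huC)
      have := Finset.card_lt_card h1
      have := hmin _ _ _ _ _ hD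
      omega
    · exact hD.hv (hs huC)
  obtain ⟨hIT, -, hcr⟩ := h.tight.inter_union hG h.sub hD.sub hD.tight hU hI
  have hc : c ∈ D := by
    by_contra hc
    exact Finset.eq_empty_iff_forall_notMem.1 hcr _ (mem_cross h.cv h.hc hc hvD h.hv)
  have hpq : ¬ (p ∈ D ∧ q ∈ D) := fun ⟨hp, hq⟩ => by
    have := h.free (C ∩ D) (Finset.inter_subset_left.ssubset_of_ne fun e =>
      hD.hv (Finset.inter_eq_left.1 e huC)) (by simp [hp, h.hp]) (by simp [hq, h.hq])
    have := hIT.2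
    omega
  have hrs : ¬ (r ∈ C ∧ s ∈ C) := fun ⟨hr, hs⟩ => by
    have := hD.free (C ∩ D) (Finset.inter_subset_right.ssubset_of_ne fun e =>
      h.hv (Finset.inter_eq_right.1 e hvD)) (by simp [hr, hD.hp]) (by simp [hs, hD.hq])
    have := hIT.2
    omega
  have hpq' : p ∈ D ∨ q ∈ D := by
    obtain ⟨b, hb, hbA, hbc, a, ha, hba⟩ := hD.tight.exists_adj hG hD.sub
      (A := D \ C) Finset.sdiff_subset ⟨v, by simp [hvD, h.hv]⟩
      (by rwa [sdiff_sdiff_right_self, Finset.inf_eq_inter, Finset.inter_comm]) c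
    rw [Finset.mem_sdiff] at hbA ha
    by_contra! hno
    refine hbc (h.out b (by tauto) ?_ ?_ a ha.2 hba).1
    · rintro rfl; exact hno.1 hb
    · rintro rfl; exact hno.2 hb
  have hrs' : r ∈ C ∨ s ∈ C := by
    obtain ⟨b, hb, hbA, hbd, a, ha, hba⟩ := h.tight.exists_adj hG h.sub
      (A := C \ D) Finset.sdiff_subset ⟨u, by simp [huC, hD.hv]⟩
      (by rwa [sdiff_sdiff_right_self, Finset.inf_eq_inter]) d
    rw [Finset.mem_sdiff] at hbA ha
    by_contra! hno
    refine hbd (hD.out b (by tauto) ?_ ?_ a ha.2 hba).1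
    · rintro rfl; exact hno.1 hb
    · rintro rfl; exact hno.2 hb
  have main : ∀ {p q r s}, Piece V E C p q c v → Piece V E D r s d u → p ∈ D → q ∉ D → s ∈ C →
      r ∉ C → False := fun h hD hp hq hs hr =>
    h.not_overlapping hG h3 hmin hD huC hvD hU hIT hc hd hp hq hs hr
  rcases hpq' with h1 | h1 <;> rcases hrs' with h2 | h2
  · exact main h hD.symm h1 (fun h => hpq ⟨h1, h⟩) h2 fun h => hrs ⟨h2, h⟩
  · exact main h hD h1 (fun h => hpq ⟨h1, h⟩) h2 fun h => hrs ⟨h, h2⟩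
  · exact main h.symm hD.symm h1 (fun h => hpq ⟨h, h1⟩) h2 fun h => hrs ⟨h2, h⟩
  · exact main h.symm hD h1 (fun h => hpq ⟨h, h1⟩) h2 fun h => hrs ⟨h, h2⟩

end Piece

/-- Every unblocked node of `(V, E)` is the outer vertex of a piece, so that no edge insertion
at a removed node leaves a 3-connected circuit. -/
def Stuck (V : Finset ℕ) (E : Finset (Sym2 ℕ)) : Prop :=
  ∀ u x y z, IsNode V E u x y z → ¬ Blocked V E u x y z → ∃ C p q, Piece V E C p q z u

/-- A piece contained in no larger piece and overlapping all pieces in two or more vertices. -/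
structure MaxPiece (V : Finset ℕ) (E : Finset (Sym2 ℕ)) (C : Finset ℕ) (p q c v : ℕ) : Prop
    extends Piece V E C p q c v where
  eq_of_subset : ∀ D r s d w, Piece V E D r s d w → C ⊆ D → D = C
  two_le_inter : ∀ D r s d w, Piece V E D r s d w → 2 ≤ (C ∩ D).card

theorem Stuck.exists_minimal_piece (hG : IsRigidityCircuit V E) (h3 : ThreeConnected V E)
    (hn : 5 ≤ V.card) (hst : Stuck V E) :
    ∃ C p q c v, Piece V E C p q c v ∧ ∀ D r s d w, Piece V E D r s d w → C.card ≤ D.card := by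
  obtain ⟨a, ha⟩ := Finset.card_pos.1 (show 0 < V.card by omega)
  obtain ⟨b, -, hab⟩ := exists_adj_of_deg_pos
    (show 0 < deg E a V by have := three_le_deg hG (by omega) ha; omega)
  obtain ⟨u, x, y, z, hN, hb, -⟩ := exists_unblocked hG h3 hn hab a
  obtain ⟨C₀, p₀, q₀, hC₀⟩ := hst u x y z hN hb
  obtain ⟨C, hC, hmin⟩ := Finset.exists_min_image
    (V.powerset.filter fun C => ∃ p q c v, Piece V E C p q c v) Finset.card
    ⟨C₀, Finset.mem_filter.2 ⟨Finset.mem_powerset.2 hC₀.sub, p₀, q₀, z, u, hC₀⟩⟩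
  obtain ⟨-, p, q, c, v, h⟩ := Finset.mem_filter.1 hC
  exact ⟨C, p, q, c, v, h, fun D r s d w hD => hmin D
    (Finset.mem_filter.2 ⟨Finset.mem_powerset.2 hD.sub, r, s, d, w, hD⟩)⟩

theorem Stuck.exists_maxPiece (hG : IsRigidityCircuit V E) (h3 : ThreeConnected V E)
    (hn : 5 ≤ V.card) (hst : Stuck V E) : ∃ C p q c v, MaxPiece V E C p q c v := by
  obtain ⟨C, p, q, c, v, h, hmin⟩ := hst.exists_minimal_piece hG h3 hn
  obtain ⟨u, x, y, z, huC, hup, huq, huc, hN, hb⟩ :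
      ∃ u x y z, u ∈ C ∧ u ≠ p ∧ u ≠ q ∧ u ≠ c ∧ IsNode V E u x y z ∧
        ¬ Blocked V E u x y z := by
    rcases (h.four_le_card hG).eq_or_lt with h4 | h5
    · exact h.exists_unblocked_of_card_eq_four hG h4.symm
    · exact h.exists_unblocked_of_five_le hG h3 (h.threeConnected hG h3 hmin) h5
  obtain ⟨D₀, r₀, s₀, hD₀⟩ := hst u x y z hN hb
  obtain ⟨hU₀, hI₀⟩ := h.union_eq hG h3 hmin hD₀ huC (h.mem_of_adj huC hup huq huc hN.adj_trd)
  obtain ⟨C', hC', hmax⟩ := Finset.exists_max_image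
    (V.powerset.filter fun D => (∃ r s d w, Piece V E D r s d w) ∧ C ∪ D = V ∧
      2 ≤ (C ∩ D).card) Finset.card
    ⟨D₀, Finset.mem_filter.2 ⟨Finset.mem_powerset.2 hD₀.sub, ⟨r₀, s₀, z, u, hD₀⟩, hU₀, hI₀⟩⟩
  obtain ⟨-, ⟨p', q', c', v', h'⟩, hU, hI⟩ := Finset.mem_filter.1 hC'
  refine ⟨C', p', q', c', v', h', fun D r s d w hD hs => ?_, fun D r s d w hD => ?_⟩
  · refine (Finset.eq_of_subset_of_card_le hs (hmax D (Finset.mem_filter.2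
      ⟨Finset.mem_powerset.2 hD.sub, ⟨r, s, d, w, hD⟩, ?_, ?_⟩))).symm
    · refine (Finset.union_subset h.sub hD.sub).antisymm ?_
      rw [← hU]
      exact Finset.union_subset_union le_rfl hs
    · exact hI.trans (Finset.card_le_card (Finset.inter_subset_inter le_rfl hs))
  · by_contra hcon
    have hout : ∀ t ∈ D, t ∉ C' → t ∈ C := fun t ht ht' => by
      have := hD.sub ht
      rw [← hU, Finset.mem_union] at this
      exact this.resolve_right ht'
    by_cases hs : C' ∩ D ⊆ C
    · have hsub : D ⊆ (C \ C') ∪ (C' ∩ D) := by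
        intro t ht
        have := hout t ht
        simp only [Finset.mem_union, Finset.mem_sdiff, Finset.mem_inter]
        tauto
      have h1 := (Finset.card_le_card hsub).trans (Finset.card_union_le _ _)
      have h2 := Finset.card_sdiff_add_card_inter C C'
      have := hmin _ _ _ _ _ hD
      omega
    · obtain ⟨t, ht, htC⟩ := Finset.not_subset.1 hs
      rw [Finset.mem_inter] at ht
      have he := inter_eq_singleton hcon ht.1 ht.2
      have hdeg := hD.tight.two_le_deg hG hD.sub
        (by have := hD.four_le_card hG; omega) ht.2
      have hcross : ∀ y ∈ D, s(t, y) ∈ E → s(y, t) ∈ cross E C C' := fun y hy hty => by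
        have hyC' : y ∉ C' := fun hyC' => by
          have : y ∈ C' ∩ D := Finset.mem_inter.2 ⟨hyC', hy⟩
          rw [he, Finset.mem_singleton] at this
          exact adj_ne hG hty this.symm
        exact mem_cross (Sym2.eq_swap ▸ hty) (hout y hy hyC') hyC' ht.1 htC
      obtain ⟨y₁, hy₁, -, h₁⟩ := exists_adj_of_two_le_deg t hdeg
      obtain ⟨y₂, hy₂, hne, h₂⟩ := exists_adj_of_two_le_deg y₁ hdeg
      have := Finset.card_le_one.1 (h.tight.ind_inter hG h.sub h'.tight hU hI).2 _
        (hcross y₁ hy₁ h₁) _ (hcross y₂ hy₂ h₂)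
      rw [Sym2.congr_left] at this
      exact hne this.symm

namespace MaxPiece

variable {p q c v w y z : ℕ}

theorem symm (h : MaxPiece V E C p q c v) : MaxPiece V E C q p c v :=
  ⟨h.toPiece.symm, h.eq_of_subset, h.two_le_inter⟩

theorem third (hG : IsRigidityCircuit V E) (h : MaxPiece V E C p q c v) {D : Finset ℕ}
    {r s d : ℕ} (hD : Piece V E D r s d w) (hw : w ∉ C) (hwv : w ≠ v) :
    (d = p ∨ d = q) ∧ ∀ x, x ∉ C → s(d, x) ∈ E → x = w := by
  have hDC : D ⊆ C := by
    rcases hD.subset_or_subset hG h.sub h.tight hw (h.two_le_inter _ _ _ _ _ hD) with hs | hs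
    · rw [h.eq_of_subset _ _ _ _ _ hD hs]
    · exact hs
  refine ⟨?_, fun x hx hdx => (hD.out d hD.hc hD.cp hD.cq x (fun h => hx (hDC h)) hdx).2⟩
  by_contra! hne
  exact hwv (h.out d (hDC hD.hc) hne.1 hne.2 w hw hD.cv).2

end MaxPiece

namespace Piece

variable {p q c v w : ℕ}

theorem exists_adj_of_adj_unique (hG : IsRigidityCircuit V E) (h : Piece V E C p q c v)
    (hp : ∀ x, x ∉ C → s(p, x) ∈ E → x = w) : ∃ x, x ∉ C ∧ x ≠ w ∧ s(q, x) ∈ E := by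
  have hqJ : q ∉ V \ C := by simp [h.hq]
  have hKV : insert q (V \ C) ⊆ V := Finset.insert_subset (h.sub h.hq) Finset.sdiff_subset
  have hU : C ∪ insert q (V \ C) = V := by
    refine (Finset.union_subset h.sub hKV).antisymm fun x hx => ?_
    simp only [Finset.mem_union, Finset.mem_insert, Finset.mem_sdiff]
    tauto
  have hI : C ∩ insert q (V \ C) = {q} := by
    ext x
    simp only [Finset.mem_inter, Finset.mem_insert, Finset.mem_sdiff, Finset.mem_singleton]
    constructor
    · tauto
    · rintro rfl
      exact ⟨h.hq, Or.inl rfl⟩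
  have key : ∀ x ∈ C, x ≠ q → ∀ y, y ∉ C → s(x, y) ∈ E →
      s(x, y) = s(p, w) ∨ s(x, y) = s(c, v) := by
    intro x hx hxq y hy hxy
    by_cases hxp : x = p
    · subst hxp
      rw [hp y hy hxy]
      exact Or.inl rfl
    · obtain ⟨rfl, rfl⟩ := h.out x hx hxp hxq y hy hxy
      exact Or.inr rfl
  have hcr : cross E C (insert q (V \ C)) ⊆ {s(p, w), s(c, v)} := by
    intro e
    induction e with
    | _ x y =>
      intro hxy
      simp only [cross, hU, Finset.mem_sdiff, Finset.mem_union, mem_spans, Finset.mem_insert,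
        not_or] at hxy
      rw [Finset.mem_insert, Finset.mem_singleton]
      obtain ⟨⟨he, hx, hy⟩, h1, h2⟩ := hxy
      by_cases hxC : x ∈ C
      · have hyC : y ∉ C := fun hyC => h1 ⟨he, hxC, hyC⟩
        refine key x hxC (fun e => h2 ⟨he, Or.inl e, Or.inr ⟨hy, hyC⟩⟩) y hyC he
      · by_cases hyC : y ∈ C
        · rw [Sym2.eq_swap]
          exact key y hyC (fun e => h2 ⟨he, Or.inr ⟨hx, hxC⟩, Or.inl e⟩) x hxC
            (Sym2.eq_swap ▸ he)
        · exact absurd ⟨he, Or.inr ⟨hx, hxC⟩, Or.inr ⟨hy, hyC⟩⟩ h2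
  have h4 := h.four_le_card hG
  have hV := Finset.card_le_card h.sub
  have h1 := ind_add_ind (E := E) (X := C) (Y := insert q (V \ C))
  rw [hU, hI, ind_singleton (loopless hG)] at h1
  have h2 := ind_self hG (by omega)
  have h5 := (Finset.card_le_card hcr).trans Finset.card_le_two
  have h6 := Finset.card_insert_of_notMem hqJ
  have h7 := Finset.card_sdiff_add_card_eq_card h.sub
  have h8 := h.tight.2
  have h9 := h.two
  have h10 := ind_le hG (hKV.ssubset_of_ne fun e => by
    rw [e] at h6
    omega) (by omega)
  have hT : Tight E (insert q (V \ C)) := ⟨by omega, by omega⟩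
  obtain ⟨x, hx, hxw, hqx⟩ := exists_adj_of_two_le_deg w
    (hT.two_le_deg hG hKV (by omega) (Finset.mem_insert_self _ _))
  refine ⟨x, ?_, hxw, hqx⟩
  rw [Finset.mem_insert] at hx
  exact (Finset.mem_sdiff.1 (hx.resolve_left (adj_ne hG hqx).symm)).2

theorem subset_of_adj_unique (hG : IsRigidityCircuit V E) (h : Piece V E C p q c v)
    (hw : w ∈ V) (hwC : w ∉ C) (hp : ∀ x, x ∉ C → s(p, x) ∈ E → x = w) (hX : X ⊆ V)
    (hT : Tight E X) (hwX : w ∉ X) (hpX : p ∈ X) {j : ℕ} (hj : j ∈ X) (hjC : j ∉ C) : C ⊆ X := by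
  by_cases h2 : 2 ≤ (X ∩ C).card
  · have hqX : q ∈ X := by
      obtain ⟨b, hb, hbA, hbc, a, ha, hba⟩ := hT.exists_adj hG hX
        (A := X \ C) Finset.sdiff_subset ⟨j, by simp [hj, hjC]⟩
        (by rwa [sdiff_sdiff_right_self, Finset.inf_eq_inter]) c
      rw [Finset.mem_sdiff] at hbA ha
      by_contra hq
      refine hbc (h.out b (by tauto) ?_ ?_ a ha.2 hba).1
      · rintro rfl
        exact hwX (hp a ha.2 hba ▸ ha.1)
      · rintro rfl
        exact hq hb
    have hU : X ∪ C ≠ V := fun e => by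
      rw [← e, Finset.mem_union] at hw
      tauto
    have hI := (hT.inter_union hG hX h.sub h.tight hU h2).1.2
    by_contra hCX
    have := h.free (X ∩ C) (Finset.inter_subset_right.ssubset_of_ne fun e =>
      hCX (Finset.inter_eq_right.1 e)) (by simp [hpX, h.hp]) (by simp [hqX, h.hq])
    omega
  · obtain ⟨x, hx, hpx⟩ := hT.exists_edge hG hX hpX
    have hxC : x ∉ C := fun hxC => by
      have : x ∈ X ∩ C := Finset.mem_inter.2 ⟨hx, hxC⟩
      rw [inter_eq_singleton h2 hpX h.hp, Finset.mem_singleton] at this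
      exact adj_ne hG hpx this.symm
    exact absurd (hp x hxC hpx ▸ hx) hwX

end Piece

namespace MaxPiece

variable {p q c v w x y z : ℕ}

theorem blocked (hG : IsRigidityCircuit V E) (hst : Stuck V E) (h : MaxPiece V E C p q c v)
    (hN : IsNode V E w p y z) (hw : w ∉ C) (hwv : w ≠ v)
    (hp : ∀ x, x ∉ C → s(p, x) ∈ E → x = w) : Blocked V E w p y z := by
  by_contra hb
  obtain ⟨D, r, s, hD⟩ := hst w p y z hN hb
  obtain ⟨hz, hz'⟩ := h.third hG hD hw hwv
  obtain rfl := hz.resolve_left hN.xz.symm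
  obtain ⟨x, hxC, hxw, hzx⟩ := h.exists_adj_of_adj_unique hG hp
  exact hxw (hz' x hxC hzx)

theorem exists_tight_of_adj_unique (hG : IsRigidityCircuit V E) (hst : Stuck V E)
    (h : MaxPiece V E C p q c v) (hN : IsNode V E w p y z) (hw : w ∉ C) (hwv : w ≠ v)
    (hp : ∀ x, x ∉ C → s(p, x) ∈ E → x = w) :
    y ∉ C ∧ ∃ X ⊆ V, Tight E X ∧ C ⊆ X ∧ y ∈ X ∧ z ∉ X ∧ w ∉ X := by
  have hadj : ∀ {y z}, IsNode V E w p y z → y ∈ C → y = q := fun {y z} hN hy => by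
    by_contra hyq
    exact hwv (h.out y hy hN.xy.symm hyq w hw (Sym2.eq_swap ▸ hN.adj_snd)).2
  have hN' := hN.swap.rotate
  have hyC : y ∉ C := fun hy => by
    obtain rfl := hadj hN hy
    obtain ⟨X, hX, hT, hpX, hzX, hyX, hwX⟩ := h.blocked hG hst hN' hw hwv hp
    have hzC : z ∉ C := fun hz => hN.yz (hadj hN' hz).symm
    exact hyX (h.subset_of_adj_unique hG hN.mem hw hp hX hT hwX hpX hzX hzC hy)
  obtain ⟨X, hX, hT, hpX, hyX, hzX, hwX⟩ := h.blocked hG hst hN hw hwv hp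
  exact ⟨hyC, X, hX, hT, h.subset_of_adj_unique hG hN.mem hw hp hX hT hwX hpX hyX hyC, hyX, hzX,
    hwX⟩

theorem deg_eq_three (hG : IsRigidityCircuit V E) (h3 : ThreeConnected V E) (hn : 5 ≤ V.card)
    (hst : Stuck V E) (h : MaxPiece V E C p q c v) : ∀ t ∈ V, t ∉ C → deg E t V = 3 := by
  by_contra! hcon
  obtain ⟨W, w, x, y, z, hCW, hWV, hTW, hmax, hwW, hwv, hN, hb, hdW, hlast⟩ :=
    exists_unblocked_outside hG h3 hn h.sub h.tight hcon v
  have hwC : w ∉ C := fun hw => hwW (hCW hw)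
  obtain ⟨D, r, s, hD⟩ := hst w x y z hN hb
  obtain ⟨hz, hz'⟩ := h.third hG hD hwC hwv
  have main : ∀ {q}, MaxPiece V E C z q c v → False := by
    intro q h
    have hzW := hCW h.hp
    have hxW := notMem_of_deg_le_one hdW hN.xz.symm hN.adj_trd hN.adj_fst hzW
    have hyW := notMem_of_deg_le_one hdW hN.yz.symm hN.adj_trd hN.adj_snd hzW
    have hdeg : ∀ {x y}, IsNode V E w z x y → x ∉ W → y ∉ W → deg E y V = 3 := by
      intro x y hN hxW hyW
      obtain ⟨-, X, hX, hTX, hCX, hxX, hyX, hwX⟩ :=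
        h.exists_tight_of_adj_unique hG hst hN hwC hwv hz'
      have hU : W ∪ X ≠ V := fun e => by
        have := hN.mem
        rw [← e, Finset.mem_union] at this
        tauto
      have h2 : 2 ≤ (W ∩ X).card := h.tight.1.trans
        (Finset.card_le_card (Finset.subset_inter hCW hCX))
      have hT := (hTW.inter_union hG hWV hX hTX hU h2).2.1
      by_contra hy
      have := hmax (W ∪ X) (Finset.union_subset hWV hX) Finset.subset_union_left hT
        ⟨y, mem_right hG hN.adj_trd, by simp [hyW, hyX], hy⟩
      exact hxW (this ▸ Finset.mem_union_right W hxX)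
    have hN' := hN.rotate.rotate
    exact hlast x y hN.xy hN.adj_fst hN.adj_snd hxW hyW (hdeg hN'.swap.rotate hyW hxW)
      (hdeg hN' hxW hyW)
  rcases hz with rfl | rfl
  · exact main h
  · exact main h.symm

end MaxPiece

theorem IsNode.adj_unique_of_tight (hG : IsRigidityCircuit V E) {w x p q : ℕ}
    (hN : IsNode V E w x p q) (hC : C ⊆ V) (hTC : Tight E C) (hp : p ∈ C) (hq : q ∈ C)
    (hw : w ∉ C) (hX : X ⊆ V) (hT : Tight E X) (hx : x ∈ X) (hqX : q ∉ X) (hwX : w ∉ X)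
    (h2 : 2 ≤ (X ∩ C).card) : ∀ t, t ∉ C → s(q, t) ∈ E → t = w := by
  intro t ht hqt
  have hU : X ∪ C ≠ V := fun e => by
    have := hN.mem
    rw [← e, Finset.mem_union] at this
    tauto
  obtain ⟨-, hTU, hcr⟩ := hT.inter_union hG hX hC hTC hU h2
  have he := hN.eq_erase hG (Finset.union_subset hX hC) hTU (by simp [hw, hwX]) (by simp [hx])
    (by simp [hp]) (by simp [hq])
  by_contra htw
  have htU : t ∈ X ∪ C := by
    rw [he]
    exact Finset.mem_erase.2 ⟨htw, mem_right hG hqt⟩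
  rw [Finset.mem_union] at htU
  exact Finset.eq_empty_iff_forall_notMem.1 hcr _
    (mem_cross (Sym2.eq_swap ▸ hqt) (htU.resolve_right ht) ht hq hqX)

theorem Piece.exists_adj_of_tight (hG : IsRigidityCircuit V E) {p w : ℕ} (hX : X ⊆ V)
    (hT : Tight E X) (hpX : p ∈ X) (hp : p ∈ C) (hwX : w ∉ X) (h2 : ¬ 2 ≤ (X ∩ C).card) :
    ∃ t, t ∉ C ∧ t ≠ w ∧ s(p, t) ∈ E := by
  obtain ⟨t, ht, hpt⟩ := hT.exists_edge hG hX hpX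
  refine ⟨t, fun htC => ?_, fun e => hwX (e ▸ ht), hpt⟩
  have : t ∈ X ∩ C := Finset.mem_inter.2 ⟨ht, htC⟩
  rw [inter_eq_singleton h2 hpX hp, Finset.mem_singleton] at this
  exact adj_ne hG hpt this.symm

theorem Piece.not_both_blocked (hG : IsRigidityCircuit V E) (h3 : ThreeConnected V E)
    (hn : 5 ≤ V.card) {p q c v w x : ℕ} (h : Piece V E C p q c v) (hN : IsNode V E w x p q)
    (hw : w ∉ C) (hxC : x ∉ C) (hx : deg E x V = 3) (h₁ : Blocked V E w x p q)
    (h₂ : Blocked V E w x q p) : False := by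
  obtain ⟨X, hX, hTX, hxX, hpX, hqX, hwX⟩ := h₁
  obtain ⟨Y, hY, hTY, hxY, hqY, hpY, hwY⟩ := h₂
  have hI := hN.two_le_card_inter hG h3 hn hx hX hTX hwX hY hTY hwY hxX hpX hxY hqY
  have hU := (hN.edges_of_two hG hX hTX hwX hY hTY hwY (by simp [hxX]) (by simp [hpX])
    (by simp [hqY]) hI).1
  have bigX := hN.adj_unique_of_tight hG h.sub h.tight h.hp h.hq hw hX hTX hxX hqX hwX
  have bigY := hN.rotate.swap.rotate.rotate.adj_unique_of_tight hG h.sub h.tight h.hq h.hp hw hY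
    hTY hxY hpY hwY
  have smallX := Piece.exists_adj_of_tight hG hX hTX hpX h.hp hwX
  have smallY := Piece.exists_adj_of_tight hG hY hTY hqY h.hq hwY
  have hcw : c ≠ w := fun e => hw (e ▸ h.hc)
  by_cases hX2 : 2 ≤ (X ∩ C).card <;> by_cases hY2 : 2 ≤ (Y ∩ C).card
  · have hpw : p ≠ w := fun e => hw (e ▸ h.hp)
    have hxc : x ≠ c := fun e => hxC (e ▸ h.hc)
    have := mem_of_closed h3 (S := {c, w}) (P := V \ C)
      (Finset.insert_subset (h.sub h.hc) (by simpa using hN.mem)) Finset.card_le_two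
      ⟨x, by simp [hX hxX, hxC], hX hxX, by simp [hxc, (adj_ne hG hN.adj_fst).symm]⟩ (by
        intro a ha _ haS b hb hbS hab
        simp only [Finset.mem_insert, Finset.mem_singleton, not_or] at haS hbS
        rw [Finset.mem_sdiff] at ha ⊢
        refine ⟨hb, fun hbC => ?_⟩
        have hba : s(b, a) ∈ E := Sym2.eq_swap ▸ hab
        refine hbS.1 (h.out b hbC ?_ ?_ a ha.2 hba).1
        · rintro rfl
          exact haS.2 (bigY hY2 a ha.2 hba)
        · rintro rfl
          exact haS.2 (bigX hX2 a ha.2 hba))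
      (h.sub h.hp) (by simp [h.cp.symm, hpw])
    exact (Finset.mem_sdiff.1 this).2 h.hp
  · obtain ⟨t, htC, htw, hqt⟩ := smallY hY2
    exact htw (bigX hX2 t htC hqt)
  · obtain ⟨t, htC, htw, hpt⟩ := smallX hX2
    exact htw (bigY hY2 t htC hpt)
  · have hc : c ∈ X ∪ Y := by
      rw [hU]
      exact Finset.mem_erase.2 ⟨hcw, h.sub h.hc⟩
    rcases Finset.mem_union.1 hc with hc | hc
    · have : c ∈ X ∩ C := Finset.mem_inter.2 ⟨hc, h.hc⟩
      rw [inter_eq_singleton hX2 hpX h.hp, Finset.mem_singleton] at this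
      exact h.cp this
    · have : c ∈ Y ∩ C := Finset.mem_inter.2 ⟨hc, h.hc⟩
      rw [inter_eq_singleton hY2 hqY h.hq, Finset.mem_singleton] at this
      exact h.cq this

theorem not_stuck (hG : IsRigidityCircuit V E) (h3 : ThreeConnected V E) (hn : 5 ≤ V.card) :
    ¬ Stuck V E := by
  intro hst
  obtain ⟨C, p, q, c, v, h⟩ := hst.exists_maxPiece hG h3 hn
  have hdeg := h.deg_eq_three hG h3 hn hst
  have h4 := h.four_le_card hG
  obtain ⟨w, hwJ, hwv, hdJ⟩ := exists_leaf hG (N := V \ C) Finset.sdiff_subset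
    (fun u hu => hdeg u (Finset.mem_sdiff.1 hu).1 (Finset.mem_sdiff.1 hu).2)
    (by
      rw [sdiff_sdiff_right_self, Finset.inf_eq_inter, Finset.inter_eq_right.2 h.sub]
      omega) h.two v
  obtain ⟨hw, hwC⟩ := Finset.mem_sdiff.1 hwJ
  have hd := hdeg w hw hwC
  have hsum := deg_union_add_deg_inter (E := E) (X := C) (Y := V \ C) w
  rw [Finset.union_sdiff_of_subset h.sub, Finset.inter_sdiff_self, hd,
    show deg E w ∅ = 0 from rfl] at hsum
  have hCpq : ∀ t ∈ C, s(w, t) ∈ E → t = p ∨ t = q := fun t ht hwt => by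
    by_contra! hne
    exact hwv (h.out t ht hne.1 hne.2 w hwC (Sym2.eq_swap ▸ hwt)).2
  have hle : deg E w C ≤ 2 := by
    refine (Finset.card_le_card (t := {p, q}) fun t ht => ?_).trans Finset.card_le_two
    rw [Finset.mem_filter] at ht
    simpa using hCpq t ht.1 ht.2
  obtain ⟨x, hxJ, hwx⟩ := exists_adj_of_deg_pos (show 0 < deg E w (V \ C) by omega)
  obtain ⟨hx, hxC⟩ := Finset.mem_sdiff.1 hxJ
  obtain ⟨t₁, ht₁, hne₁, hwt₁⟩ := exists_adj_of_two_le_deg q (show 2 ≤ deg E w C by omega)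
  obtain ⟨t₂, ht₂, hne₂, hwt₂⟩ := exists_adj_of_two_le_deg p (show 2 ≤ deg E w C by omega)
  obtain rfl := (hCpq t₁ ht₁ hwt₁).resolve_right hne₁
  obtain rfl := (hCpq t₂ ht₂ hwt₂).resolve_left hne₂
  have hN := IsNode.of_adj hG hd hwx hwt₁ hwt₂ (fun e => hxC (e ▸ ht₁)) (fun e => hxC (e ▸ ht₂))
    h.pq
  have main : ∀ {p q}, MaxPiece V E C p q c v → IsNode V E w x q p → Blocked V E w x q p := by
    intro p q h hN
    by_contra hb
    obtain ⟨D, r, s, hD⟩ := hst w x q p hN hb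
    exact (h.exists_tight_of_adj_unique hG hst hN.rotate.swap hwC hwv
      (h.third hG hD hwC hwv).2).1 h.hq
  exact h.not_both_blocked hG h3 hn hN hwC hxC (hdeg x hx hxC) (main h.symm hN)
    (main h hN.rotate.swap.rotate.rotate)

theorem exists_feasible (hG : IsRigidityCircuit V E) (h3 : ThreeConnected V E)
    (hn : 5 ≤ V.card) : ∃ v a b c, IsNode V E v a b c ∧ ¬ Blocked V E v a b c ∧
      ThreeConnected (V.erase v) (withE E (V.erase v) a b) := by
  by_contra! hcon
  exact not_stuck hG h3 hn fun u x y z hN hb => hN.exists_piece hG h3 hn hb (hcon u x y z hN hb)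

/-- Some proper tight set contains an unblocked node and its neighbours, and stays independent
until the edge between the first two of them is added. -/
theorem IsNode.exists_tight_free (hG : IsRigidityCircuit V E) (hn : 5 ≤ V.card) {v a b c : ℕ}
    (h : IsNode V E v a b c) (hb : ¬ Blocked V E v a b c) :
    ∃ Y ⊂ V, Tight E Y ∧ 3 ≤ Y.card ∧ a ∈ Y ∧ b ∈ Y ∧ c ∈ Y ∧ v ∈ Y ∧ Free E Y a b := by
  have ha := mem_right hG h.adj_fst
  have hb' := mem_right hG h.adj_snd
  have hc := mem_right hG h.adj_trd
  have hva := adj_ne hG h.adj_fst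
  have hvb := adj_ne hG h.adj_snd
  have hvc := adj_ne hG h.adj_trd
  have hTv := tight_erase hG (by omega) h.mem (h.deg_eq_three hG)
  obtain ⟨w, hw, hw'⟩ : ∃ w ∈ V.filter (fun u => deg E u V = 3), w ∉ ({v, a, b} : Finset ℕ) := by
    by_contra! hcon
    have h1 := Finset.card_le_card hcon
    have h2 := four_le_card_nodes hG (by omega)
    have h5 := Finset.card_le_three (a := v) (b := a) (c := b)
    omega
  rw [Finset.mem_filter] at hw
  simp only [Finset.mem_insert, Finset.mem_singleton, not_or] at hw'
  have hTw := tight_erase hG (by omega) hw.1 hw.2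
  obtain ⟨Y, hY, hmin⟩ := Finset.exists_min_image
    ((V.erase w).powerset.filter fun Y => Tight E Y ∧ a ∈ Y ∧ b ∈ Y) Finset.card
    ⟨V.erase w, Finset.mem_filter.2 ⟨Finset.mem_powerset_self _, hTw,
      Finset.mem_erase.2 ⟨Ne.symm hw'.2.1, ha⟩, Finset.mem_erase.2 ⟨Ne.symm hw'.2.2, hb'⟩⟩⟩
  rw [Finset.mem_filter, Finset.mem_powerset] at hY
  obtain ⟨hYw, hTY, haY, hbY⟩ := hY
  have hYV : Y ⊆ V := hYw.trans (Finset.erase_subset _ _)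
  have hmin' : ∀ X ⊂ Y, a ∈ X → b ∈ X → ¬ Tight E X := fun X hX haX hbX hT => by
    have h1 := hmin X (Finset.mem_filter.2
      ⟨Finset.mem_powerset.2 (hX.subset.trans hYw), hT, haX, hbX⟩)
    have h2 := Finset.card_lt_card hX
    omega
  have hvY : v ∈ Y := by
    by_contra hvY
    have hcY : c ∈ Y := by
      by_contra hcY
      exact hb ⟨Y, hYV, hTY, haY, hbY, hcY, hvY⟩
    have he := h.eq_erase hG hYV hTY hvY haY hbY hcY
    have : w ∈ V.erase v := Finset.mem_erase.2 ⟨hw'.1, hw.1⟩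
    rw [← he] at this
    exact absurd (hYw this) (by simp)
  have h3 : 3 ≤ Y.card := by
    rw [← Finset.card_eq_three.2 ⟨v, a, b, hva, hvb, h.xy, rfl⟩]
    exact Finset.card_le_card
      (Finset.insert_subset hvY (Finset.insert_subset haY (by simpa using hbY)))
  refine ⟨Y, hTY.ssubset hG hYV, hTY, h3, haY, hbY, ?_, hvY, fun X hX haX hbX => ?_⟩
  · by_contra hcY
    refine hmin' (Y.erase v) (Finset.erase_ssubset hvY) (by simp [hva.symm, haY])
      (by simp [hvb.symm, hbY]) ?_
    have h1 := ind_erase (E := E) (loopless hG) hvY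
    rw [h.deg_eq_two haY hbY hcY] at h1
    have h2 := Finset.card_erase_of_mem hvY
    have := hTY.2
    exact ⟨by omega, by omega⟩
  · have h2 : 2 ≤ X.card := by
      rw [← Finset.card_pair h.xy]
      exact Finset.card_le_card (Finset.insert_subset haX (by simpa using hbX))
    have h1 := ind_le hG (hX.trans_subset hYV) h2
    have h4 := hmin' X hX haX hbX
    by_contra hcon
    exact h4 ⟨h2, by omega⟩

theorem IsNode.eq_union_sdiff (hG : IsRigidityCircuit V E) {v a b c : ℕ}
    (h : IsNode V E v a b c) (hab : s(a, b) ∉ E) (ha : a ∈ Y) (hb : b ∈ Y) (hc : c ∈ Y)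
    (hv : v ∈ Y) : E = (withE E (V.erase v) a b ∪ withE E Y a b) \ {s(a, b)} := by
  have hY : ∀ t, s(v, t) ∈ E → t ∈ Y := fun t ht => by
    rcases (h.adj t).1 ht with rfl | rfl | rfl
    · exact ha
    · exact hb
    · exact hc
  ext e
  induction e with
  | _ x y =>
    simp only [Finset.mem_sdiff, Finset.mem_union, mem_withE, Finset.mem_singleton, Sym2.eq_iff,
      Finset.mem_erase]
    constructor
    · intro he
      refine ⟨?_, ?_⟩
      · by_cases hx : x = v
        · subst hx
          exact Or.inr (Or.inr ⟨he, hv, hY y he⟩)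
        · by_cases hy : y = v
          · subst hy
            exact Or.inr (Or.inr ⟨he, hY x (Sym2.eq_swap ▸ he), hv⟩)
          · exact Or.inl (Or.inr ⟨he, ⟨hx, mem_left hG he⟩, hy, mem_right hG he⟩)
      · rintro (⟨rfl, rfl⟩ | ⟨rfl, rfl⟩)
        · exact hab he
        · exact hab (Sym2.eq_swap ▸ he)
    · tauto

end CircuitCRD

/-- Every 3-connected rigidity circuit with at least 5 vertices is the combinatorial
resultant of a 3-connected rigidity circuit on `n - 1` vertices and a rigidity
circuit on at most `n - 1` vertices. -/
theorem threeConnected_circuit_has_CRD (V : Finset ℕ) (E : Finset (Sym2 ℕ))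
    (hG : IsRigidityCircuit V E) (h3 : ThreeConnected V E) (hn : 5 ≤ V.card) :
    ∃ (V1 V2 : Finset ℕ) (E1 E2 : Finset (Sym2 ℕ)) (e : Sym2 ℕ),
      IsRigidityCircuit V1 E1 ∧ IsRigidityCircuit V2 E2 ∧
      e ∈ E1 ∩ E2 ∧ V = V1 ∪ V2 ∧ E = (E1 ∪ E2) \ {e} ∧
      ThreeConnected V1 E1 ∧ V1.card = V.card - 1 ∧ V2.card ≤ V.card - 1 := by
  obtain ⟨v, a, b, c, hN, hb, hH⟩ := CircuitCRD.exists_feasible hG h3 hn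
  obtain ⟨Y, hYV, hTY, hY3, haY, hbY, hcY, hvY, hf⟩ := hN.exists_tight_free hG hn hb
  have ha' := (CircuitCRD.adj_ne hG hN.adj_fst).symm
  have hb' := (CircuitCRD.adj_ne hG hN.adj_snd).symm
  have hcard := Finset.card_erase_of_mem hN.mem
  have he : s(a, b) ∉ E := hf.notMem haY hbY hN.xy hY3
  refine ⟨V.erase v, Y, CircuitCRD.withE E (V.erase v) a b, CircuitCRD.withE E Y a b, s(a, b),
    (CircuitCRD.tight_erase hG (by omega) hN.mem (hN.deg_eq_three hG)).withE_circuit hG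
      (Finset.erase_subset _ _) (Finset.mem_erase.2 ⟨ha', CircuitCRD.mem_right hG hN.adj_fst⟩)
      (Finset.mem_erase.2 ⟨hb', CircuitCRD.mem_right hG hN.adj_snd⟩) hN.xy (hN.free hG hb)
      (by omega),
    hTY.withE_circuit hG hYV.subset haY hbY hN.xy hf hY3,
    Finset.mem_inter.2 ⟨CircuitCRD.mem_withE.2 (by tauto), CircuitCRD.mem_withE.2 (by tauto)⟩,
    ?_, hN.eq_union_sdiff hG he haY hbY hcY hvY, hH, hcard, ?_⟩
  · refine (Finset.union_subset (Finset.erase_subset _ _) hYV.subset).antisymm' fun x hx => ?_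
    by_cases hxv : x = v
    · exact Finset.mem_union_right _ (hxv ▸ hvY)
    · exact Finset.mem_union_left _ (Finset.mem_erase.2 ⟨hxv, hx⟩)
  · have := Finset.card_lt_card hYV
    omega

end
end

section
/- Let G = (V, E) be a rigidity circuit with n = |V| ≥ 5 vertices that is not 3-connected. Then there exist rigidity circuits G1 = (V1, E1) and G2 = (V2, E2) and an edge e ∈ E1 ∩ E2 such that G = CRes(G1, G2, e) and both G1 and G2 have at most n − 1 vertices. -/
open scoped Classical

noncomputable section

theorem mem_spans_s4 {E : Finset (Sym2 ℕ)} {V' : Finset ℕ} {e : Sym2 ℕ} :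
    e ∈ spans E V' ↔ e ∈ E ∧ ∀ v ∈ e, v ∈ V' := by
  simp [spans]

theorem spans_inter (E : Finset (Sym2 ℕ)) (A B : Finset ℕ) :
    spans E A ∩ spans E B = spans E (A ∩ B) := by
  ext e
  simp only [Finset.mem_inter, mem_spans_s4]
  grind

theorem card_spans_add_card_spans_le (E : Finset (Sym2 ℕ)) (A B : Finset ℕ) :
    (spans E A).card + (spans E B).card ≤
      (spans E (A ∪ B)).card + (spans E (A ∩ B)).card := by
  rw [← Finset.card_union_add_card_inter, spans_inter]
  gcongr
  intro e
  simp only [Finset.mem_union, mem_spans_s4]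
  grind

/-- A graph on at least four vertices that is not 3-connected is covered by two proper
induced subgraphs sharing at most two vertices. -/
theorem exists_separation {V : Finset ℕ} {E : Finset (Sym2 ℕ)} (hE : IsGraph V E)
    (hnot3 : ¬ ThreeConnected V E) (hn : 4 ≤ V.card) :
    ∃ V1 V2 : Finset ℕ, V1 ∪ V2 = V ∧ V1 ⊂ V ∧ V2 ⊂ V ∧ (V1 ∩ V2).card ≤ 2 ∧
      spans E V1 ∪ spans E V2 = E := by
  simp only [ThreeConnected, hn, true_and, not_forall] at hnot3
  obtain ⟨S, hSV, hS, hconn⟩ := hnot3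
  have hne : (V \ S).Nonempty := by
    rw [← Finset.card_pos]
    have := Finset.le_card_sdiff S V
    omega
  simp only [ConnectedGraph, hne, true_and, not_forall] at hconn
  obtain ⟨a, ha, b, hb, hab⟩ := hconn
  set A := (V \ S).filter
    (Relation.ReflTransGen (fun x y => s(x, y) ∈ spans E (V \ S)) a) with hA
  have haA : a ∈ A := by simp only [hA, Finset.mem_filter]; exact ⟨ha, .refl⟩
  have hbA : b ∉ A := by simp [hA, hab]
  have hAV : A ⊆ V \ S := Finset.filter_subset _ _
  have hclosed : ∀ x ∈ A, ∀ y, s(x, y) ∈ E → y ∉ S → y ∈ A := by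
    intro x hx y hxy hy
    have hxVS := hAV hx
    simp only [hA, Finset.mem_filter] at hx ⊢
    have hyVS : y ∈ V \ S := Finset.mem_sdiff.2 ⟨(hE _ hxy).2 y (by simp), hy⟩
    refine ⟨hyVS, hx.2.tail (mem_spans_s4.2 ⟨hxy, ?_⟩)⟩
    simp only [Sym2.mem_iff]
    rintro v (rfl | rfl) <;> assumption
  clear_value A
  refine ⟨A ∪ S, V \ A, ?_, ?_, ?_, ?_, ?_⟩
  · grind
  · rw [Finset.ssubset_iff_of_subset (by grind)]
    exact ⟨b, by grind, by grind⟩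
  · rw [Finset.ssubset_iff_of_subset (by grind)]
    exact ⟨a, by grind, by grind⟩
  · exact (Finset.card_le_card (by grind)).trans hS
  · ext e
    induction e with | _ x y
    simp only [Finset.mem_union, mem_spans_s4, Sym2.mem_iff]
    constructor
    · rintro (h | h) <;> exact h.1
    · intro h
      have h' : s(y, x) ∈ E := Sym2.eq_swap ▸ h
      have hx := (hE _ h).2 x (by simp)
      have hy := (hE _ h).2 y (by simp)
      have := hclosed x
      have := hclosed y
      grind

namespace IsRigidityCircuit

variable {V : Finset ℕ} {E : Finset (Sym2 ℕ)}

theorem card_spans_add_three_le (hG : IsRigidityCircuit V E) {U : Finset ℕ} (hU : U ⊂ V)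
    (h2 : 2 ≤ U.card) : (spans E U).card + 3 ≤ 2 * U.card := by
  have := hG.2.2 U hU h2
  omega

theorem card_spans_add_two_le (hG : IsRigidityCircuit V E) {U : Finset ℕ} (hU : U ⊂ V)
    (h1 : 1 ≤ U.card) : (spans E U).card + 2 ≤ 2 * U.card := by
  rcases h1.eq_or_lt with h | h
  · obtain ⟨x, rfl⟩ := Finset.card_eq_one.1 h.symm
    have : spans E {x} = ∅ := by
      refine Finset.eq_empty_of_forall_notMem fun e he => ?_
      rw [mem_spans_s4] at he
      refine (hG.1 e he.1).1 ?_
      induction e with | _ y z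
      have hy := he.2 y (by simp)
      have hz := he.2 z (by simp)
      rw [Finset.mem_singleton] at hy hz
      rw [Sym2.mk_isDiag_iff, hy, hz]
    simp [this]
  · have := hG.card_spans_add_three_le hU h
    omega

/-- In a separation of a rigidity circuit the two sides meet in exactly two vertices, which
are not adjacent, and both sides are tight. -/
theorem tight_of_separation (hG : IsRigidityCircuit V E) {V1 V2 : Finset ℕ}
    (hV : V1 ∪ V2 = V) (h1 : V1 ⊂ V) (h2 : V2 ⊂ V) (hS : (V1 ∩ V2).card ≤ 2)
    (hE : spans E V1 ∪ spans E V2 = E) :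
    (V1 ∩ V2).card = 2 ∧ spans E (V1 ∩ V2) = ∅ ∧
      (spans E V1).card + 3 = 2 * V1.card ∧ (spans E V2).card + 3 = 2 * V2.card := by
  have hc := Finset.card_union_add_card_inter V1 V2
  have he := Finset.card_union_add_card_inter (spans E V1) (spans E V2)
  rw [hE, spans_inter, hG.2.1] at he
  rw [hV] at hc
  have hc1 := Finset.card_lt_card h1
  have hc2 := Finset.card_lt_card h2
  have a1 := hG.card_spans_add_two_le h1 (by omega)
  have a2 := hG.card_spans_add_two_le h2 (by omega)
  have b1 := hG.card_spans_add_three_le h1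
  have b2 := hG.card_spans_add_three_le h2
  rw [← Finset.card_eq_zero]
  by_cases k1 : 2 ≤ V1.card <;> by_cases k2 : 2 ≤ V2.card <;>
    simp only [k1, k2, forall_const] at b1 b2 <;> omega

/-- Adding the missing edge between the two vertices of a 2-separation to one tight side
gives a rigidity circuit. -/
theorem insert_spans (hG : IsRigidityCircuit V E) {V1 V2 : Finset ℕ} {u v : ℕ} (huv : u ≠ v)
    (hV : V1 ∪ V2 = V) (h1 : V1 ⊂ V) (hS : V1 ∩ V2 = {u, v}) (he : spans E {u, v} = ∅)
    (t1 : (spans E V1).card + 3 = 2 * V1.card) (t2 : (spans E V2).card + 3 = 2 * V2.card) :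
    IsRigidityCircuit V1 (insert s(u, v) (spans E V1)) := by
  have hu : u ∈ V1 ∩ V2 := by simp [hS]
  have hv : v ∈ V1 ∩ V2 := by simp [hS]
  rw [Finset.mem_inter] at hu hv
  have huvE : s(u, v) ∉ E := fun h => by
    have : s(u, v) ∈ spans E {u, v} := mem_spans_s4.2 ⟨h, by simp⟩
    simp [he] at this
  refine ⟨?_, ?_, ?_⟩
  · intro e h
    rcases Finset.mem_insert.1 h with rfl | h
    · simp [huv, hu.1, hv.1]
    · rw [mem_spans_s4] at h
      exact ⟨(hG.1 e h.1).1, h.2⟩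
  · rw [Finset.card_insert_of_notMem (fun h => huvE (mem_spans_s4.1 h).1)]
    omega
  · intro U hU hU2
    have hUV := hG.card_spans_add_three_le (hU.trans h1) hU2
    by_cases h : u ∈ U ∧ v ∈ U
    · have hsub : spans (insert s(u, v) (spans E V1)) U ⊆ insert s(u, v) (spans E U) := by
        intro e
        simp only [mem_spans_s4, Finset.mem_insert]
        tauto
      have hcard := (Finset.card_le_card hsub).trans (Finset.card_insert_le _ _)
      have hUS : U ∩ V2 = {u, v} := by
        have := hU.subset
        ext x
        have := congrArg (x ∈ ·) hS
        simp only [Finset.mem_inter, Finset.mem_insert, Finset.mem_singleton] at this ⊢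
        grind
      have hproper : U ∪ V2 ⊂ V := by
        obtain ⟨x, hx, hxU⟩ := Finset.exists_of_ssubset hU
        rw [Finset.ssubset_iff_of_subset (by have := hU.subset; grind)]
        refine ⟨x, h1.subset hx, fun hx' => ?_⟩
        have : x ∈ V1 ∩ V2 := by grind
        rw [hS] at this
        grind
      have hsuper := card_spans_add_card_spans_le E U V2
      have hunion := Finset.card_union_add_card_inter U V2
      rw [hUS, he, Finset.card_empty] at hsuper
      rw [hUS, Finset.card_pair huv] at hunion
      have := hG.card_spans_add_three_le hproper
        (hU2.trans (Finset.card_le_card Finset.subset_union_left))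
      omega
    · have hsub : spans (insert s(u, v) (spans E V1)) U ⊆ spans E U := by
        intro e
        simp only [mem_spans_s4, Finset.mem_insert]
        rintro ⟨rfl | h', hU'⟩
        · exact absurd ⟨hU' u (by simp), hU' v (by simp)⟩ h
        · exact ⟨h'.1, hU'⟩
      have := Finset.card_le_card hsub
      omega

end IsRigidityCircuit

/-- Every rigidity circuit with at least 5 vertices that is not 3-connected is the
combinatorial resultant of two rigidity circuits, each on at most `n - 1` vertices. -/
theorem not_threeConnected_circuit_has_CRD (V : Finset ℕ) (E : Finset (Sym2 ℕ))
    (hG : IsRigidityCircuit V E) (hnot3 : ¬ ThreeConnected V E) (hn : 5 ≤ V.card) :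
    ∃ (V1 V2 : Finset ℕ) (E1 E2 : Finset (Sym2 ℕ)) (e : Sym2 ℕ),
      IsRigidityCircuit V1 E1 ∧ IsRigidityCircuit V2 E2 ∧
      e ∈ E1 ∩ E2 ∧ V = V1 ∪ V2 ∧ E = (E1 ∪ E2) \ {e} ∧
      V1.card ≤ V.card - 1 ∧ V2.card ≤ V.card - 1 := by
  obtain ⟨V1, V2, hV, h1, h2, hS, hE⟩ := exists_separation hG.1 hnot3 (by omega)
  obtain ⟨hS, he, t1, t2⟩ := hG.tight_of_separation hV h1 h2 hS hE
  obtain ⟨u, v, huv, hS⟩ := Finset.card_eq_two.1 hS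
  rw [hS] at he
  have huvE : s(u, v) ∉ E := fun h => by
    have : s(u, v) ∈ spans E {u, v} := mem_spans_s4.2 ⟨h, by simp⟩
    simp [he] at this
  refine ⟨V1, V2, insert s(u, v) (spans E V1), insert s(u, v) (spans E V2), s(u, v),
    hG.insert_spans huv hV h1 hS he t1 t2,
    hG.insert_spans huv (by rw [Finset.union_comm, hV]) h2 (by rw [Finset.inter_comm, hS])
      he t2 t1, by simp, hV.symm, ?_,
    Nat.le_sub_one_of_lt (Finset.card_lt_card h1), Nat.le_sub_one_of_lt (Finset.card_lt_card h2)⟩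
  rw [← Finset.insert_union_distrib, hE, Finset.sdiff_singleton_eq_erase,
    Finset.erase_insert huvE]

end
end

section
/- Fix n ≥ 4 and let X_n = {x_{ij} : 1 ≤ i < j ≤ n}. Let C1, C2 ⊆ X_n be two distinct circuits of the algebraic rigidity matroid, let x ∈ C1 ∩ C2 be a common variable, and suppose C := (C1 ∪ C2) \ {x} is also a circuit of the algebraic rigidity matroid. Let p1, p2 and p be circuit polynomials for C1, C2 and C respectively, i.e., generators of the principal ideals CM_n ∩ ℚ[C1], CM_n ∩ ℚ[C2] and CM_n ∩ ℚ[C]. Then the Sylvester resultant Res(p1, p2, x), taken by regarding p1 and p2 as univariate polynomials in x with coefficients in the polynomial ring over ℚ in the remaining variables, is a nonzero polynomial and p divides Res(p1, p2, x) in ℚ[X_n]. -/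
noncomputable section

/-- The set of variables `X_n = {x_{ij} : 1 ≤ i < j ≤ n}`, realized as unordered
pairs of distinct elements of `Fin n`. -/
abbrev XVar (n : ℕ) : Type := {e : Sym2 (Fin n) // ¬ e.IsDiag}

/-- The Cayley–Menger matrix on `n` points: the `(n+1) × (n+1)` symmetric matrix with
rows and columns indexed by `0, 1, …, n`, with entry `0` at `(0,0)`, entries `1` at
`(0,i)` and `(i,0)` for `i ≥ 1`, entries `0` on the diagonal, and variable `x_{ij}`
at positions `(i,j)` and `(j,i)` for distinct `i, j ≥ 1`. -/
def cmMatrix (n : ℕ) : Matrix (Fin (n + 1)) (Fin (n + 1)) (MvPolynomial (XVar n) ℚ) :=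
  Matrix.of fun i j =>
    if hij : i = j then 0
    else if hi : i = 0 then 1
    else if hj : j = 0 then 1
    else MvPolynomial.X ⟨s(i.pred hi, j.pred hj), by
      rw [Sym2.mk_isDiag_iff]
      exact fun h => hij (by
        have := congrArg (Fin.succ) h
        rwa [Fin.succ_pred, Fin.succ_pred] at this)⟩

/-- The Cayley–Menger ideal `CM_n ⊆ ℚ[X_n]`: the ideal generated by all `5 × 5`
minors of the Cayley–Menger matrix on `n` points. -/
def cmIdeal (n : ℕ) : Ideal (MvPolynomial (XVar n) ℚ) :=
  Ideal.span { p | ∃ (r c : Fin 5 → Fin (n + 1)),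
    Function.Injective r ∧ Function.Injective c ∧
    p = ((cmMatrix n).submatrix r c).det }

/-- The Sylvester matrix of two polynomials `f` and `g` over a commutative ring,
of size `(m + n) × (m + n)` where `m = deg f` and `n = deg g`: the first `n` rows
are the shifted coefficient vectors of `f` (leading coefficient first) and the last
`m` rows are the shifted coefficient vectors of `g`. -/
def sylvesterMatrix {R : Type*} [CommRing R] (f g : Polynomial R) :
    Matrix (Fin (g.natDegree + f.natDegree)) (Fin (g.natDegree + f.natDegree)) R :=
  Matrix.of fun i j =>
    if (i : ℕ) < g.natDegree then
      -- row of coefficients of `f`, shifted by `i`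
      if (i : ℕ) ≤ (j : ℕ) ∧ (j : ℕ) ≤ (i : ℕ) + f.natDegree then
        f.coeff (f.natDegree + (i : ℕ) - (j : ℕ))
      else 0
    else
      -- row of coefficients of `g`, shifted by `i - deg g`
      if (i : ℕ) - g.natDegree ≤ (j : ℕ) ∧ (j : ℕ) ≤ (i : ℕ) - g.natDegree + g.natDegree then
        g.coeff (g.natDegree + ((i : ℕ) - g.natDegree) - (j : ℕ))
      else 0

/-- The Sylvester resultant of two polynomials: the determinant of their
Sylvester matrix. It eliminates the polynomial variable. -/
def resultant {R : Type*} [CommRing R] (f g : Polynomial R) : R :=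
  (sylvesterMatrix f g).det

/-- Regard a polynomial in `ℚ[X_n]` as a univariate polynomial in the variable `x`
with coefficients in the polynomial ring over `ℚ` in the remaining variables. -/
def toUnivariate (n : ℕ) (x : XVar n) (p : MvPolynomial (XVar n) ℚ) :
    Polynomial (MvPolynomial {y : XVar n // y ≠ x} ℚ) :=
  MvPolynomial.optionEquivLeft ℚ {y : XVar n // y ≠ x}
    (MvPolynomial.rename (Equiv.optionSubtypeNe x).symm p)

/-- Regard a polynomial in the variables other than `x` as an element of `ℚ[X_n]`. -/
def ofRemaining (n : ℕ) (x : XVar n) (q : MvPolynomial {y : XVar n // y ≠ x} ℚ) :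
    MvPolynomial (XVar n) ℚ :=
  MvPolynomial.rename (Subtype.val : {y : XVar n // y ≠ x} → XVar n) q


/-- `C ⊆ X_n` is a circuit of the algebraic rigidity matroid: `CM_n ∩ ℚ[C] ≠ {0}`
while `CM_n ∩ ℚ[C'] = {0}` for every proper subset `C' ⊊ C`. -/
def IsAlgCircuit (n : ℕ) (C : Set (XVar n)) : Prop :=
  (∃ p ∈ cmIdeal n, p ∈ MvPolynomial.supported ℚ C ∧ p ≠ 0) ∧
    ∀ C' ⊂ C, ∀ p ∈ cmIdeal n, p ∈ MvPolynomial.supported ℚ C' → p = 0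

/-- `p` is a circuit polynomial for `C`: it lies in `ℚ[C]` and generates the ideal
`CM_n ∩ ℚ[C]` of `ℚ[C]`. -/
def IsCircuitPolynomial (n : ℕ) (C : Set (XVar n)) (p : MvPolynomial (XVar n) ℚ) : Prop :=
  p ∈ MvPolynomial.supported ℚ C ∧
    ∀ q ∈ MvPolynomial.supported ℚ C,
      (q ∈ cmIdeal n ↔ ∃ r ∈ MvPolynomial.supported ℚ C, q = r * p)

/-- A symmetric matrix over an algebraically closed field of characteristic zero all of whose
`3 × 3` minors vanish is the Gram matrix of a family of vectors in the plane. -/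
theorem exists_planar_gram_of_minors_eq_zero {K ι : Type*} [Field K] [IsAlgClosed K] [CharZero K]
    (G : ι → ι → K) (hsymm : ∀ i j, G i j = G j i)
    (hdet : ∀ r c : Fin 3 → ι, (Matrix.of fun a b => G (r a) (c b)).det = 0) :
    ∃ p q : ι → K, ∀ i j, G i j = p i * p j + q i * q j := by
  have minor (a b c a' b' c' : ι) :
      G a a' * G b b' * G c c' - G a a' * G b c' * G c b' - G a b' * G b a' * G c c'
        + G a b' * G b c' * G c a' + G a c' * G b a' * G c b' - G a c' * G b b' * G c a' = 0 := by
    simpa [Matrix.det_fin_three] using hdet ![a, b, c] ![a', b', c']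
  by_cases hdiag : ∀ k, G k k = 0
  · by_cases hzero : ∀ k l, G k l = 0
    · exact ⟨0, 0, by simp [hzero]⟩
    push Not at hzero
    obtain ⟨k, l, hkl⟩ := hzero
    obtain ⟨t, ht⟩ := IsAlgClosed.exists_pow_nat_eq (-1 : K) two_pos
    obtain ⟨s, hs⟩ := IsAlgClosed.exists_pow_nat_eq (2 * G k l) two_pos
    have hs0 : s ≠ 0 := by
      rintro rfl
      exact hkl (by simpa using hs.symm)
    have ht0 : t ≠ 0 := by
      rintro rfl
      simp at ht
    refine ⟨fun i => (G i k + G i l) / s, fun i => t * (G i k - G i l) / s, fun i j => ?_⟩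
    have h := minor k l i k l j
    rw [hdiag, hdiag, hsymm l k, hsymm k j, hsymm l j] at h
    have h' : G k l * G i j = G i k * G j l + G i l * G j k := by
      apply mul_left_cancel₀ hkl
      linear_combination -h
    field_simp
    linear_combination G i j * hs + 2 * h' - (G i k - G i l) * (G j k - G j l) * ht
  · push Not at hdiag
    obtain ⟨k, hk⟩ := hdiag
    obtain ⟨s, hs⟩ := IsAlgClosed.exists_pow_nat_eq (G k k) two_pos
    have hs0 : s ≠ 0 := by
      rintro rfl
      exact hk (by simpa using hs.symm)
    set H : ι → ι → K := fun i j => G k k * G i j - G i k * G j k with hH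
    have hHminor (i j i' j' : ι) : H i i' * H j j' = H i j' * H j i' := by
      have h := minor k i j k i' j'
      rw [hsymm k i', hsymm k j'] at h
      simp only [hH]
      linear_combination G k k * h
    have hHsymm (i j : ι) : H i j = H j i := by simp only [hH, hsymm i j]; ring
    by_cases hHdiag : ∀ l, H l l = 0
    · refine ⟨fun i => G i k / s, 0, fun i j => ?_⟩
      have h : H i j = 0 := by
        have := hHminor i j i j
        rw [hHdiag, hHsymm j i] at this
        simpa using this.symm
      simp only [hH] at h
      simp only [Pi.zero_apply]
      field_simp
      linear_combination h + G i j * hs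
    · push Not at hHdiag
      obtain ⟨l, hl⟩ := hHdiag
      obtain ⟨u, hu⟩ := IsAlgClosed.exists_pow_nat_eq (H l l) two_pos
      have hu0 : u ≠ 0 := by
        rintro rfl
        exact hl (by simpa using hu.symm)
      refine ⟨fun i => G i k / s, fun i => H i l / (s * u), fun i j => ?_⟩
      have h := hHminor i l j l
      rw [hHsymm l j] at h
      have h' : H i j = G k k * G i j - G i k * G j k := rfl
      field_simp
      linear_combination (G i j * u ^ 2) * hs + (G k k * G i j - G i k * G j k) * hu + h
        - H l l * h'

/-- The ring homomorphism sending each variable `x_{ij}` to the squared distance between the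
points `i` and `j` of a planar configuration with coordinates `u` and `v`. -/
def squaredDistance {S : Type*} [CommRing S] [Algebra ℚ S] (n : ℕ) (u v : Fin n → S) :
    MvPolynomial (XVar n) ℚ →ₐ[ℚ] S :=
  MvPolynomial.aeval fun e =>
    Sym2.lift ⟨fun i j => (u i - u j) ^ 2 + (v i - v j) ^ 2, fun i j => by ring⟩ e.1

theorem cmMatrix_zero_succ (n : ℕ) (i : Fin n) : cmMatrix n 0 i.succ = 1 := by
  simp [cmMatrix, (Fin.succ_ne_zero i).symm]

theorem cmMatrix_succ_zero (n : ℕ) (i : Fin n) : cmMatrix n i.succ 0 = 1 := by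
  simp [cmMatrix]

theorem cmMatrix_self (n : ℕ) (i : Fin (n + 1)) : cmMatrix n i i = 0 := by
  simp [cmMatrix]

theorem cmMatrix_symm (n : ℕ) (i j : Fin (n + 1)) : cmMatrix n i j = cmMatrix n j i := by
  by_cases hij : i = j
  · rw [hij]
  · by_cases hi : i = 0 <;> by_cases hj : j = 0 <;>
      simp [cmMatrix, hij, Ne.symm hij, hi, hj, Sym2.eq_swap, eq_comm (a := (0 : Fin (n + 1)))]

theorem cmMatrix_succ_succ (n : ℕ) (i j : Fin n) (h : i ≠ j) :
    cmMatrix n i.succ j.succ = MvPolynomial.X ⟨s(i, j), by simpa using h⟩ := by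
  simp [cmMatrix, h]

theorem squaredDistance_cmMatrix_succ_succ {S : Type*} [CommRing S] [Algebra ℚ S] (n : ℕ)
    (u v : Fin n → S) (i j : Fin n) :
    squaredDistance n u v (cmMatrix n i.succ j.succ) = (u i - u j) ^ 2 + (v i - v j) ^ 2 := by
  by_cases h : i = j
  · simp [h, cmMatrix_self]
  · rw [cmMatrix_succ_succ n i j h]
    simp [squaredDistance]

/-- The Cayley–Menger ideal vanishes on planar configurations. -/
theorem cmIdeal_le_ker_squaredDistance {S : Type*} [CommRing S] [Algebra ℚ S] (n : ℕ)
    (u v : Fin n → S) : cmIdeal n ≤ RingHom.ker (squaredDistance n u v) := by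
  rw [cmIdeal, Ideal.span_le]
  rintro _ ⟨r, c, -, -, rfl⟩
  rw [SetLike.mem_coe, RingHom.mem_ker, AlgHom.map_det]
  let A : Fin (n + 1) → Fin 5 → S :=
    Fin.cases ![1, 0, 0, 0, 0] fun i => ![u i ^ 2 + v i ^ 2, 1, u i, v i, 0]
  let B : Fin (n + 1) → Fin 5 → S :=
    Fin.cases ![0, 1, 0, 0, 0] fun i => ![1, u i ^ 2 + v i ^ 2, -2 * u i, -2 * v i, 0]
  have hmul (i j : Fin (n + 1)) : squaredDistance n u v (cmMatrix n i j) = ∑ k, A i k * B j k := by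
    induction i using Fin.cases <;> induction j using Fin.cases
    · simp [cmMatrix_self, A, B, Fin.sum_univ_five]
    · simp [cmMatrix_zero_succ, A, B, Fin.sum_univ_five]
    · simp [cmMatrix_succ_zero, A, B, Fin.sum_univ_five]
    · rw [squaredDistance_cmMatrix_succ_succ]
      simp [A, B, Fin.sum_univ_five]
      ring
  have hfac : (squaredDistance n u v).mapMatrix ((cmMatrix n).submatrix r c) =
      Matrix.of (fun a k => A (r a) k) * Matrix.of (fun k b => B (c b) k) := by
    ext a b
    simp [hmul, Matrix.mul_apply]
  rw [hfac, Matrix.det_mul, Matrix.det_eq_zero_of_column_eq_zero 4, zero_mul]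
  intro a
  rw [Matrix.of_apply]
  cases r a using Fin.cases <;> simp [A]

theorem det_cayleyMenger_eq_det_gram {S : Type*} [CommRing S] (d : Fin 3 → Fin 3 → S)
    (x y : Fin 3 → S) :
    (!![0, 1, 1, 1, 1; 1, 0, y 0, y 1, y 2; 1, x 0, d 0 0, d 0 1, d 0 2;
        1, x 1, d 1 0, d 1 1, d 1 2; 1, x 2, d 2 0, d 2 1, d 2 2]).det =
      (Matrix.of fun a b => x a + y b - d a b).det := by
  simp [Matrix.det_succ_row_zero, Fin.sum_univ_succ, Fin.succAbove]
  ring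

/-- Over an algebraically closed field every zero of the Cayley–Menger ideal is the vector of
squared distances of a planar configuration. -/
theorem exists_squaredDistance_eq {K : Type*} [Field K] [IsAlgClosed K] [Algebra ℚ K] (n : ℕ)
    (a : Fin n) (ψ : MvPolynomial (XVar n) ℚ →ₐ[ℚ] K) (hψ : cmIdeal n ≤ RingHom.ker ψ) :
    ∃ u v : Fin n → K, squaredDistance n u v = ψ := by
  have : CharZero K := algebraRat.charZero K
  set d : Fin n → Fin n → K := fun i j => ψ (cmMatrix n i.succ j.succ) with hd
  have hdself (i : Fin n) : d i i = 0 := by simp [hd, cmMatrix_self]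
  have hdsymm (i j : Fin n) : d i j = d j i := by simp only [hd, cmMatrix_symm n i.succ]
  have hgram (r c : Fin 3 → Fin n) :
      (Matrix.of fun k l => d (r k) a + d a (c l) - d (r k) (c l)).det = 0 := by
    by_cases hr : Function.Injective (Fin.cons a r : Fin 4 → Fin n)
    · by_cases hc : Function.Injective (Fin.cons a c : Fin 4 → Fin n)
      · have inj {e : Fin 4 → Fin n} (he : Function.Injective e) :
            Function.Injective
              ![0, (e 0).succ, (e 1).succ, (e 2).succ, (e 3).succ] := by
          have h : ![0, (e 0).succ, (e 1).succ, (e 2).succ, (e 3).succ] =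
              (Fin.cons 0 (Fin.succ ∘ e) : Fin 5 → Fin (n + 1)) := by
            ext k
            fin_cases k <;> rfl
          rw [h]
          exact Fin.cons_injective_iff.2
            ⟨by simp [Fin.succ_ne_zero], (Fin.succ_injective n).comp he⟩
        have hmem := hψ (Ideal.subset_span ⟨_, _, inj hr, inj hc, rfl⟩)
        rw [RingHom.mem_ker, AlgHom.map_det] at hmem
        rw [← det_cayleyMenger_eq_det_gram (fun k l => d (r k) (c l))]
        refine Eq.trans (congrArg Matrix.det ?_) hmem
        ext i j
        rw [AlgHom.mapMatrix_apply, Matrix.map_apply, Matrix.submatrix_apply]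
        fin_cases i <;> fin_cases j
        all_goals first
          | exact (map_zero ψ).symm.trans (congrArg ψ (cmMatrix_self n _).symm)
          | exact (map_one ψ).symm.trans (congrArg ψ (cmMatrix_zero_succ n _).symm)
          | exact (map_one ψ).symm.trans (congrArg ψ (cmMatrix_succ_zero n _).symm)
          | rfl
      · rw [Fin.cons_injective_iff, not_and_or, not_not, Set.mem_range] at hc
        obtain ⟨k, hk⟩ | hc := hc
        · exact Matrix.det_eq_zero_of_column_eq_zero k fun l => by simp [hk, hdself]
        · simp only [Function.Injective, not_forall] at hc
          obtain ⟨k, l, hkl, hne⟩ := hc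
          exact Matrix.det_zero_of_column_eq hne fun m => by simp [hkl]
    · rw [Fin.cons_injective_iff, not_and_or, not_not, Set.mem_range] at hr
      obtain ⟨k, hk⟩ | hr := hr
      · exact Matrix.det_eq_zero_of_row_eq_zero k fun l => by simp [hk, hdself]
      · simp only [Function.Injective, not_forall] at hr
        obtain ⟨k, l, hkl, hne⟩ := hr
        exact Matrix.det_zero_of_row_eq hne (by ext m; simp [hkl])
  obtain ⟨u, v, huv⟩ := exists_planar_gram_of_minors_eq_zero
    (fun i j => 2⁻¹ * (d i a + d a j - d i j))
    (fun i j => by rw [hdsymm i a, hdsymm a j, hdsymm i j]; ring)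
    (fun r c => by
      have h := Matrix.det_smul
        (Matrix.of fun k l => d (r k) a + d a (c l) - d (r k) (c l)) (2⁻¹ : K)
      rw [hgram, mul_zero] at h
      exact h)
  refine ⟨u, v, ?_⟩
  apply MvPolynomial.algHom_ext
  rintro ⟨e, he⟩
  induction e using Sym2.ind with
  | _ i j =>
    have hij : i ≠ j := by simpa using he
    rw [← cmMatrix_succ_succ n i j hij, squaredDistance_cmMatrix_succ_succ]
    have hii := huv i i
    have hjj := huv j j
    have hij := huv i j
    simp only [hdself, hdsymm a] at hii hjj hij
    change _ = d i j
    linear_combination (-1 : K) * hii - hjj + 2 * hij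

/-- The Cayley–Menger ideal has prime radical. -/
theorem radical_cmIdeal_isPrime (n : ℕ) (hn : 0 < n) : (cmIdeal n).radical.IsPrime := by
  set φ : MvPolynomial (XVar n) ℚ →ₐ[ℚ] MvPolynomial (Fin n ⊕ Fin n) ℚ :=
    squaredDistance n (MvPolynomial.X ∘ Sum.inl) (MvPolynomial.X ∘ Sum.inr) with hφ
  have hprime : (RingHom.ker φ).IsPrime := RingHom.ker_isPrime φ
  suffices (cmIdeal n).radical = RingHom.ker φ by rwa [this]
  refine le_antisymm (hprime.radical_le_iff.2 (cmIdeal_le_ker_squaredDistance n _ _)) ?_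
  rw [Ideal.radical_eq_sInf]
  refine le_sInf fun J hJ f hf => ?_
  obtain ⟨hle, hJprime⟩ := hJ
  let K := AlgebraicClosure (FractionRing (MvPolynomial (XVar n) ℚ ⧸ J))
  let ι : MvPolynomial (XVar n) ℚ ⧸ J →ₐ[ℚ] K :=
    (IsScalarTower.toAlgHom ℚ (FractionRing (MvPolynomial (XVar n) ℚ ⧸ J)) K).comp
      (IsScalarTower.toAlgHom ℚ (MvPolynomial (XVar n) ℚ ⧸ J) _)
  have hι : Function.Injective ι :=
    (algebraMap (FractionRing (MvPolynomial (XVar n) ℚ ⧸ J)) K).injective.comp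
      (IsFractionRing.injective (MvPolynomial (XVar n) ℚ ⧸ J) _)
  obtain ⟨u, v, huv⟩ := exists_squaredDistance_eq n ⟨0, hn⟩ (ι.comp (Ideal.Quotient.mkₐ ℚ J))
    fun g hg => by
      rw [RingHom.mem_ker, AlgHom.comp_apply, Ideal.Quotient.mkₐ_eq_mk,
        Ideal.Quotient.eq_zero_iff_mem.2 (hle hg), map_zero]
  have hfactor : (MvPolynomial.aeval (Sum.elim u v)).comp φ = squaredDistance n u v := by
    apply MvPolynomial.algHom_ext
    rintro ⟨e, he⟩
    induction e using Sym2.ind with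
    | _ i j => simp [hφ, squaredDistance]
  rw [← Ideal.Quotient.eq_zero_iff_mem]
  apply hι
  rw [map_zero, ← Ideal.Quotient.mkₐ_eq_mk ℚ, ← AlgHom.comp_apply, ← huv, ← hfactor,
    AlgHom.comp_apply, RingHom.mem_ker.1 hf, map_zero]

/-- The defining Sylvester determinant agrees with the resultant of Mathlib. -/
theorem resultant_eq_polynomial_resultant {R : Type*} [CommRing R] (f g : Polynomial R) :
    resultant f g = Polynomial.resultant f g := by
  let e : Fin (g.natDegree + f.natDegree) ≃ Fin (f.natDegree + g.natDegree) :=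
    (finCongr (add_comm _ _)).trans Fin.revPerm
  rw [resultant, Polynomial.resultant, ← Matrix.det_transpose,
    ← Matrix.det_submatrix_equiv_self e]
  congr 1
  ext i j
  have hi := i.2
  have hj := j.2
  have hei : (e i : ℕ) = f.natDegree + g.natDegree - 1 - i := by
    simp [e, Fin.val_rev]
    omega
  have hej : (e j : ℕ) = f.natDegree + g.natDegree - 1 - j := by
    simp [e, Fin.val_rev]
    omega
  rw [Matrix.transpose_apply, Matrix.submatrix_apply, sylvesterMatrix, Polynomial.sylvester,
    Matrix.of_apply, Matrix.of_apply]
  by_cases h : (j : ℕ) < g.natDegree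
  · obtain ⟨k, hk⟩ : ∃ k : Fin g.natDegree, e j = Fin.natAdd f.natDegree k :=
      ⟨⟨g.natDegree - 1 - j, by omega⟩, Fin.ext (by simp [hej]; omega)⟩
    have hk' := congrArg Fin.val hk
    rw [Fin.val_natAdd, hej] at hk'
    rw [hk, Fin.addCases_right, if_pos h, hei]
    congr 1
    · simp only [Set.mem_Icc, eq_iff_iff]; omega
    · congr 1; omega
  · obtain ⟨k, hk⟩ : ∃ k : Fin f.natDegree, e j = Fin.castAdd g.natDegree k :=
      ⟨⟨f.natDegree + g.natDegree - 1 - j, by omega⟩, Fin.ext (by simp [hej])⟩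
    have hk' := congrArg Fin.val hk
    rw [Fin.val_castAdd, hej] at hk'
    rw [hk, Fin.addCases_left, if_neg h, hei]
    congr 1
    · simp only [Set.mem_Icc, eq_iff_iff]; omega
    · congr 1; omega

/-- Two polynomials over a unique factorization domain with vanishing resultant, not both zero,
have a common irreducible factor. -/
theorem exists_irreducible_dvd_of_resultant_eq_zero {R : Type*} [CommRing R] [IsDomain R]
    [UniqueFactorizationMonoid R] {f g : Polynomial R} (hf : f ≠ 0)
    (h : Polynomial.resultant f g = 0) : ∃ q, Irreducible q ∧ q ∣ f ∧ q ∣ g := by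
  let : NormalizedGCDMonoid R := Nonempty.some inferInstance
  classical
  let K := FractionRing R
  have hinj : Function.Injective (algebraMap R K) := IsFractionRing.injective R K
  have hK : ¬ IsCoprime (f.map (algebraMap R K)) (g.map (algebraMap R K)) := by
    refine (Polynomial.resultant_eq_zero_iff.1 ?_).2
    rw [Polynomial.natDegree_map_eq_of_injective hinj,
      Polynomial.natDegree_map_eq_of_injective hinj, Polynomial.resultant_map_map, h, map_zero]
  rw [← EuclideanDomain.gcd_isUnit_iff] at hK
  set d := EuclideanDomain.gcd (f.map (algebraMap R K)) (g.map (algebraMap R K)) with hd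
  have hd0 : d ≠ 0 := by
    intro h0
    have := (EuclideanDomain.gcd_eq_zero_iff.1 h0).1
    exact hf ((Polynomial.map_eq_zero_iff hinj).1 this)
  set N := IsLocalization.integerNormalization (nonZeroDivisors R) d with hN
  obtain ⟨b, hb, hbN⟩ := IsLocalization.integerNormalization_spec (nonZeroDivisors R) d
  have hN0 : N ≠ 0 := by
    rw [hN, Ne, IsFractionRing.integerNormalization_eq_zero_iff]
    exact hd0
  have hdvd : N.primPart.map (algebraMap R K) ∣ d := by
    have hunit : IsUnit (Polynomial.C (algebraMap R K b)) :=
      Polynomial.isUnit_C.2 (IsUnit.mk0 _ (by simpa using nonZeroDivisors.ne_zero hb))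
    have hmap : N.map (algebraMap R K) = Polynomial.C (algebraMap R K b) * d := by
      rw [hbN, Algebra.smul_def, Polynomial.algebraMap_apply]
    rw [← hunit.dvd_mul_left, ← hmap]
    exact Polynomial.map_dvd _ N.primPart_dvd
  have hnu : ¬ IsUnit N.primPart := fun hu =>
    hK (Polynomial.isUnit_or_eq_zero_of_isUnit_integerNormalization_primPart hd0 hu)
  obtain ⟨q, hq, hqN⟩ := WfDvdMonoid.exists_irreducible_factor hnu N.primPart_ne_zero
  have hprim := N.isPrimitive_primPart
  exact ⟨q, hq,
    hqN.trans (hprim.dvd_of_fraction_map_dvd_fraction_map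
      (hdvd.trans (EuclideanDomain.gcd_dvd_left _ _))),
    hqN.trans (hprim.dvd_of_fraction_map_dvd_fraction_map
      (hdvd.trans (EuclideanDomain.gcd_dvd_right _ _)))⟩

theorem mem_supported_of_dvd {σ R : Type*} [CommRing R] [IsDomain R] {s : Set σ}
    {p q : MvPolynomial σ R} (hp : p ∈ MvPolynomial.supported R s) (hp0 : p ≠ 0) (hq : q ∣ p) :
    q ∈ MvPolynomial.supported R s := by
  classical
  obtain ⟨r, rfl⟩ := hq
  rw [mul_ne_zero_iff] at hp0
  rw [MvPolynomial.mem_supported] at hp ⊢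
  refine subset_trans (Finset.coe_subset.2 fun i hi => ?_) hp
  rw [MvPolynomial.vars_def, MvPolynomial.degrees_mul_eq hp0.1 hp0.2]
  rw [MvPolynomial.vars_def] at hi
  simp only [Multiset.mem_toFinset, Multiset.mem_add] at hi ⊢
  exact Or.inl hi

theorem IsAlgCircuit.ne_zero {n : ℕ} {C : Set (XVar n)} {p : MvPolynomial (XVar n) ℚ}
    (hC : IsAlgCircuit n C) (hp : IsCircuitPolynomial n C p) : p ≠ 0 := by
  rintro rfl
  obtain ⟨q, hq, hqs, hq0⟩ := hC.1
  obtain ⟨r, -, rfl⟩ := (hp.2 q hqs).1 hq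
  exact hq0 (mul_zero r)

theorem IsCircuitPolynomial.mem_cmIdeal {n : ℕ} {C : Set (XVar n)} {p : MvPolynomial (XVar n) ℚ}
    (hp : IsCircuitPolynomial n C p) : p ∈ cmIdeal n :=
  (hp.2 p hp.1).2 ⟨1, one_mem _, (one_mul _).symm⟩

theorem IsAlgCircuit.not_subset {n : ℕ} {C1 C2 : Set (XVar n)} (hC1 : IsAlgCircuit n C1)
    (hC2 : IsAlgCircuit n C2) (hne : C1 ≠ C2) : ¬ C1 ⊆ C2 := by
  intro h
  obtain ⟨q, hq, hqs, hq0⟩ := hC1.1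
  exact hq0 (hC2.2 C1 (h.ssubset_of_ne hne) q hq hqs)

/-- Circuit polynomials of circuits, the first not contained in the second, have no common
irreducible factor. -/
theorem not_dvd_of_irreducible_of_dvd {n : ℕ} (hn : 0 < n) {C1 C2 : Set (XVar n)}
    (hC1 : IsAlgCircuit n C1) (hC : ¬ C1 ⊆ C2) {p1 p2 q : MvPolynomial (XVar n) ℚ}
    (hp1 : IsCircuitPolynomial n C1 p1) (hp2 : IsCircuitPolynomial n C2 p2)
    (hp10 : p1 ≠ 0) (hp20 : p2 ≠ 0) (hq : Irreducible q) (hq1 : q ∣ p1) : ¬ q ∣ p2 := by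
  intro hq2
  have hprime := radical_cmIdeal_isPrime n hn
  have hqs1 := mem_supported_of_dvd hp1.1 hp10 hq1
  have hqs2 := mem_supported_of_dvd hp2.1 hp20 hq2
  have hqs : q ∈ MvPolynomial.supported ℚ (C1 ∩ C2) := by
    rw [MvPolynomial.mem_supported] at *
    exact Set.subset_inter hqs1 hqs2
  have hqrad : q ∉ (cmIdeal n).radical := by
    rintro ⟨m, hm⟩
    refine pow_ne_zero m hq.ne_zero (hC1.2 (C1 ∩ C2) ?_ _ hm (pow_mem hqs m))
    exact ⟨Set.inter_subset_left, fun h => hC fun i hi => (h hi).2⟩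
  obtain ⟨k, hqk, hk⟩ :=
    (FiniteMultiplicity.of_prime_left hq.prime hp10).exists_eq_pow_mul_and_not_dvd
  have hkmem : k ∈ (cmIdeal n).radical := by
    have h := Ideal.le_radical hp1.mem_cmIdeal
    rw [hqk] at h
    exact (hprime.mem_or_mem h).resolve_left fun h' => hqrad (hprime.mem_of_pow_mem _ h')
  obtain ⟨m, hm⟩ := hkmem
  have hks := mem_supported_of_dvd hp1.1 hp10 (Dvd.intro_left _ hqk.symm)
  obtain ⟨r, -, hr⟩ := (hp1.2 _ (pow_mem hks m)).1 hm
  exact hk (hq.prime.dvd_of_dvd_pow (hr ▸ hq1.mul_left r))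

/-- The isomorphism underlying `toUnivariate`. -/
def univariateEquiv (n : ℕ) (x : XVar n) :
    MvPolynomial (XVar n) ℚ ≃ₐ[ℚ] Polynomial (MvPolynomial {y : XVar n // y ≠ x} ℚ) :=
  (MvPolynomial.renameEquiv ℚ (Equiv.optionSubtypeNe x).symm).trans
    (MvPolynomial.optionEquivLeft ℚ {y : XVar n // y ≠ x})

theorem univariateEquiv_apply (n : ℕ) (x : XVar n) (p : MvPolynomial (XVar n) ℚ) :
    univariateEquiv n x p = toUnivariate n x p := rfl

theorem univariateEquiv_ofRemaining (n : ℕ) (x : XVar n)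
    (q : MvPolynomial {y : XVar n // y ≠ x} ℚ) :
    univariateEquiv n x (ofRemaining n x q) = Polynomial.C q := by
  induction q using MvPolynomial.induction_on with
  | C a => simp [univariateEquiv, ofRemaining]
  | add p q hp hq =>
    simp only [ofRemaining, map_add] at hp hq ⊢
    rw [hp, hq]
  | mul_X p i hp =>
    simp only [ofRemaining, map_mul] at hp ⊢
    rw [hp]
    simp [univariateEquiv, i.2]

theorem coeff_toUnivariate_mem_supported {n : ℕ} {x : XVar n} {C : Set (XVar n)}
    {p : MvPolynomial (XVar n) ℚ} (hp : p ∈ MvPolynomial.supported ℚ C) (k : ℕ) :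
    (toUnivariate n x p).coeff k ∈ MvPolynomial.supported ℚ (Subtype.val ⁻¹' C) := by
  induction hp using Algebra.adjoin_induction generalizing k with
  | mem p hp =>
    obtain ⟨y, hy, rfl⟩ := hp
    by_cases h : y = x
    · simp only [toUnivariate, MvPolynomial.rename_X, h, Equiv.optionSubtypeNe_symm_self,
        MvPolynomial.optionEquivLeft_X_none, Polynomial.coeff_X]
      split_ifs
      · exact one_mem _
      · exact zero_mem _
    · simp only [toUnivariate, MvPolynomial.rename_X, Equiv.optionSubtypeNe_symm_of_ne h,
        MvPolynomial.optionEquivLeft_X_some, Polynomial.coeff_C]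
      split_ifs
      · exact MvPolynomial.X_mem_supported.2 hy
      · exact zero_mem _
  | algebraMap r =>
    rw [← univariateEquiv_apply, AlgEquiv.commutes, Polynomial.algebraMap_apply,
      Polynomial.coeff_C]
    split_ifs
    · exact Subalgebra.algebraMap_mem _ r
    · exact zero_mem _
  | add p q _ _ hp hq =>
    rw [← univariateEquiv_apply, map_add, Polynomial.coeff_add]
    exact add_mem (hp k) (hq k)
  | mul p q _ _ hp hq =>
    rw [← univariateEquiv_apply, map_mul, Polynomial.coeff_mul]
    exact sum_mem fun i _ => mul_mem (hp i.1) (hq i.2)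

theorem resultant_mem_of_coeff_mem {R A : Type*} [CommRing R] [CommRing A] [Algebra A R]
    (S : Subalgebra A R) {f g : Polynomial R} (hf : ∀ k, f.coeff k ∈ S)
    (hg : ∀ k, g.coeff k ∈ S) : resultant f g ∈ S := by
  rw [resultant, Matrix.det_apply]
  refine S.sum_mem fun τ _ => zsmul_mem (S.prod_mem fun i _ => ?_) _
  rw [sylvesterMatrix, Matrix.of_apply]
  split_ifs
  exacts [hf _, zero_mem _, hg _, zero_mem _]

theorem ofRemaining_mem_supported {n : ℕ} {x : XVar n} {C : Set (XVar n)}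
    {q : MvPolynomial {y : XVar n // y ≠ x} ℚ}
    (hq : q ∈ MvPolynomial.supported ℚ (Subtype.val ⁻¹' C)) :
    ofRemaining n x q ∈ MvPolynomial.supported ℚ (C \ {x}) := by
  have h : (MvPolynomial.supported ℚ (Subtype.val ⁻¹' C)).map
      (MvPolynomial.rename (Subtype.val : {y : XVar n // y ≠ x} → XVar n)) ≤
      MvPolynomial.supported ℚ (C \ {x}) := by
    rw [MvPolynomial.supported, AlgHom.map_adjoin, Algebra.adjoin_le_iff]
    rintro _ ⟨_, ⟨y, hy, rfl⟩, rfl⟩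
    rw [MvPolynomial.rename_X, SetLike.mem_coe, MvPolynomial.X_mem_supported]
    exact ⟨hy, y.2⟩
  exact h ⟨q, hq, rfl⟩

/-- A circuit polynomial has positive degree in every variable of its circuit. -/
theorem IsAlgCircuit.natDegree_toUnivariate_ne_zero {n : ℕ} {C : Set (XVar n)} {x : XVar n}
    {p : MvPolynomial (XVar n) ℚ} (hC : IsAlgCircuit n C) (hx : x ∈ C)
    (hp : IsCircuitPolynomial n C p) : (toUnivariate n x p).natDegree ≠ 0 := by
  intro h
  refine hC.ne_zero hp (hC.2 (C \ {x}) ?_ p hp.mem_cmIdeal ?_)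
  · exact ⟨Set.sdiff_subset, fun h' => (h' hx).2 rfl⟩
  · have hpx : p = ofRemaining n x ((toUnivariate n x p).coeff 0) := by
      apply (univariateEquiv n x).injective
      rw [univariateEquiv_ofRemaining, univariateEquiv_apply]
      exact Polynomial.eq_C_of_natDegree_eq_zero h
    rw [hpx]
    exact ofRemaining_mem_supported (coeff_toUnivariate_mem_supported hp.1 0)

/-- If `C1`, `C2` are distinct circuits of the algebraic rigidity matroid with a
common variable `x` such that `C = (C1 ∪ C2) \ {x}` is also a circuit, and `p1`, `p2`,
`p` are circuit polynomials for `C1`, `C2`, `C` respectively, then the Sylvester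
resultant `Res(p1, p2, x)` is nonzero and is divisible by `p` in `ℚ[X_n]`. -/
theorem circuitPolynomial_dvd_resultant (n : ℕ) (hn : 4 ≤ n)
    (C1 C2 : Set (XVar n)) (hC1 : IsAlgCircuit n C1) (hC2 : IsAlgCircuit n C2)
    (hne : C1 ≠ C2) (x : XVar n) (hx : x ∈ C1 ∩ C2)
    (hC : IsAlgCircuit n ((C1 ∪ C2) \ {x}))
    (p1 p2 p : MvPolynomial (XVar n) ℚ)
    (hp1 : IsCircuitPolynomial n C1 p1) (hp2 : IsCircuitPolynomial n C2 p2)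
    (hp : IsCircuitPolynomial n ((C1 ∪ C2) \ {x}) p) :
    resultant (toUnivariate n x p1) (toUnivariate n x p2) ≠ 0 ∧
      p ∣ ofRemaining n x (resultant (toUnivariate n x p1) (toUnivariate n x p2)) := by
  have hp10 := hC1.ne_zero hp1
  have hp20 := hC2.ne_zero hp2
  rw [resultant_eq_polynomial_resultant]
  constructor
  · intro h0
    obtain ⟨q, hq, hq1, hq2⟩ := exists_irreducible_dvd_of_resultant_eq_zero
      (f := toUnivariate n x p1) ((map_ne_zero_iff _ (univariateEquiv n x).injective).2 hp10) h0
    rw [← univariateEquiv_apply, ← (univariateEquiv n x).apply_symm_apply q, map_dvd_iff]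
      at hq1 hq2
    exact not_dvd_of_irreducible_of_dvd (by omega) hC1 (hC1.not_subset hC2 hne) hp1 hp2 hp10 hp20
      ((MulEquiv.irreducible_iff (univariateEquiv n x).symm).2 hq) hq1 hq2
  · obtain ⟨a, b, -, -, hab⟩ := Polynomial.exists_mul_add_mul_eq_C_resultant
      (toUnivariate n x p1) (toUnivariate n x p2) le_rfl le_rfl
      (Or.inl (hC1.natDegree_toUnivariate_ne_zero hx.1 hp1))
    have hcomb : ofRemaining n x
        (Polynomial.resultant (toUnivariate n x p1) (toUnivariate n x p2)) =
        p1 * (univariateEquiv n x).symm a + p2 * (univariateEquiv n x).symm b := by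
      apply (univariateEquiv n x).injective
      rw [univariateEquiv_ofRemaining, ← hab]
      rw [map_add, map_mul, map_mul, AlgEquiv.apply_symm_apply, AlgEquiv.apply_symm_apply,
        univariateEquiv_apply, univariateEquiv_apply]
    have hmem := (cmIdeal n).add_mem
      ((cmIdeal n).mul_mem_right ((univariateEquiv n x).symm a) hp1.mem_cmIdeal)
      ((cmIdeal n).mul_mem_right ((univariateEquiv n x).symm b) hp2.mem_cmIdeal)
    rw [← hcomb] at hmem
    have hsupp : ofRemaining n x
        (Polynomial.resultant (toUnivariate n x p1) (toUnivariate n x p2)) ∈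
        MvPolynomial.supported ℚ ((C1 ∪ C2) \ {x}) := by
      rw [← resultant_eq_polynomial_resultant]
      exact ofRemaining_mem_supported (resultant_mem_of_coeff_mem _
        (coeff_toUnivariate_mem_supported
          (MvPolynomial.supported_mono Set.subset_union_left hp1.1))
        (coeff_toUnivariate_mem_supported
          (MvPolynomial.supported_mono Set.subset_union_right hp2.1)))
    obtain ⟨r, -, hr⟩ := (hp.2 _ hsupp).1 hmem
    exact Dvd.intro_left r hr.symm

end
end
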